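/- Let Φ and Ψ be linear flows on X = ℝ^d. Then Φ ~^{0⁺} Ψ if and only if both of the following hold: (a) there exist a homeomorphism h : X_H^Φ → X_H^Ψ with h(0) = 0 such that h and h⁻¹ satisfy a β-Hölder condition near 0 for some β > 0, and α ∈ ℝ∖{0}, with h(Φ_t x) = Ψ_{αt} h(x) for all t ∈ ℝ and x ∈ X_H^Φ; and (b) there exist a linear isomorphism Q : X_C^Φ → X_C^Ψ and α' ∈ ℝ∖{0} with Q Φ_t x = Ψ_{α' t} Q x for all t ∈ ℝ and x ∈ X_C^Φ. -/

import Mathlib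

noncomputable section
namespace LF

open Filter Topology

/-- `ℝ^d` with the Euclidean norm. -/
abbrev Euc (d : ℕ) := EuclideanSpace ℝ (Fin d)

variable {d : ℕ}

/-- The time-`t` map of the linear flow on `ℝ^d` generated by the matrix `A`,
i.e. `x ↦ exp (t A) x`. -/
def linFlow (A : Matrix (Fin d) (Fin d) ℝ) (t : ℝ) (x : Euc d) : Euc d :=
  Matrix.toEuclideanLin (NormedSpace.exp (t • A)) x

/-- The orbit `{Φ_t x : t ∈ ℝ}` of `x` under the linear flow generated by `A`. -/
def flowOrbit (A : Matrix (Fin d) (Fin d) ℝ) (x : Euc d) : Set (Euc d) :=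
  Set.range fun t : ℝ => linFlow A t x

/-- `Φ` is `h`-related to `Ψ`: the homeomorphism `h` maps every orbit of the flow
generated by `A` onto an orbit of the flow generated by `B`. -/
def IsOrbitEquiv (A B : Matrix (Fin d) (Fin d) ℝ) (h : Euc d ≃ₜ Euc d) : Prop :=
  ∀ x : Euc d, h '' flowOrbit A x = flowOrbit B (h x)

/-- `f` satisfies a `β`-Hölder condition on some ball centred at `0`. -/
def HolderNearZero (β : ℝ) (f : Euc d → Euc d) : Prop :=
  ∃ r > (0 : ℝ), ∃ K : ℝ, ∀ x ∈ Metric.ball (0 : Euc d) r, ∀ y ∈ Metric.ball (0 : Euc d) r,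
    dist (f x) (f y) ≤ K * dist x y ^ β

/-- `h ∈ 𝓗_β`: `h 0 = 0` and `h`, `h⁻¹` both satisfy a `β`-Hölder condition near `0`. -/
def MemHolderClass (β : ℝ) (h : Euc d ≃ₜ Euc d) : Prop :=
  h 0 = 0 ∧ HolderNearZero β ⇑h ∧ HolderNearZero β ⇑h.symm

/-- `h ∈ 𝓗_0`: homeomorphisms fixing `0`. -/
def MemH0 (h : Euc d ≃ₜ Euc d) : Prop := h 0 = 0

/-- `h ∈ 𝓗_{0⁺} = ⋃_{γ>0} 𝓗_γ`. -/
def MemH0plus (h : Euc d ≃ₜ Euc d) : Prop := ∃ γ : ℝ, 0 < γ ∧ MemHolderClass γ h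

/-- `h ∈ 𝓗_{1⁻} = ⋂_{0<γ<1} 𝓗_γ`. -/
def MemH1minus (h : Euc d ≃ₜ Euc d) : Prop := ∀ γ : ℝ, 0 < γ → γ < 1 → MemHolderClass γ h

/-- `h ∈ 𝓗_{β⁻} = ⋂_{0<γ<β} 𝓗_γ`. -/
def MemHBelow (β : ℝ) (h : Euc d ≃ₜ Euc d) : Prop :=
  ∀ γ : ℝ, 0 < γ → γ < β → MemHolderClass γ h

/-- `h ∈ 𝓗_{β⁺} = ⋃_{γ>β} 𝓗_γ`. -/
def MemHAbove (β : ℝ) (h : Euc d ≃ₜ Euc d) : Prop :=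
  ∃ γ : ℝ, β < γ ∧ MemHolderClass γ h

/-- `φ ~^⋆ ψ`: `φ` is `h`-related to `ψ` for some `h` in the class `P`. -/
def RelEquivWith (P : (Euc d ≃ₜ Euc d) → Prop) (A B : Matrix (Fin d) (Fin d) ℝ) : Prop :=
  ∃ h : Euc d ≃ₜ Euc d, P h ∧ IsOrbitEquiv A B h

/-- `φ ≃^⋆ ψ`: there are `h` in the class `P` and `α ≠ 0` with
`h (φ t x) = ψ (α t) (h x)` for all `t`, `x`. -/
def SimEquivWith (P : (Euc d ≃ₜ Euc d) → Prop) (A B : Matrix (Fin d) (Fin d) ℝ) : Prop :=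
  ∃ (h : Euc d ≃ₜ Euc d) (α : ℝ), α ≠ 0 ∧ P h ∧
    ∀ (t : ℝ) (x : Euc d), h (linFlow A t x) = linFlow B (α * t) (h x)

/-- The stable set `X_S^Φ = {x : Φ_t x → 0 as t → ∞}`. -/
def stableSet (A : Matrix (Fin d) (Fin d) ℝ) : Set (Euc d) :=
  {x | Tendsto (fun t : ℝ => linFlow A t x) atTop (𝓝 0)}

/-- The unstable set `X_U^Φ = {x : Φ_t x → 0 as t → -∞}`. -/
def unstableSet (A : Matrix (Fin d) (Fin d) ℝ) : Set (Euc d) :=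
  {x | Tendsto (fun t : ℝ => linFlow A t x) atBot (𝓝 0)}

/-- The central set `X_C^Φ = {x : e^{-ε|t|} Φ_t x → 0 as |t| → ∞, for every ε > 0}`. -/
def centralSet (A : Matrix (Fin d) (Fin d) ℝ) : Set (Euc d) :=
  {x | ∀ ε > (0 : ℝ),
    Tendsto (fun t : ℝ => Real.exp (-(ε * |t|)) • linFlow A t x) (atBot ⊔ atTop) (𝓝 0)}

/-- The stable subspace of the flow generated by `A` (the stable set is a subspace,
so taking its span is innocuous). -/
def XS (A : Matrix (Fin d) (Fin d) ℝ) : Submodule ℝ (Euc d) := Submodule.span ℝ (stableSet A)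

/-- The unstable subspace. -/
def XU (A : Matrix (Fin d) (Fin d) ℝ) : Submodule ℝ (Euc d) := Submodule.span ℝ (unstableSet A)

/-- The central subspace. -/
def XC (A : Matrix (Fin d) (Fin d) ℝ) : Submodule ℝ (Euc d) := Submodule.span ℝ (centralSet A)

/-- The hyperbolic subspace `X_H^Φ = X_S^Φ ⊕ X_U^Φ`. -/
def XH (A : Matrix (Fin d) (Fin d) ℝ) : Submodule ℝ (Euc d) := XS A ⊔ XU A

def dimS (A : Matrix (Fin d) (Fin d) ℝ) : ℕ := Module.finrank ℝ (XS A)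
def dimU (A : Matrix (Fin d) (Fin d) ℝ) : ℕ := Module.finrank ℝ (XU A)
def dimHyp (A : Matrix (Fin d) (Fin d) ℝ) : ℕ := Module.finrank ℝ (XH A)

/-- The central-part generators `A^{Φ_C}` and `α A^{Ψ_C}` are similar, i.e.
`Q A_C = (α B_C) Q` for some linear isomorphism `Q : X_C^Φ → X_C^Ψ`. -/
def IsCentralSimilar (A B : Matrix (Fin d) (Fin d) ℝ) (α : ℝ) : Prop :=
  ∃ (hA : ∀ x ∈ XC A, Matrix.toEuclideanLin A x ∈ XC A)
    (hB : ∀ x ∈ XC B, Matrix.toEuclideanLin B x ∈ XC B)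
    (Q : XC A ≃ₗ[ℝ] XC B),
    ∀ x : XC A, Q ((Matrix.toEuclideanLin A).restrict hA x)
      = α • (Matrix.toEuclideanLin B).restrict hB (Q x)

/-- The forward Lyapunov exponent `λ_+^Φ(x) = lim_{t→∞} log ‖Φ_t x‖ / t`
(the limit exists for `x ≠ 0`, so it equals the `limsup` used here). -/
def lyap (A : Matrix (Fin d) (Fin d) ℝ) (x : Euc d) : ℝ :=
  Filter.limsup (fun t : ℝ => Real.log ‖linFlow A t x‖ / t) atTop

/-- The Lyapunov space `L^Φ(s) = {x : λ_+^Φ(x) ≤ s}` (with `λ_+^Φ(0) = -∞`), as a set. -/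
def lyapSet (A : Matrix (Fin d) (Fin d) ℝ) (s : ℝ) : Set (Euc d) :=
  {x | x = 0 ∨ lyap A x ≤ s}

/-- `ℓ^Φ(s) = dim L^Φ(s)` (the Lyapunov set is a subspace, so taking its span is innocuous). -/
def ell (A : Matrix (Fin d) (Fin d) ℝ) (s : ℝ) : ℕ :=
  Module.finrank ℝ (Submodule.span ℝ (lyapSet A s))

/-- The `(j+1)`-st smallest Lyapunov exponent `λ_{j+1}^Φ`, counted with multiplicity. -/
def lyapExp (A : Matrix (Fin d) (Fin d) ℝ) (j : ℕ) : ℝ :=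
  sInf {s : ℝ | j + 1 ≤ ell A s}

/-- The Lyapunov space at `s` of the restriction of the flow to the invariant set `V`. -/
def lyapSetIn (A : Matrix (Fin d) (Fin d) ℝ) (V : Set (Euc d)) (s : ℝ) : Set (Euc d) :=
  {x | x ∈ V ∧ (x = 0 ∨ lyap A x ≤ s)}

def ellIn (A : Matrix (Fin d) (Fin d) ℝ) (V : Set (Euc d)) (s : ℝ) : ℕ :=
  Module.finrank ℝ (Submodule.span ℝ (lyapSetIn A V s))

/-- The `(j+1)`-st smallest Lyapunov exponent of the flow restricted to `V`. -/
def lyapExpIn (A : Matrix (Fin d) (Fin d) ℝ) (V : Set (Euc d)) (j : ℕ) : ℝ :=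
  sInf {s : ℝ | j + 1 ≤ ellIn A V s}

/-- `λ_{j+1}^{Φ_H}`: the `(j+1)`-st smallest Lyapunov exponent of the restriction
of the flow to the hyperbolic subspace. -/
def lyapExpH (A : Matrix (Fin d) (Fin d) ℝ) (j : ℕ) : ℝ :=
  lyapExpIn A (XH A) j

/-- The flow generated by `A` is stable: every orbit tends to `0` as `t → ∞`. -/
def IsStable (A : Matrix (Fin d) (Fin d) ℝ) : Prop := ∀ x : Euc d, x ∈ stableSet A

/-- The flow generated by `A` is unstable: every orbit tends to `0` as `t → -∞`. -/
def IsUnstable (A : Matrix (Fin d) (Fin d) ℝ) : Prop := ∀ x : Euc d, x ∈ unstableSet A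

/-- The flow generated by `A` is hyperbolic: `X = X_S ⊕ X_U`. -/
def IsHyperbolic (A : Matrix (Fin d) (Fin d) ℝ) : Prop := IsCompl (XS A) (XU A)

/-- `ρ_+(Φ,Ψ) = (min_j λ_j^Φ/λ_j^Ψ) / |max_j λ_j^Φ/λ_j^Ψ|`. -/
def rhoPlus (A B : Matrix (Fin d) (Fin d) ℝ) : ℝ :=
  (⨅ j : Fin d, lyapExp A j / lyapExp B j) / |⨆ j : Fin d, lyapExp A j / lyapExp B j|

/-- The Lyapunov cross ratio `ρ(Φ,Ψ) = max {ρ_+(Φ,Ψ), ρ_+(Φ*,Ψ)}`, where `Φ*` is the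
time-reversal of `Φ`, generated by `-A`. -/
def rho (A B : Matrix (Fin d) (Fin d) ℝ) : ℝ := max (rhoPlus A B) (rhoPlus (-A) B)

/-- The minimal period `T_x^Φ = inf {t > 0 : Φ_t x = x} ∈ [0,∞]` (with `inf ∅ = ∞`). -/
def minPeriod (A : Matrix (Fin d) (Fin d) ℝ) (x : Euc d) : EReal :=
  sInf {T : EReal | ∃ t : ℝ, 0 < t ∧ linFlow A t x = x ∧ T = (t : EReal)}

/-- The set of complex eigenvalues of the real matrix `A`. -/
def cSpec {n : ℕ} (A : Matrix (Fin n) (Fin n) ℝ) : Set ℂ :=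
  spectrum ℂ (A.map Complex.ofReal)

/-- `x` is a fixed point of the flow generated by `A`. -/
def IsFixedPt (A : Matrix (Fin d) (Fin d) ℝ) (x : Euc d) : Prop :=
  ∀ t : ℝ, linFlow A t x = x

/-- The nilpotent `m × m` Jordan block `J_m` (ones on the superdiagonal). -/
def jordanNil (m : ℕ) : Matrix (Fin m) (Fin m) ℝ :=
  Matrix.of fun i j => if (i : ℕ) + 1 = (j : ℕ) then 1 else 0

/-- A `β`-Hölder condition near `0` for a map between subspaces of `ℝ^d`. -/
def HolderNearZeroS {V W : Submodule ℝ (Euc d)} (β : ℝ) (f : ↥V → ↥W) : Prop :=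
  ∃ r > (0 : ℝ), ∃ K : ℝ, ∀ x y : ↥V, dist x 0 < r → dist y 0 < r →
    dist (f x) (f y) ≤ K * dist x y ^ β


section Dim
open MeasureTheory Metric

lemma det_interp (n : ℕ) (ε : ℝ) (hε : 0 < ε) : ∃ (v c : Fin (n+1) → ℝ), (∀ i, 0 < v i ∧ v i ≤ ε) ∧
    ∀ p : Polynomial ℝ, p.natDegree ≤ n → p.eval 1 = ∑ i, c i * p.eval (v i) := by
  let v : Fin (n+1) → ℝ := fun i => ε / ((i : ℝ) + 1)
  have hinj : Set.InjOn v (Finset.univ : Finset (Fin (n+1))) := by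
    intro i _ j _ h
    simp only [v] at h
    have h1 : (0:ℝ) < (i : ℝ) + 1 := by positivity
    have h2 : (0:ℝ) < (j : ℝ) + 1 := by positivity
    rw [div_eq_div_iff h1.ne' h2.ne'] at h
    have h3 := mul_left_cancel₀ hε.ne' h
    ext
    have : (i : ℝ) = j := by linarith
    exact_mod_cast this
  refine ⟨v, fun i => (Lagrange.basis Finset.univ v i).eval 1, fun i => ⟨by positivity, ?_⟩, fun p hp => ?_⟩
  · rw [div_le_iff₀ (by positivity)]
    have : (0:ℝ) ≤ (i : ℝ) := by positivity
    nlinarith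
  · have h := Lagrange.eq_interpolate (f := p) hinj (by
      refine (Polynomial.degree_le_natDegree).trans_lt ?_
      simp
      exact_mod_cast Nat.lt_succ_of_le hp)
    conv_lhs => rw [h]
    rw [Lagrange.interpolate_apply, Polynomial.eval_finset_sum]
    refine Finset.sum_congr rfl fun i _ => ?_
    simp [mul_comm]

variable {E : Type*} [NormedAddCommGroup E] [InnerProductSpace ℝ E] [FiniteDimensional ℝ E]

lemma det_poly (M : E →L[ℝ] E) : ∃ p : Polynomial ℝ, p.natDegree ≤ Module.finrank ℝ E ∧
    ∀ t : ℝ, p.eval t = (1 + t • M : E →L[ℝ] E).det := by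
  let b := Module.finBasis ℝ E
  let A := LinearMap.toMatrix b b (M : E →ₗ[ℝ] E)
  refine ⟨Matrix.det ((Polynomial.X : Polynomial ℝ) • A.map Polynomial.C + (1 : Matrix _ _ ℝ).map Polynomial.C),
    (Polynomial.natDegree_det_X_add_C_le A 1).trans (by simp), fun t => ?_⟩
  rw [ContinuousLinearMap.det, ← LinearMap.det_toMatrix b]
  have e : ((1 + t • M : E →L[ℝ] E) : E →ₗ[ℝ] E) = LinearMap.id + t • (M : E →ₗ[ℝ] E) := by
    ext x; simp
  rw [e, map_add, map_smul, LinearMap.toMatrix_id, ← Polynomial.coe_evalRingHom, RingHom.map_det]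
  congr 1
  ext i j
  simp [A, Matrix.one_apply]
  split_ifs <;> simp [add_comm, mul_comm]

lemma cross {x y : E} (hx : ‖x‖ ≤ 1) (hy : 1 ≤ ‖y‖) : ∃ z, ‖z‖ = 1 ∧ ‖x - z‖ ≤ ‖x - y‖ := by
  have hc : Continuous fun t : ℝ => ‖x + t • (y - x)‖ := by fun_prop
  obtain ⟨t, ht, h⟩ := intermediate_value_Icc (zero_le_one' ℝ) hc.continuousOn
    (show (1:ℝ) ∈ Set.Icc _ _ by simpa using ⟨hx, hy⟩)
  refine ⟨_, h, ?_⟩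
  rw [sub_add_cancel_left, norm_neg, norm_smul, Real.norm_of_nonneg ht.1, norm_sub_rev]
  exact mul_le_of_le_one_left (norm_nonneg _) ht.2

lemma no_retract (r : E → E) (hr : ContDiff ℝ 1 r) (hn : ∀ x, ‖x‖ ≤ 1 → ‖r x‖ = 1) 
    (hs : ∀ x, ‖x‖ = 1 → r x = x) : False := by
  borelize E
  set w : E → E := fun x => r x - x with hw
  have hwc : ContDiff ℝ 1 w := hr.sub contDiff_id
  have hDc : Continuous (fderiv ℝ w) := hwc.continuous_fderiv one_ne_zero
  have hwd : ∀ x, HasFDerivAt w (fderiv ℝ w x) x := fun x =>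
    (hwc.differentiable one_ne_zero x).hasFDerivAt
  obtain ⟨C0, hC0⟩ := (isCompact_closedBall (0 : E) 1).exists_bound_of_continuousOn hDc.continuousOn
  set C := |C0| + 1
  have hC : 0 < C := by positivity
  have hCb : ∀ x, ‖x‖ ≤ 1 → ‖fderiv ℝ w x‖ ≤ C := fun x hx =>
    (hC0 x (by simpa using hx)).trans (by have := le_abs_self C0; linarith)
  have hlip : ∀ x y, ‖x‖ ≤ 1 → ‖y‖ ≤ 1 → ‖w x - w y‖ ≤ C * ‖x - y‖ := by
    intro x y hx hy
    refine (convex_closedBall (0:E) 1).norm_image_sub_le_of_norm_hasFDerivWithin_le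
      (fun z _ => (hwd z).hasFDerivWithinAt) (fun z hz => hCb z (by simpa using hz))
      (by simpa using hy) (by simpa using hx)
  classical
  set W : E → E := fun x => if ‖x‖ ≤ 1 then w x else 0 with hW
  have hWlip : ∀ x y, ‖W x - W y‖ ≤ C * ‖x - y‖ := by
    have key : ∀ x y, ‖x‖ ≤ 1 → ¬ ‖y‖ ≤ 1 → ‖w x‖ ≤ C * ‖x - y‖ := by
      intro x y hx hy
      obtain ⟨z, hz, hxz⟩ := cross hx (not_le.1 hy).le
      have h1 := hlip x z hx hz.le
      have : w z = 0 := by simp [hw, hs z hz]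
      rw [this, sub_zero] at h1
      exact h1.trans (by gcongr)
    intro x y
    by_cases hx : ‖x‖ ≤ 1 <;> by_cases hy : ‖y‖ ≤ 1
    · simpa [hW, hx, hy] using hlip x y hx hy
    · simpa [hW, hx, hy] using key x y hx hy
    · rw [norm_sub_rev x y]; simpa [hW, hx, hy] using key y x hy hx
    · simp [hW, hx, hy]; positivity
  -- small t
  have hsmall : ∀ t, 0 < t → t ≤ 1 / (2 * C) →
      ∫ x in ball (0:E) 1, (1 + t • fderiv ℝ w x : E →L[ℝ] E).det = (volume (ball (0:E) 1)).toReal := by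
    intro t ht ht2
    have htC : t * C ≤ 1 / 2 := by
      rw [le_div_iff₀ (by positivity)] at ht2; linarith
    set f : E → E := fun x => x + t • W x with hf
    have hfl : ∀ x y, ‖x - y‖ ≤ 2 * ‖f x - f y‖ := by
      intro x y
      have e : x - y = (f x - f y) - t • (W x - W y) := by
        simp only [hf, smul_sub]; abel
      have h1 : ‖x - y‖ ≤ ‖f x - f y‖ + ‖t • (W x - W y)‖ := by
        conv_lhs => rw [e]
        exact norm_sub_le _ _
      rw [norm_smul, Real.norm_of_nonneg ht.le] at h1
      have h2 : t * ‖W x - W y‖ ≤ t * (C * ‖x - y‖) := by gcongr; exact hWlip x y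
      nlinarith [norm_nonneg (x - y)]
    have hinj : Function.Injective f := by
      intro x y hxy
      have := hfl x y
      rw [hxy] at this
      simp at this
      exact sub_eq_zero.1 this
    have hsurj : Function.Surjective f := by
      intro y
      have hK : ContractingWith (1/2 : NNReal) (fun x => y - t • W x) := by
        refine ⟨by rw [← NNReal.coe_lt_coe]; norm_num, LipschitzWith.of_dist_le_mul fun a b => ?_⟩
        rw [dist_eq_norm, dist_eq_norm]
        have : y - t • W a - (y - t • W b) = t • (W b - W a) := by rw [smul_sub]; abel
        rw [this, norm_smul, Real.norm_of_nonneg ht.le, norm_sub_rev]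
        have h2 : t * ‖W a - W b‖ ≤ t * (C * ‖a - b‖) := by gcongr; exact hWlip a b
        push_cast
        nlinarith [norm_nonneg (a - b)]
      refine ⟨hK.fixedPoint, ?_⟩
      have := hK.fixedPoint_isFixedPt
      rw [Function.IsFixedPt] at this
      simp only [hf]
      conv_lhs => enter [1]; rw [← this]
      abel
    have hout : ∀ x, 1 ≤ ‖x‖ → f x = x := by
      intro x hx
      rcases hx.eq_or_lt with h | h
      · simp [hf, hW, h.symm.le, hw, hs x h.symm]
      · simp [hf, hW, not_le.2 h]
    have hnorm : ∀ x, ‖x‖ < 1 → ‖f x‖ < 1 := by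
      intro x hx
      by_contra hc
      push Not at hc
      have h2 := hinj (hout _ hc)
      rw [h2] at hc
      exact absurd hx (not_lt.2 hc)
    have himg : f '' ball 0 1 = ball 0 1 := by
      ext y
      constructor
      · rintro ⟨x, hx, rfl⟩
        simpa using hnorm x (by simpa using hx)
      · intro hy
        obtain ⟨x, rfl⟩ := hsurj y
        refine ⟨x, ?_, rfl⟩
        by_contra hc
        simp at hc hy
        rw [hout x hc] at hy
        linarith
    have hder : ∀ x ∈ ball (0:E) 1, HasFDerivWithinAt f (1 + t • fderiv ℝ w x) (ball 0 1) x := by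
      intro x hx
      refine HasFDerivAt.hasFDerivWithinAt ?_
      have h1 : HasFDerivAt (fun x => x + t • w x) (ContinuousLinearMap.id ℝ E + t • fderiv ℝ w x) x :=
        (hasFDerivAt_id x).add ((hwd x).const_smul t)
      refine HasFDerivAt.congr_of_eventuallyEq h1 ?_
      filter_upwards [isOpen_ball.mem_nhds hx] with z hz
      have : ‖z‖ ≤ 1 := by simpa using (mem_ball.1 hz).le
      simp [hf, hW, this]
    have hpos : ∀ x ∈ ball (0:E) 1, 0 < (1 + t • fderiv ℝ w x : E →L[ℝ] E).det := by
      intro x hx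
      have hx1 : ‖x‖ ≤ 1 := by simpa using (mem_ball.1 hx).le
      obtain ⟨p, -, hp⟩ := det_poly (fderiv ℝ w x)
      by_contra hc
      push Not at hc
      rw [← hp] at hc
      have h0 : (0:ℝ) ≤ p.eval 0 := by rw [hp]; simp [ContinuousLinearMap.det]
      obtain ⟨u, hu, hu0⟩ := intermediate_value_Icc' ht.le p.continuous.continuousOn ⟨hc, h0⟩
      simp only at hu0
      rw [hp] at hu0
      obtain ⟨v, hv, hv0⟩ := Submodule.exists_mem_ne_zero_of_ne_bot
        (LinearMap.bot_lt_ker_of_det_eq_zero hu0).ne'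
      have hv1 : v + u • fderiv ℝ w x v = 0 := by simpa using hv
      have hv2 : ‖v‖ = u * ‖fderiv ℝ w x v‖ := by
        have := eq_neg_of_add_eq_zero_left hv1
        conv_lhs => rw [this]
        rw [norm_neg, norm_smul, Real.norm_of_nonneg hu.1]
      have hv3 : ‖fderiv ℝ w x v‖ ≤ C * ‖v‖ :=
        ((fderiv ℝ w x).le_opNorm v).trans (by gcongr; exact hCb x hx1)
      have hv4 : 0 < ‖v‖ := norm_pos_iff.2 hv0
      have : u * ‖fderiv ℝ w x v‖ ≤ t * (C * ‖v‖) := by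
        gcongr
        · exact hu.2
      nlinarith
    have h3 := integral_image_eq_integral_abs_det_fderiv_smul volume measurableSet_ball hder
      hinj.injOn (fun _ => (1:ℝ))
    rw [himg] at h3
    simp only [smul_eq_mul, mul_one, integral_const] at h3
    rw [show (volume (ball (0:E) 1)).toReal = volume.real (ball (0:E) 1) from rfl]
    rw [measureReal_restrict_apply_univ] at h3
    rw [h3]
    refine setIntegral_congr_fun measurableSet_ball fun x hx => ?_
    rw [abs_of_pos (hpos x hx)]
  obtain ⟨v, c, hv, hp⟩ := det_interp (Module.finrank ℝ E) (1 / (2 * C)) (by positivity)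
  have hc1 : ∑ i, c i = 1 := by
    have := hp 1 (by simp)
    simpa using this.symm
  have hdet0 : ∀ x ∈ ball (0:E) 1, (1 + (1:ℝ) • fderiv ℝ w x : E →L[ℝ] E).det = 0 := by
    intro x hx
    have hd : (1 + (1:ℝ) • fderiv ℝ w x : E →L[ℝ] E) = fderiv ℝ r x := by
      have : r = fun x => x + w x := by funext x; simp [hw]
      rw [one_smul]
      refine HasFDerivAt.unique (f := r) ?_ (hr.differentiable one_ne_zero x).hasFDerivAt
      rw [this]
      exact (hasFDerivAt_id x).add (hwd x)
    rw [hd]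
    by_contra hne
    have hD : HasFDerivAt r (fderiv ℝ r x) x := (hr.differentiable one_ne_zero x).hasFDerivAt
    have hin := hD.norm_sq
    have hconst : HasFDerivAt (fun x => ‖r x‖ ^ 2) (0 : E →L[ℝ] ℝ) x := by
      refine (hasFDerivAt_const (1:ℝ) x).congr_of_eventuallyEq ?_
      filter_upwards [isOpen_ball.mem_nhds hx] with z hz
      rw [hn z (by simpa using (mem_ball.1 hz).le)]; simp
    have h0 := hin.unique hconst
    let e := LinearMap.equivOfDetNeZero (fderiv ℝ r x : E →ₗ[ℝ] E) hne
    obtain ⟨z, hz⟩ := e.surjective (r x)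
    have hz' : fderiv ℝ r x z = r x := hz
    have := congrArg (fun L : E →L[ℝ] ℝ => L z) h0
    simp [hz'] at this
    have h1 := hn x (by simpa using (mem_ball.1 hx).le)
    rw [this] at h1
    simp at h1
  have hintg : ∀ t : ℝ, IntegrableOn (fun x => (1 + t • fderiv ℝ w x : E →L[ℝ] E).det) (ball (0:E) 1) := by
    intro t
    refine IntegrableOn.mono_set ?_ ball_subset_closedBall
    refine ContinuousOn.integrableOn_compact (isCompact_closedBall _ _) (Continuous.continuousOn ?_)
    exact ContinuousLinearMap.continuous_det.comp (continuous_const.add (hDc.const_smul t))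
  have hfin : ∫ x in ball (0:E) 1, (1 + (1:ℝ) • fderiv ℝ w x : E →L[ℝ] E).det =
      (volume (ball (0:E) 1)).toReal := by
    have : ∀ x, (1 + (1:ℝ) • fderiv ℝ w x : E →L[ℝ] E).det =
        ∑ i, c i * (1 + v i • fderiv ℝ w x : E →L[ℝ] E).det := by
      intro x
      obtain ⟨p, hp1, hp2⟩ := det_poly (fderiv ℝ w x)
      simp only [← hp2]
      exact hp p hp1
    simp only [this]
    rw [integral_finsetSum _ (fun i _ => (hintg (v i)).const_mul (c i))]
    simp only [integral_const_mul]
    rw [Finset.sum_congr rfl fun i _ => by rw [hsmall (v i) (hv i).1 (hv i).2]]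
    rw [← Finset.sum_mul, hc1, one_mul]
  rw [setIntegral_congr_fun measurableSet_ball hdet0] at hfin
  simp at hfin
  have hvol : 0 < volume (ball (0:E) 1) := measure_ball_pos _ _ one_pos
  have hvol2 : volume (ball (0:E) 1) < ⊤ := measure_ball_lt_top
  have := ENNReal.toReal_pos hvol.ne' hvol2.ne
  rcases (ENNReal.toReal_eq_zero_iff _).1 (hfin.symm ▸ rfl : (volume (ball (0:E) 1)).toReal = 0) with h | h
  · exact hvol.ne' h
  · exact hvol2.ne h

lemma smooth_approx {E F : Type*} [NormedAddCommGroup E] [NormedSpace ℝ E] [FiniteDimensional ℝ E]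
    [NormedAddCommGroup F] [NormedSpace ℝ F] [FiniteDimensional ℝ F] {f : E → F}
    (hf : Continuous f) {K : Set E} (hK : IsCompact K) {ε : ℝ} (hε : 0 < ε) :
    ∃ g : E → F, ContDiff ℝ 1 g ∧ ∀ x ∈ K, ‖g x - f x‖ < ε := by
  have : ProperSpace E := FiniteDimensional.proper ℝ E
  have : CompleteSpace F := FiniteDimensional.complete ℝ F
  have : UniformContinuousOn f (cthickening 1 K) :=
    hK.cthickening.uniformContinuousOn_of_continuous <| by fun_prop
  rcases Metric.uniformContinuousOn_iff.mp this (ε / 2) (half_pos hε) with ⟨δ, hδ, hfδ⟩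
  rcases hf.exists_contDiff_dist_le_of_forall_mem_ball_dist_le
    (lt_min one_pos hδ) with ⟨g, hgc, hg⟩
  refine ⟨g, hgc.of_le (by exact_mod_cast le_top), fun x hx ↦ ?_⟩
  rw [← dist_eq_norm]
  refine (hg _ _ fun y hy ↦ ?_).trans_lt (half_lt_self hε)
  rw [mem_ball, lt_min_iff] at hy
  exact hfδ _ (mem_cthickening_of_dist_le _ x _ _ hx hy.1.le) _
    (self_subset_cthickening _ hx) hy.2 |>.le

/-- a continuous map near the identity on the ball must vanish somewhere -/
lemma exists_zero_of_near_id {f : E → E} (hf : Continuous f)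
    (h : ∀ x, ‖x‖ ≤ 1 → ‖f x - x‖ ≤ 1 / 4) : ∃ x, ‖x‖ ≤ 1 ∧ f x = 0 := by
  by_contra hc
  push Not at hc
  have hcomp := isCompact_closedBall (0:E) 1
  obtain ⟨δ, hδ, hδb⟩ : ∃ δ > 0, ∀ x, ‖x‖ ≤ 1 → δ ≤ ‖f x‖ := by
    obtain ⟨x0, hx0, hmin⟩ := hcomp.exists_isMinOn ⟨0, by simp⟩ hf.norm.continuousOn
    refine ⟨‖f x0‖, norm_pos_iff.2 (hc x0 (by simpa using hx0)), fun x hx => ?_⟩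
    exact hmin (by simpa using hx : x ∈ closedBall (0:E) 1)
  obtain ⟨g, hg, hgf⟩ := smooth_approx hf hcomp (ε := min δ (1/4)) (by positivity)
  have hg1 : ∀ x, ‖x‖ ≤ 1 → g x ≠ 0 := by
    intro x hx h0
    have := hgf x (by simpa using hx)
    rw [h0, zero_sub, norm_neg] at this
    have h2 := hδb x hx
    have := this.trans_le (min_le_left _ _)
    linarith
  have hg2 : ∀ x, ‖x‖ ≤ 1 → ‖g x - x‖ < 1/2 := by
    intro x hx
    have h1 := (hgf x (by simpa using hx)).trans_le (min_le_right _ _)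
    have h2 := h x hx
    have : g x - x = (g x - f x) + (f x - x) := by abel
    rw [this]
    exact (norm_add_le _ _).trans_lt (by linarith)
  let χ : ContDiffBump (0:E) := ⟨1/2, 3/4, by norm_num, by norm_num⟩
  set F : E → E := fun x => x + χ x • (g x - x) with hF
  have hFc : ContDiff ℝ 1 F := contDiff_id.add (χ.contDiff.smul (hg.sub contDiff_id))
  have hF0 : ∀ x, F x ≠ 0 := by
    intro x
    by_cases hx : ‖x‖ ≤ 1/2
    · have : χ x = 1 := χ.one_of_mem_closedBall (by rw [mem_closedBall_zero_iff]; exact hx)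
      simp only [hF, this, one_smul]
      simpa using hg1 x (by linarith)
    · push Not at hx
      intro h0
      by_cases hx1 : ‖x‖ ≤ 1
      · have h1 : ‖x‖ = ‖χ x • (g x - x)‖ := by
          have := eq_neg_of_add_eq_zero_left h0
          conv_lhs => rw [this]
          rw [norm_neg]
        rw [norm_smul, Real.norm_of_nonneg χ.nonneg] at h1
        have h2 := hg2 x hx1
        have h3 := χ.le_one (x := x)
        nlinarith [norm_nonneg (g x - x), χ.nonneg (x := x)]
      · push Not at hx1
        have : χ x = 0 := χ.zero_of_le_dist (by simpa using (by linarith : (3:ℝ)/4 ≤ ‖x‖))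
        simp [hF, this] at h0
        rw [h0] at hx1
        simp at hx1
        linarith
  refine no_retract (fun x => ‖F x‖⁻¹ • F x) ?_ ?_ ?_
  · exact ((hFc.norm ℝ hF0).inv fun x => norm_ne_zero_iff.2 (hF0 x)).smul hFc
  · intro x _
    rw [norm_smul, norm_inv, norm_norm, inv_mul_cancel₀ (norm_ne_zero_iff.2 (hF0 x))]
  · intro x hx
    have : χ x = 0 := χ.zero_of_le_dist (by simpa using (by linarith : (3:ℝ)/4 ≤ ‖x‖))
    simp [hF, this, hx]

lemma finrank_le_of_inj' {F : Type*} [NormedAddCommGroup F] [NormedSpace ℝ F]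
    [FiniteDimensional ℝ F] (f : E → F) (hf : Continuous f) (hinj : Function.Injective f) :
    Module.finrank ℝ E ≤ Module.finrank ℝ F := by
  by_contra hc
  push Not at hc
  have hcomp := isCompact_closedBall (0:E) 1
  have : CompactSpace (closedBall (0:E) 1) := isCompact_iff_compactSpace.1 hcomp
  let e : closedBall (0:E) 1 → F := fun x => f x
  have he : IsClosedEmbedding e :=
    (hf.comp continuous_subtype_val).isClosedEmbedding (hinj.comp Subtype.val_injective)
  have : TietzeExtension E := TietzeExtension.of_tvs ℝ
  obtain ⟨G, hG⟩ := ContinuousMap.exists_extension' he (⟨Subtype.val, continuous_subtype_val⟩ : C(closedBall (0:E) 1, E))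
  have hG' : ∀ x : E, ‖x‖ ≤ 1 → G (f x) = x := fun x hx =>
    congrFun hG ⟨x, by simpa using hx⟩
  obtain ⟨g, hg, hgG⟩ := smooth_approx G.continuous (hcomp.image hf) (ε := 1/8) (by norm_num)
  have hd := hg.dense_compl_range_of_finrank_lt_finrank hc
  obtain ⟨c, hc1, hc2⟩ := hd.exists_mem_open (isOpen_ball (x := (0:E)) (ε := 1/8)) ⟨0, by simp⟩
  obtain ⟨x, hx, hx0⟩ := exists_zero_of_near_id (f := fun x => g (f x) - c)
    ((hg.continuous.comp hf).sub continuous_const) (fun x hx => by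
      have h1 := hgG (f x) ⟨x, by simpa using hx, rfl⟩
      rw [hG' x hx] at h1
      have : g (f x) - c - x = (g (f x) - x) - c := by abel
      rw [this]
      have h2 : ‖c‖ < 1/8 := by simpa using hc2
      exact (norm_sub_le _ _).trans (by linarith))
  exact hc1 ⟨f x, sub_eq_zero.1 hx0⟩

lemma finrank_le_of_inj {E F : Type*} [NormedAddCommGroup E] [NormedSpace ℝ E]
    [FiniteDimensional ℝ E] [NormedAddCommGroup F] [NormedSpace ℝ F]
    [FiniteDimensional ℝ F] (f : E → F) (hf : Continuous f) (hinj : Function.Injective f) :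
    Module.finrank ℝ E ≤ Module.finrank ℝ F := by
  have e : EuclideanSpace ℝ (Fin (Module.finrank ℝ E)) ≃L[ℝ] E :=
    ContinuousLinearEquiv.ofFinrankEq (by simp)
  have := finrank_le_of_inj' (f ∘ e) (hf.comp e.continuous) (hinj.comp e.injective)
  simpa using this

end Dim


section Sim
open Polynomial

/-- kernel of `p` intersected with range of `p^k` -/
def Gs (p : ℝ[X]) (k : ℕ) (M : Type*) [AddCommGroup M] [Module ℝ[X] M] : Submodule ℝ[X] M where
  carrier := {x | p • x = 0 ∧ ∃ y, p ^ k • y = x}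
  zero_mem' := ⟨smul_zero _, 0, smul_zero _⟩
  add_mem' := by
    rintro x y ⟨h1, u, rfl⟩ ⟨h2, v, rfl⟩
    exact ⟨by rw [smul_add, h1, h2, add_zero], u + v, smul_add _ _ _⟩
  smul_mem' := by
    rintro c x ⟨h1, u, rfl⟩
    exact ⟨by rw [smul_comm, h1, smul_zero], c • u, smul_comm _ _ _⟩

lemma mem_Gs {p : ℝ[X]} {k : ℕ} {M : Type*} [AddCommGroup M] [Module ℝ[X] M] {x : M} :
    x ∈ Gs p k M ↔ p • x = 0 ∧ ∃ y, p ^ k • y = x := Iff.rfl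

lemma Gs_congr {M N : Type*} [AddCommGroup M] [Module ℝ[X] M] [AddCommGroup N] [Module ℝ[X] N]
    [Module ℝ M] [Module ℝ N] [IsScalarTower ℝ ℝ[X] M] [IsScalarTower ℝ ℝ[X] N]
    (e : M ≃ₗ[ℝ[X]] N) (p : ℝ[X]) (k : ℕ) :
    Module.finrank ℝ (Gs p k M) = Module.finrank ℝ (Gs p k N) := by
  have h : (Gs p k M).map e.toLinearMap = Gs p k N := by
    ext x
    constructor
    · rintro ⟨y, ⟨h1, u, rfl⟩, rfl⟩
      refine ⟨?_, e u, ?_⟩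
      · change p • e _ = 0
        rw [← map_smul, h1, map_zero]
      · exact (map_smul e _ _).symm
    · rintro ⟨h1, u, rfl⟩
      refine ⟨e.symm (p ^ k • u), ⟨?_, e.symm u, ?_⟩, by simp⟩
      · rw [← map_smul, h1, map_zero]
      · exact (map_smul e.symm _ _).symm
  have := ((e.submoduleMap (Gs p k M)).restrictScalars ℝ).finrank_eq
  rw [this, h]

lemma Gs_pi {ι : Type*} [Fintype ι] (N : ι → Type*) [∀ i, AddCommGroup (N i)]
    [∀ i, Module ℝ[X] (N i)] [∀ i, Module ℝ (N i)] [∀ i, IsScalarTower ℝ ℝ[X] (N i)]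
    [∀ i, FiniteDimensional ℝ (N i)] (p : ℝ[X]) (k : ℕ) :
    Module.finrank ℝ (Gs p k (∀ i, N i)) = ∑ i, Module.finrank ℝ (Gs p k (N i)) := by
  have hfd : ∀ i, FiniteDimensional ℝ (Gs p k (N i)) := fun i =>
    Module.Finite.of_injective ((Gs p k (N i)).subtype.restrictScalars ℝ)
      (Submodule.subtype_injective _)
  rw [← Module.finrank_pi_fintype ℝ]
  let e : Gs p k (∀ i, N i) ≃ₗ[ℝ] (∀ i, Gs p k (N i)) :=
    { toFun := fun x i => ⟨x.1 i, by
        obtain ⟨h1, u, h2⟩ := x.2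
        exact ⟨congrFun h1 i, u i, congrFun h2 i⟩⟩
      invFun := fun y => ⟨fun i => (y i).1, by
        choose h u hu using fun i => (y i).2
        exact ⟨funext h, u, funext hu⟩⟩
      map_add' := fun x y => rfl
      map_smul' := fun c x => rfl
      left_inv := fun x => rfl
      right_inv := fun x => rfl }
  exact e.finrank_eq

abbrev Cy (q : ℝ[X]) (e : ℕ) := ℝ[X] ⧸ Submodule.span ℝ[X] {q ^ e}

lemma Cy_mk_smul (q : ℝ[X]) (e : ℕ) (p x : ℝ[X]) :
    p • (Submodule.Quotient.mk x : Cy q e) = Submodule.Quotient.mk (p * x) := rfl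

lemma Cy_eq_zero {q : ℝ[X]} {e : ℕ} {x : ℝ[X]} :
    (Submodule.Quotient.mk x : Cy q e) = 0 ↔ q ^ e ∣ x := by
  rw [Submodule.Quotient.mk_eq_zero, Submodule.mem_span_singleton]
  constructor
  · rintro ⟨a, rfl⟩; exact ⟨a, by simp [mul_comm]⟩
  · rintro ⟨a, rfl⟩; exact ⟨a, by simp [mul_comm]⟩

lemma Gs_cy_ne {p q : ℝ[X]} (hp : Irreducible p) (hq : Irreducible q) (hpm : p.Monic)
    (hqm : q.Monic) (hne : q ≠ p) (k e : ℕ) : Module.finrank ℝ (Gs p k (Cy q e)) = 0 := by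
  have h : Gs p k (Cy q e) = ⊥ := by
    rw [eq_bot_iff]
    rintro x ⟨h1, -⟩
    obtain ⟨x, rfl⟩ := Submodule.Quotient.mk_surjective _ x
    rw [Cy_mk_smul, Cy_eq_zero] at h1
    have hc : IsCoprime (q ^ e) p := by
      refine IsCoprime.pow_left ?_
      rw [hq.coprime_iff_not_dvd]
      intro hd
      exact hne (eq_of_monic_of_associated hqm hpm (hq.associated_of_dvd hp hd))
    rw [Submodule.mem_bot, Cy_eq_zero]
    exact hc.dvd_of_dvd_mul_left h1
  rw [h]; exact Module.finrank_zero_of_subsingleton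

lemma Gs_cy_le {p : ℝ[X]} {k e : ℕ} (he : e ≤ k) :
    Module.finrank ℝ (Gs p k (Cy p e)) = 0 := by
  have h : Gs p k (Cy p e) = ⊥ := by
    rw [eq_bot_iff]
    rintro x ⟨-, y, rfl⟩
    obtain ⟨y, rfl⟩ := Submodule.Quotient.mk_surjective _ y
    rw [Submodule.mem_bot, Cy_mk_smul, Cy_eq_zero]
    exact (pow_dvd_pow p he).mul_right _
  rw [h]; exact Module.finrank_zero_of_subsingleton

lemma Gs_cy_lt {p : ℝ[X]} (hp : Irreducible p) {k e : ℕ} (he : k < e) :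
    Module.finrank ℝ (Gs p k (Cy p e)) = p.natDegree := by
  let f : ℝ[X] →ₗ[ℝ[X]] Cy p e :=
    (Submodule.mkQ _).comp (LinearMap.mulRight ℝ[X] (p ^ (e - 1)))
  have hf : ∀ x, f x = Submodule.Quotient.mk (x * p ^ (e - 1)) := fun x => rfl
  have hpe : p ^ e = p * p ^ (e - 1) := by
    rw [← pow_succ']; congr 1; omega
  have hp0 : p ^ (e - 1) ≠ 0 := pow_ne_zero _ hp.ne_zero
  have hker : f.ker = Ideal.span {p} := by
    ext x
    rw [LinearMap.mem_ker, hf, Cy_eq_zero, Ideal.mem_span_singleton, hpe]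
    exact mul_dvd_mul_iff_right hp0
  have hran : f.range = Gs p k (Cy p e) := by
    ext x
    constructor
    · rintro ⟨x, rfl⟩
      rw [hf]
      refine ⟨?_, Submodule.Quotient.mk (x * p ^ (e - 1 - k)), ?_⟩
      · rw [Cy_mk_smul, Cy_eq_zero, hpe]; exact ⟨x, by ring⟩
      · rw [Cy_mk_smul]; congr 1
        rw [mul_left_comm, ← pow_add]; congr 2; omega
    · rintro ⟨h1, -⟩
      obtain ⟨x, rfl⟩ := Submodule.Quotient.mk_surjective _ x
      rw [Cy_mk_smul, Cy_eq_zero, hpe, mul_dvd_mul_iff_left hp.ne_zero] at h1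
      obtain ⟨y, rfl⟩ := h1
      exact ⟨y, by rw [hf, mul_comm]⟩
  have h1 := (f.quotKerEquivRange.restrictScalars ℝ).finrank_eq
  rw [← hran, ← h1, hker]
  exact finrank_quotient_span_eq_natDegree

lemma exists_cyc (M : Type*) [AddCommGroup M] [Module ℝ[X] M] [Module ℝ M]
    [IsScalarTower ℝ ℝ[X] M] [FiniteDimensional ℝ M] :
    ∃ (ι : Type) (_ : Fintype ι) (p : ι → ℝ[X]) (e : ι → ℕ), (∀ i, Irreducible (p i)) ∧
      (∀ i, (p i).Monic) ∧ (∀ i, 0 < e i) ∧ Nonempty (M ≃ₗ[ℝ[X]] ∀ i, Cy (p i) (e i)) := by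
  haveI : Module.Finite ℝ[X] M := Module.Finite.of_restrictScalars_finite ℝ ℝ[X] M
  have htor : Module.IsTorsion ℝ[X] M := by
    intro x
    let f : ℝ[X] →ₗ[ℝ] M := (LinearMap.toSpanSingleton ℝ[X] M x).restrictScalars ℝ
    have : ¬ Function.Injective f := fun h => by
      have h1 : FiniteDimensional ℝ ℝ[X] := Module.Finite.of_injective f h
      exact Polynomial.not_finite h1
    rw [← LinearMap.ker_eq_bot, Submodule.eq_bot_iff] at this
    push Not at this
    obtain ⟨q, hq, hq0⟩ := this
    exact ⟨⟨q, mem_nonZeroDivisors_of_ne_zero hq0⟩, hq⟩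
  obtain ⟨ι, _, p, hp, e, ⟨E⟩⟩ := Module.equiv_directSum_of_isTorsion htor
  classical
  refine ⟨{i : ι // 0 < e i}, inferInstance, fun i => normalize (p i), fun i => e i,
    fun i => (normalize_associated (p i)).symm.irreducible (hp i),
    fun i => monic_normalize (hp i).ne_zero, fun i => i.2, ⟨?_⟩⟩
  have E2 := E.trans (DirectSum.linearEquivFunOnFintype ℝ[X] ι _)
  let g : (∀ i, ℝ[X] ⧸ Submodule.span ℝ[X] {p i ^ e i}) →ₗ[ℝ[X]]
      ∀ i : {i : ι // 0 < e i}, ℝ[X] ⧸ Submodule.span ℝ[X] {p i ^ e i} :=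
    LinearMap.pi fun i => LinearMap.proj i.1
  have hg : Function.Bijective g := by
    constructor
    · intro x y hxy
      funext i
      by_cases hi : 0 < e i
      · exact congrFun hxy ⟨i, hi⟩
      · have h0 : e i = 0 := by omega
        obtain ⟨u, hu⟩ := Submodule.Quotient.mk_surjective _ (x i)
        obtain ⟨v, hv⟩ := Submodule.Quotient.mk_surjective _ (y i)
        rw [← hu, ← hv, Submodule.Quotient.eq, h0, pow_zero]
        exact Submodule.mem_span_singleton.2 ⟨u - v, by simp⟩
    · intro y
      refine ⟨fun i => if hi : 0 < e i then y ⟨i, hi⟩ else 0, ?_⟩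
      funext i
      simp [g, i.2]
  refine (E2.trans (LinearEquiv.ofBijective g hg)).trans (LinearEquiv.piCongrRight fun i => ?_)
  refine Submodule.quotEquivOfEq _ _ ?_
  exact Ideal.span_singleton_eq_span_singleton.2 ((normalize_associated (p i)).symm.pow_pow)

lemma equiv_of_Gs (M N : Type*) [AddCommGroup M] [Module ℝ[X] M] [Module ℝ M]
    [IsScalarTower ℝ ℝ[X] M] [FiniteDimensional ℝ M] [AddCommGroup N] [Module ℝ[X] N] [Module ℝ N]
    [IsScalarTower ℝ ℝ[X] N] [FiniteDimensional ℝ N]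
    (h : ∀ p : ℝ[X], p.Monic → Irreducible p → ∀ k,
      Module.finrank ℝ (Gs p k M) = Module.finrank ℝ (Gs p k N)) :
    Nonempty (M ≃ₗ[ℝ[X]] N) := by
  classical
  obtain ⟨ι, _, p, e, hp, hpm, he, ⟨E⟩⟩ := exists_cyc M
  obtain ⟨κ, _, q, f, hq, hqm, hf, ⟨F⟩⟩ := exists_cyc N
  have count : ∀ (ι : Type) [Fintype ι] (p : ι → ℝ[X]) (e : ι → ℕ), (∀ i, Irreducible (p i)) →
      (∀ i, (p i).Monic) → (∀ i, 0 < e i) → ∀ P : ℝ[X], P.Monic → Irreducible P → ∀ k,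
      Module.finrank ℝ (Gs P k (∀ i, Cy (p i) (e i))) =
        P.natDegree * (Finset.univ.filter fun i => p i = P ∧ k < e i).card := by
    intro ι _ p e hp hpm he P hPm hP k
    haveI : ∀ i, FiniteDimensional ℝ (Cy (p i) (e i)) := fun i =>
      ((hpm i).pow (e i)).finite_quotient
    rw [Gs_pi, Finset.card_filter, Finset.mul_sum]
    refine Finset.sum_congr rfl fun i _ => ?_
    by_cases h1 : p i = P
    · subst h1
      by_cases h2 : k < e i
      · rw [Gs_cy_lt hP h2]; simp [h2]
      · rw [Gs_cy_le (not_lt.1 h2)]; simp [h2]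
    · rw [Gs_cy_ne hP (hp i) hPm (hpm i) h1]; simp [h1]
  have hc : ∀ P : ℝ[X], P.Monic → Irreducible P → ∀ k,
      (Finset.univ.filter fun i => p i = P ∧ k < e i).card =
      (Finset.univ.filter fun i => q i = P ∧ k < f i).card := by
    intro P hPm hP k
    have h1 := h P hPm hP k
    rw [Gs_congr E, Gs_congr F, count ι p e hp hpm he P hPm hP,
      count κ q f hq hqm hf P hPm hP] at h1
    exact Nat.eq_of_mul_eq_mul_left hP.natDegree_pos h1
  have split : ∀ (ι : Type) [Fintype ι] (p : ι → ℝ[X]) (e : ι → ℕ) (P : ℝ[X]) (k : ℕ),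
      (Finset.univ.filter fun i => p i = P ∧ k < e i).card =
      (Finset.univ.filter fun i => p i = P ∧ k + 1 < e i).card +
      (Finset.univ.filter fun i => (p i, e i) = (P, k + 1)).card := by
    intro ι _ p e P k
    rw [← Finset.card_union_of_disjoint]
    · congr 1; ext i; simp only [Finset.mem_filter, Finset.mem_univ, true_and, Finset.mem_union,
        Prod.mk.injEq]
      constructor
      · rintro ⟨h, h'⟩
        by_cases h2 : k + 1 < e i
        · exact Or.inl ⟨h, h2⟩
        · exact Or.inr ⟨h, by omega⟩
      · rintro (⟨h, h'⟩ | ⟨h, h'⟩)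
        · exact ⟨h, by omega⟩
        · exact ⟨h, by omega⟩
    · rw [Finset.disjoint_left]; intro i
      simp only [Finset.mem_filter, Finset.mem_univ, true_and, Prod.mk.injEq]
      rintro ⟨h, h'⟩ ⟨h2, h3⟩; omega
  have hfib : ∀ c : ℝ[X] × ℕ, Nonempty ({i // (p i, e i) = c} ≃ {j // (q j, f j) = c}) := by
    rintro ⟨P, k⟩
    by_cases hP : P.Monic ∧ Irreducible P ∧ 0 < k
    · obtain ⟨h1, h2, h3⟩ := hP
      obtain ⟨k, rfl⟩ : ∃ m, k = m + 1 := ⟨k - 1, by omega⟩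
      refine ⟨Fintype.equivOfCardEq ?_⟩
      rw [Fintype.card_subtype, Fintype.card_subtype]
      have e1 := split ι p e P k
      have e2 := split κ q f P k
      have e3 := hc P h1 h2 k
      have e4 := hc P h1 h2 (k + 1)
      omega
    · haveI : IsEmpty {i // (p i, e i) = (P, k)} := ⟨by
        rintro ⟨i, hi⟩
        simp only [Prod.mk.injEq] at hi
        obtain ⟨rfl, rfl⟩ := hi
        exact hP ⟨hpm i, hp i, he i⟩⟩
      haveI : IsEmpty {i // (q i, f i) = (P, k)} := ⟨by
        rintro ⟨i, hi⟩
        simp only [Prod.mk.injEq] at hi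
        obtain ⟨rfl, rfl⟩ := hi
        exact hP ⟨hqm i, hq i, hf i⟩⟩
      exact ⟨Equiv.equivOfIsEmpty _ _⟩
  let σ : ι ≃ κ := Equiv.ofFiberEquiv fun c => (hfib c).some
  have hσ : ∀ i, (q (σ i), f (σ i)) = (p i, e i) := fun i =>
    Equiv.ofFiberEquiv_map (f := fun i => (p i, e i)) (g := fun j => (q j, f j)) _ i
  have E1 : (∀ i, Cy (q (σ i)) (f (σ i))) ≃ₗ[ℝ[X]] N :=
    (LinearEquiv.piCongrLeft ℝ[X] (fun j => Cy (q j) (f j)) σ).trans F.symm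
  suffices E2 : (∀ i, Cy (p i) (e i)) ≃ₗ[ℝ[X]] (∀ i, Cy (q (σ i)) (f (σ i))) from
    ⟨(E.trans E2).trans E1⟩
  refine LinearEquiv.piCongrRight fun i => ?_
  refine Submodule.quotEquivOfEq _ _ ?_
  have := hσ i
  simp only [Prod.mk.injEq] at this
  rw [this.1, this.2]

lemma finrank_Gs_aeval {V : Type*} [AddCommGroup V] [Module ℝ V] [FiniteDimensional ℝ V]
    (a : V →ₗ[ℝ] V) (p : ℝ[X]) (k : ℕ) :
      Module.finrank ℝ (Gs p k (Module.AEval' a)) =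
      Module.finrank ℝ ((aeval a p).ker ⊓ (aeval a p ^ k).range : Submodule ℝ V) := by
  have := ((Module.AEval'.of a).submoduleMap
    ((aeval a p).ker ⊓ (aeval a p ^ k).range : Submodule ℝ V)).finrank_eq
  rw [this]
  have h2 : (Gs p k (Module.AEval' a)).restrictScalars ℝ =
    ((aeval a p).ker ⊓ (aeval a p ^ k).range : Submodule ℝ V).map
      (Module.AEval'.of a).toLinearMap := by
    ext x
    constructor
    · rintro ⟨h1, u, rfl⟩
      refine ⟨(Module.AEval'.of a).symm (p ^ k • u), ⟨?_, (Module.AEval'.of a).symm u, ?_⟩,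
        (Module.AEval'.of a).apply_symm_apply _⟩
      · have := congrArg (Module.AEval'.of a).symm h1
        rw [map_zero] at this
        exact this
      · rw [← map_pow]; rfl
    · rintro ⟨x, ⟨h1, u, rfl⟩, rfl⟩
      refine ⟨?_, Module.AEval'.of a u, ?_⟩
      · have : Module.AEval'.of a (aeval a p • (aeval a p ^ k) u) = 0 := by
          have h1' : aeval a p ((aeval a p ^ k) u) = 0 := h1
          rw [Module.End.smul_def, h1', map_zero]
        exact this
      · have : Module.AEval'.of a (aeval a (p ^ k) • u) = p ^ k • Module.AEval'.of a u := rfl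
        rw [← this, map_pow]; rfl
  rw [← h2]; rfl

/-- similarity lemma -/
theorem similar_of_finrank {V W : Type*} [AddCommGroup V] [Module ℝ V] [FiniteDimensional ℝ V]
    [AddCommGroup W] [Module ℝ W] [FiniteDimensional ℝ W]
    (a : V →ₗ[ℝ] V) (b : W →ₗ[ℝ] W)
    (h : ∀ p : ℝ[X], p.Monic → Irreducible p → ∀ k : ℕ,
      Module.finrank ℝ ((aeval a p).ker ⊓ (aeval a p ^ k).range : Submodule ℝ V) =
      Module.finrank ℝ ((aeval b p).ker ⊓ (aeval b p ^ k).range : Submodule ℝ W)) :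
    ∃ Q : V ≃ₗ[ℝ] W, ∀ x, Q (a x) = b (Q x) := by
  haveI : FiniteDimensional ℝ (Module.AEval' a) := inferInstanceAs (FiniteDimensional ℝ (Module.AEval ℝ V a))
  haveI : FiniteDimensional ℝ (Module.AEval' b) := inferInstanceAs (FiniteDimensional ℝ (Module.AEval ℝ W b))
  obtain ⟨E⟩ := equiv_of_Gs (Module.AEval' a) (Module.AEval' b) fun p hm hp k => by
    rw [finrank_Gs_aeval, finrank_Gs_aeval]; exact h p hm hp k
  refine ⟨(Module.AEval'.of a).trans ((E.restrictScalars ℝ).trans (Module.AEval'.of b).symm),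
    fun x => ?_⟩
  change (Module.AEval'.of b).symm (E (Module.AEval'.of a (a x))) =
    b ((Module.AEval'.of b).symm (E (Module.AEval'.of a x)))
  rw [← Module.AEval'.X_smul_of, map_smul, Module.AEval'.of_symm_X_smul]
end Sim


section Basics
variable {E : Type*} [NormedAddCommGroup E] [NormedSpace ℝ E] [FiniteDimensional ℝ E]
  [CompleteSpace E]

/-- the linear flow generated by a continuous linear map -/
def fl (a : E →L[ℝ] E) (t : ℝ) : E →L[ℝ] E := NormedSpace.exp (t • a)

lemma hasDerivAt_fl' (a : E →L[ℝ] E) (t : ℝ) : HasDerivAt (fun u => fl a u) (a * fl a t) t :=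
  hasDerivAt_exp_smul_const' (𝕂 := ℝ) a t

lemma continuous_fl (a : E →L[ℝ] E) : Continuous (fun t => fl a t) :=
  continuous_iff_continuousAt.2 fun t => (hasDerivAt_fl' a t).continuousAt

lemma hasDerivAt_fl (a : E →L[ℝ] E) (t : ℝ) (x : E) :
    HasDerivAt (fun u => fl a u x) (a (fl a t x)) t := by
  have := (hasDerivAt_fl' a t).clm_apply (hasDerivAt_const t x)
  simpa using this

lemma fl_zero (a : E →L[ℝ] E) : fl a 0 = 1 := by simp [fl]

lemma fl_add_gen (a b : E →L[ℝ] E) (h : Commute a b) (t : ℝ) : fl (a + b) t = fl a t * fl b t := by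
  letI : NormedAlgebra ℚ (E →L[ℝ] E) := NormedAlgebra.restrictScalars ℚ ℝ _
  unfold fl
  rw [smul_add, NormedSpace.exp_add_of_commute]
  exact (h.smul_left t).smul_right t

lemma fl_add (a : E →L[ℝ] E) (s t : ℝ) : fl a (s + t) = fl a s * fl a t := by
  letI : NormedAlgebra ℚ (E →L[ℝ] E) := NormedAlgebra.restrictScalars ℚ ℝ _
  unfold fl
  rw [add_smul, NormedSpace.exp_add_of_commute]
  exact ((Commute.refl a).smul_left s).smul_right t

lemma fl_add_apply (a : E →L[ℝ] E) (s t : ℝ) (x : E) : fl a (s + t) x = fl a s (fl a t x) := by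
  rw [fl_add]; rfl

@[simp] lemma fl_zero_apply (a : E →L[ℝ] E) (x : E) : fl a 0 x = x := by rw [fl_zero]; rfl

@[simp] lemma fl_neg_apply (a : E →L[ℝ] E) (t : ℝ) (x : E) : fl a (-t) (fl a t x) = x := by
  rw [← fl_add_apply]; simp

@[simp] lemma fl_neg_apply' (a : E →L[ℝ] E) (t : ℝ) (x : E) : fl a t (fl a (-t) x) = x := by
  rw [← fl_add_apply]; simp

lemma fl_smul (a : E →L[ℝ] E) (c t : ℝ) : fl (c • a) t = fl a (c * t) := by
  unfold fl; rw [smul_smul, mul_comm]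

lemma fl_neg_gen (a : E →L[ℝ] E) (t : ℝ) : fl (-a) t = fl a (-t) := by
  unfold fl; simp

lemma fl_injective (a : E →L[ℝ] E) (t : ℝ) : Function.Injective (fl a t) :=
  Function.LeftInverse.injective (g := fl a (-t)) (fun x => fl_neg_apply a t x)

lemma continuous_fl_uncurry (a : E →L[ℝ] E) : Continuous (fun p : ℝ × E => fl a p.1 p.2) :=
  ((continuous_fl a).comp continuous_fst).clm_apply continuous_snd

lemma fl_commute (a b : E →L[ℝ] E) (h : Commute b a) (t : ℝ) : Commute b (fl a t) := by
  unfold fl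
  exact (h.smul_right t).exp_right

lemma fl_comm_apply (a b : E →L[ℝ] E) (h : Commute b a) (t : ℝ) (x : E) :
    b (fl a t x) = fl a t (b x) := by
  have := (fl_commute a b h t).eq
  exact congrArg (fun f : E →L[ℝ] E => f x) this

lemma fl_comm_self (a : E →L[ℝ] E) (t : ℝ) (x : E) : a (fl a t x) = fl a t (a x) :=
  fl_comm_apply a a (Commute.refl a) t x

/-- uniqueness of solutions -/
lemma fl_unique (a : E →L[ℝ] E) (γ : ℝ → E) (h : ∀ t, HasDerivAt γ (a (γ t)) t) (t : ℝ) :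
    γ t = fl a t (γ 0) := by
  have key : ∀ u, HasDerivAt (fun u => fl a (-u) (γ u)) 0 u := by
    intro u
    have h1 : HasDerivAt (fun u => fl a (-u)) (-(a * fl a (-u))) u := by
      have := (hasDerivAt_fl' a (-u)).scomp u (hasDerivAt_neg u)
      simpa [Function.comp_def] using this
    have h2 := h1.clm_apply (h u)
    convert h2 using 1
    simp [fl_comm_self]
  have hd : Differentiable ℝ (fun u => fl a (-u) (γ u)) := fun u => (key u).differentiableAt
  have h0 : ∀ u, deriv (fun u => fl a (-u) (γ u)) u = 0 := fun u => (key u).deriv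
  have := is_const_of_deriv_eq_zero hd h0 t 0
  simp at this
  rw [← this]; simp

lemma fl_mem (a : E →L[ℝ] E) (V : Submodule ℝ E) (hV : ∀ x ∈ V, a x ∈ V) (t : ℝ) (x : E)
    (hx : x ∈ V) : fl a t x ∈ V := by
  have hcl : IsClosed (V : Set E) := V.closed_of_finiteDimensional
  have : fl a t x = ∑' k : ℕ, ((k.factorial : ℝ)⁻¹ • (t • a) ^ k) x := by
    unfold fl
    letI : NormedAlgebra ℚ (E →L[ℝ] E) := NormedAlgebra.restrictScalars ℚ ℝ _
    rw [NormedSpace.exp_eq_tsum ℝ]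
    have hs := NormedSpace.expSeries_summable' (𝕂 := ℝ) (t • a)
    exact (hs.hasSum.mapL (ContinuousLinearMap.apply ℝ E x)).tsum_eq.symm
  rw [this]
  have hmem : ∀ k : ℕ, ((a) ^ k) x ∈ V := by
    intro k
    induction k with
    | zero => simpa
    | succ k ih => rw [pow_succ']; exact hV _ ih
  refine hcl.mem_of_tendsto (b := atTop) (f := fun s : Finset ℕ =>
    ∑ k ∈ s, ((k.factorial : ℝ)⁻¹ • (t • a) ^ k) x) ?_ ?_
  · have hs := NormedSpace.expSeries_summable' (𝕂 := ℝ) (t • a)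
    have := (hs.hasSum.mapL (ContinuousLinearMap.apply ℝ E x)).summable
    exact this.hasSum
  · refine Eventually.of_forall fun s => V.sum_mem fun k _ => ?_
    rw [smul_pow]
    simp only [ContinuousLinearMap.smul_apply]
    exact V.smul_mem _ (V.smul_mem _ (hmem k))

end Basics

section Defs2
variable {d : ℕ}
/-- matrix as a continuous linear map -/
def mcl (A : Matrix (Fin d) (Fin d) ℝ) : Euc d →L[ℝ] Euc d := 
  LinearMap.toContinuousLinearMap (Matrix.toEuclideanLin A)

lemma linFlow_eq (A : Matrix (Fin d) (Fin d) ℝ) (t : ℝ) (x : Euc d) :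
    linFlow A t x = fl (mcl A) t x := by
  have key : ∀ M : Matrix (Fin d) (Fin d) ℝ, mcl (NormedSpace.exp M) = NormedSpace.exp (mcl M) := by
    intro M
    let f : Matrix (Fin d) (Fin d) ℝ →+* (Euc d →L[ℝ] Euc d) :=
      (Matrix.toEuclideanCLM (n := Fin d) (𝕜 := ℝ)).toRingEquiv.toRingHom
    have hf : ∀ M, f M = mcl M := by
      intro M; ext x i; rfl
    have hc : Continuous f := by
      have : Continuous (fun M : Matrix (Fin d) (Fin d) ℝ => mcl M) := by
        let g : Matrix (Fin d) (Fin d) ℝ →ₗ[ℝ] (Euc d →L[ℝ] Euc d) :=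
          LinearMap.toContinuousLinearMap.toLinearMap ∘ₗ
            (Matrix.toEuclideanLin (𝕜 := ℝ) (m := Fin d) (n := Fin d)).toLinearMap
        exact g.continuous_of_finiteDimensional
      convert this using 1
      ext1 M; exact hf M
    letI : NormedAlgebra ℚ (Euc d →L[ℝ] Euc d) := NormedAlgebra.restrictScalars ℚ ℝ _
    letI := Matrix.linftyOpNormedRing (n := Fin d) (α := ℝ)
    letI := Matrix.linftyOpNormedAlgebra (n := Fin d) (α := ℝ) (R := ℝ)
    letI : NormedAlgebra ℚ (Matrix (Fin d) (Fin d) ℝ) := NormedAlgebra.restrictScalars ℚ ℝ _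
    have := NormedSpace.map_exp f hc M
    rw [hf, hf] at this
    exact this
  have h1 : mcl (t • A) = t • mcl A := by simp [mcl]
  unfold fl
  rw [← h1, ← key]
  rfl
end Defs2


section Struct
variable {E : Type*} [NormedAddCommGroup E] [NormedSpace ℝ E] [FiniteDimensional ℝ E]
  [CompleteSpace E]

/-- `x + i y`-type pairs -/
def IsEig (s : E →L[ℝ] E) (α β : ℝ) (x y : E) : Prop :=
  s x = α • x + β • y ∧ s y = α • y - β • x

lemma fl_eig {s : E →L[ℝ] E} {α β : ℝ} {x y : E} (h : IsEig s α β x y) (t : ℝ) :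
    fl s t x = Real.exp (α * t) • (Real.cos (β * t) • x + Real.sin (β * t) • y) := by
  have := fl_unique s (fun t => Real.exp (α * t) • (Real.cos (β * t) • x + Real.sin (β * t) • y))
    (fun t => ?_) t
  · simpa using this.symm
  have h1 : HasDerivAt (fun t : ℝ => Real.exp (α * t)) (Real.exp (α * t) * α) t := by
    simpa using ((hasDerivAt_id t).const_mul α).exp
  have h2 : HasDerivAt (fun t : ℝ => Real.cos (β * t)) (-Real.sin (β * t) * β) t := by
    simpa using ((hasDerivAt_id t).const_mul β).cos
  have h3 : HasDerivAt (fun t : ℝ => Real.sin (β * t)) (Real.cos (β * t) * β) t := by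
    simpa using ((hasDerivAt_id t).const_mul β).sin
  convert h1.smul ((h2.smul_const x).add (h3.smul_const y)) using 1
  · rfl
  simp only [map_smul, map_add, h.1, h.2, Pi.add_apply]
  module

structure SN (a s n : E →L[ℝ] E) : Prop where
  add : a = s + n
  comm : Commute s n
  nil : ∃ N, n ^ N = 0
  spn : Submodule.span ℝ {x : E | ∃ α β y, 0 ≤ β ∧ IsEig s α β x y} = ⊤
  invs : ∀ V : Submodule ℝ E, (∀ x ∈ V, a x ∈ V) → ∀ x ∈ V, s x ∈ V
  invn : ∀ V : Submodule ℝ E, (∀ x ∈ V, a x ∈ V) → ∀ x ∈ V, n x ∈ V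

lemma mem_of_mem_adjoin (f g : Module.End ℝ E) (hg : g ∈ Algebra.adjoin ℝ {f}) (V : Submodule ℝ E)
    (hV : ∀ x ∈ V, f x ∈ V) : ∀ x ∈ V, g x ∈ V := by
  induction hg using Algebra.adjoin_induction with
  | mem y hy => rw [Set.mem_singleton_iff.1 hy]; exact hV
  | algebraMap r => intro x hx; simpa [Module.algebraMap_end_apply] using V.smul_mem r hx
  | add u v _ _ hu hv => intro x hx; exact V.add_mem (hu x hx) (hv x hx)
  | mul u v _ _ hu hv => intro x hx; exact hu _ (hv x hx)

open Polynomial in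
lemma ker_irred_le (s : E →L[ℝ] E) (p : ℝ[X]) (hp : Irreducible p) :
    LinearMap.ker (aeval (s : Module.End ℝ E) p) ≤
      Submodule.span ℝ {x : E | ∃ α β y, 0 ≤ β ∧ IsEig s α β x y} := by
  intro x hx
  apply Submodule.subset_span
  have hd : p.natDegree ≤ 2 := natDegree_le_of_degree_le hp.degree_le_two
  have hpos : 0 < p.natDegree := hp.natDegree_pos
  rw [LinearMap.mem_ker] at hx
  have hdd : p.natDegree = 1 ∨ p.natDegree = 2 := by omega
  rcases hdd with h1 | h2
  · have hlc : p.coeff 1 ≠ 0 := by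
      have := (leadingCoeff_ne_zero).2 hp.ne_zero
      rwa [leadingCoeff, h1] at this
    have e := aeval_eq_sum_range (R := ℝ) (p := p) (s : Module.End ℝ E)
    rw [h1, Finset.sum_range_succ, Finset.sum_range_succ, Finset.sum_range_zero] at e
    rw [e] at hx
    simp at hx
    refine ⟨-(p.coeff 0)/p.coeff 1, 0, 0, le_rfl, ?_, by simp⟩
    have : s x = (p.coeff 1)⁻¹ • (p.coeff 1 • s x) := by rw [smul_smul, inv_mul_cancel₀ hlc, one_smul]
    rw [this, eq_neg_of_add_eq_zero_right hx]
    simp [smul_smul, div_eq_inv_mul]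
  · have hlc : p.coeff 2 ≠ 0 := by
      have := (leadingCoeff_ne_zero).2 hp.ne_zero
      rwa [leadingCoeff, h2] at this
    have e := aeval_eq_sum_range (R := ℝ) (p := p) (s : Module.End ℝ E)
    rw [h2, Finset.sum_range_succ, Finset.sum_range_succ, Finset.sum_range_succ,
      Finset.sum_range_zero] at e
    rw [e] at hx
    simp [pow_two] at hx
    set u := p.coeff 2
    set v := p.coeff 1
    set w := p.coeff 0
    have hdisc : v ^ 2 - 4 * u * w < 0 := by
      by_contra hcon
      push Not at hcon
      have hroot : p.IsRoot ((-v + Real.sqrt (v ^ 2 - 4 * u * w)) / (2 * u)) := by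
        have e2 := eval_eq_sum_range (p := p) ((-v + Real.sqrt (v ^ 2 - 4 * u * w)) / (2 * u))
        rw [h2, Finset.sum_range_succ, Finset.sum_range_succ, Finset.sum_range_succ,
          Finset.sum_range_zero] at e2
        rw [IsRoot.def, e2]
        have := Real.sq_sqrt hcon
        set q := Real.sqrt (v ^ 2 - 4 * u * w)
        change 0 + w * _ ^ 0 + v * _ ^ 1 + u * _ ^ 2 = 0
        field_simp
        nlinarith
      have := degree_eq_one_of_irreducible_of_root hp hroot
      rw [degree_eq_natDegree hp.ne_zero, h2] at this
      norm_num at this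
    have hb : 0 < (4 * u * w - v ^ 2) / (4 * u ^ 2) := by
      apply div_pos <;> [linarith; positivity]
    set b := Real.sqrt ((4 * u * w - v ^ 2) / (4 * u ^ 2)) with hbdef
    have hbpos : 0 < b := Real.sqrt_pos.2 hb
    have hb2 : b ^ 2 = (4 * u * w - v ^ 2) / (4 * u ^ 2) := Real.sq_sqrt hb.le
    have hss : s (s x) = - (w/u) • x - (v/u) • s x := by
      have : s (s x) = u⁻¹ • (u • s (s x)) := by rw [smul_smul, inv_mul_cancel₀ hlc, one_smul]
      rw [this, eq_neg_of_add_eq_zero_right hx]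
      simp only [div_eq_inv_mul]
      module
    refine ⟨-v / (2 * u), b, b⁻¹ • (s x - (-v / (2 * u)) • x), hbpos.le, ?_, ?_⟩
    · rw [smul_smul, mul_inv_cancel₀ hbpos.ne']; module
    · rw [map_smul, map_sub, map_smul, hss]
      have hb3 : b = b⁻¹ * ((4 * u * w - v ^ 2) / (4 * u ^ 2)) := by
        rw [← hb2]; field_simp
      nth_rewrite 3 [hb3]
      match_scalars <;> field_simp <;> ring

open Polynomial in
lemma ker_sqfree_le (s : E →L[ℝ] E) (p : ℝ[X]) (hp0 : p ≠ 0) (hp : Squarefree p) :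
    LinearMap.ker (aeval (s : Module.End ℝ E) p) ≤
      Submodule.span ℝ {x : E | ∃ α β y, 0 ≤ β ∧ IsEig s α β x y} := by
  induction p using WfDvdMonoid.induction_on_irreducible with
  | zero => exact absurd rfl hp0
  | unit u hu =>
    intro x hx
    have : aeval (s : Module.End ℝ E) u x = 0 := hx
    obtain ⟨c, hc, rfl⟩ := Polynomial.isUnit_iff.1 hu
    simp [Module.algebraMap_end_apply] at this
    rcases this with h | h
    · simp [h] at hc
    · rw [h]; exact zero_mem _
  | mul a i ha hi ih =>
    have hco : IsCoprime i a := by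
      rw [hi.coprime_iff_not_dvd]
      rintro ⟨c, rfl⟩
      have := hp i ⟨c, by ring⟩
      exact hi.not_isUnit this
    rw [← sup_ker_aeval_eq_ker_aeval_mul_of_coprime _ hco]
    exact sup_le (ker_irred_le s i hi) (ih ha (hp.squarefree_of_dvd (Dvd.intro_left _ rfl)))

lemma exists_SN (a : E →L[ℝ] E) : ∃ s n, SN a s n := by
  obtain ⟨n, hn, s, hs, hnil, hss, hadd⟩ :=
    Module.End.exists_isNilpotent_isSemisimple (f := (a : Module.End ℝ E))
  let F := Module.End.toContinuousLinearMap (𝕜 := ℝ) E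
  have hcomm : Commute n s := Algebra.commute_of_mem_adjoin_singleton_of_commute hs
      (Algebra.commute_of_mem_adjoin_self hn).symm
  have hFa : ∀ (f : Module.End ℝ E) x, F f x = f x := fun f x => rfl
  refine ⟨F s, F n, ?_, ?_, ?_, ?_, ?_, ?_⟩
  · ext x
    have : a x = (n + s) x := by rw [← hadd]; rfl
    rw [this, add_comm]; rfl
  · exact (hcomm.symm).map F
  · obtain ⟨N, hN⟩ := hnil
    exact ⟨N, by rw [← map_pow, hN, map_zero]⟩
  · rw [eq_top_iff]
    have h1 := ker_sqfree_le (F s) (minpoly ℝ s) (minpoly.ne_zero (Algebra.IsIntegral.isIntegral s))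
      hss.minpoly_squarefree
    refine le_trans ?_ h1
    intro x _
    have : ((F s : E →L[ℝ] E) : Module.End ℝ E) = s := rfl
    rw [this, minpoly.aeval]; simp
  · intro V hV; exact mem_of_mem_adjoin (a : Module.End ℝ E) s hs V hV
  · intro V hV; exact mem_of_mem_adjoin (a : Module.End ℝ E) n hn V hV

lemma fl_nil {n : E →L[ℝ] E} {N : ℕ} (hN : n ^ N = 0) (t : ℝ) (x : E) :
    fl n t x = ∑ k ∈ Finset.range N, (t ^ k / (k.factorial : ℝ)) • (n ^ k) x := by
  have : fl n t = ∑ k ∈ Finset.range N, (t ^ k / (k.factorial : ℝ)) • (n ^ k) := by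
    unfold fl
    rw [NormedSpace.exp_eq_tsum ℝ]
    beta_reduce
    rw [tsum_eq_sum (s := Finset.range N)]
    · refine Finset.sum_congr rfl fun k _ => ?_
      rw [smul_pow, smul_smul]; congr 1; field_simp
    · intro k hk
      simp at hk
      rw [smul_pow, pow_eq_zero_of_le hk hN]; simp
  rw [this]; simp [ContinuousLinearMap.sum_apply]

lemma fl_nil_bound {n : E →L[ℝ] E} {N : ℕ} (hN : n ^ N = 0) {ε : ℝ} (hε : 0 < ε) :
    ∃ C, 0 ≤ C ∧ ∀ t x, ‖fl n t x‖ ≤ C * Real.exp (ε * |t|) * ‖x‖ := by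
  refine ⟨∑ k ∈ Finset.range N, (ε⁻¹) ^ k * ‖n ^ k‖, by positivity, fun t x => ?_⟩
  rw [fl_nil hN, Finset.sum_mul, Finset.sum_mul]
  refine (norm_sum_le _ _).trans (Finset.sum_le_sum fun k _ => ?_)
  rw [norm_smul]
  have h1 : ‖t ^ k / (k.factorial : ℝ)‖ ≤ ε⁻¹ ^ k * Real.exp (ε * |t|) := by
    have := Real.pow_div_factorial_le_exp (ε * |t|) (by positivity) k
    rw [norm_div, norm_pow, Real.norm_eq_abs, Real.norm_natCast]
    calc |t| ^ k / (k.factorial : ℝ) = ε⁻¹ ^ k * ((ε * |t|) ^ k / k.factorial) := by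
          rw [mul_pow, inv_pow]; field_simp
      _ ≤ _ := by gcongr
  calc _ ≤ (ε⁻¹ ^ k * Real.exp (ε * |t|)) * (‖n ^ k‖ * ‖x‖) := by
        gcongr; exact (n ^ k).le_opNorm x
    _ = _ := by ring

end Struct


section Struct
variable {E : Type*} [NormedAddCommGroup E] [NormedSpace ℝ E] [FiniteDimensional ℝ E]
  [CompleteSpace E]

lemma unif_base {F : Type*} [NormedAddCommGroup F] [NormedSpace ℝ F] (V : Submodule ℝ E) :
    ∃ (m : ℕ) (b : Fin m → E) (K : ℝ), (∀ i, b i ∈ V) ∧ 0 ≤ K ∧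
    ∀ (f : E →ₗ[ℝ] F), ∀ x ∈ V, ‖f x‖ ≤ K * ‖x‖ * ∑ i, ‖f (b i)‖ := by
  let b := Module.finBasis ℝ V
  let e := LinearMap.toContinuousLinearMap (b.equivFun.toLinearMap)
  refine ⟨_, fun i => (b i : E), ‖e‖, fun i => (b i).2, e.opNorm_nonneg, fun f x hx => ?_⟩
  have h1 : x = ∑ i, e ⟨x, hx⟩ i • (b i : E) := by
    have := b.sum_equivFun ⟨x, hx⟩
    have h2 := congrArg (Subtype.val) this
    simp only [Submodule.coe_sum, Submodule.coe_smul] at h2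
    exact h2.symm
  have h3 : ∀ i, |e ⟨x, hx⟩ i| ≤ ‖e‖ * ‖x‖ := fun i =>
    (norm_le_pi_norm (e ⟨x, hx⟩) i).trans (e.le_opNorm ⟨x, hx⟩)
  conv_lhs => rw [h1]
  rw [map_sum, Finset.mul_sum]
  refine (norm_sum_le _ _).trans (Finset.sum_le_sum fun i _ => ?_)
  rw [map_smul, norm_smul]
  exact mul_le_mul_of_nonneg_right (h3 i) (norm_nonneg _)

lemma unif_tendsto {F ι : Type*} [NormedAddCommGroup F] [NormedSpace ℝ F] (V : Submodule ℝ E)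
    (f : ι → E →L[ℝ] F) (l : Filter ι) (h : ∀ x ∈ V, Tendsto (fun t => f t x) l (𝓝 0))
    {ε : ℝ} (hε : 0 < ε) : ∀ᶠ t in l, ∀ x ∈ V, ‖f t x‖ ≤ ε * ‖x‖ := by
  obtain ⟨m, b, K, hb, hK, H⟩ := unif_base (F := F) V
  have h1 : Tendsto (fun t => K * ∑ i, ‖f t (b i)‖) l (𝓝 0) := by
    have : Tendsto (fun t => K * ∑ i, ‖f t (b i)‖) l (𝓝 (K * ∑ i : Fin m, ‖(0:F)‖)) :=
      Tendsto.const_mul K (tendsto_finset_sum _ fun i _ => (h _ (hb i)).norm)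
    simpa using this
  filter_upwards [h1.eventually (gt_mem_nhds hε)] with t ht x hx
  calc ‖f t x‖ ≤ K * ‖x‖ * ∑ i, ‖f t (b i)‖ := H (f t) x hx
    _ = (K * ∑ i, ‖f t (b i)‖) * ‖x‖ := by ring
    _ ≤ ε * ‖x‖ := by gcongr

lemma unif_bounded {F ι : Type*} [NormedAddCommGroup F] [NormedSpace ℝ F] (V : Submodule ℝ E)
    (f : ι → E →L[ℝ] F) (h : ∀ x ∈ V, ∃ C, ∀ t, ‖f t x‖ ≤ C) :
    ∃ C, 0 < C ∧ ∀ t, ∀ x ∈ V, ‖f t x‖ ≤ C * ‖x‖ := by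
  obtain ⟨m, b, K, hb, hK, H⟩ := unif_base (F := F) V
  choose C hC using fun i => h _ (hb i)
  refine ⟨K * ∑ i, |C i| + 1, by positivity, fun t x hx => ?_⟩
  calc ‖f t x‖ ≤ K * ‖x‖ * ∑ i, ‖f t (b i)‖ := H (f t) x hx
    _ ≤ K * ‖x‖ * ∑ i, |C i| := by
        gcongr with i; exact (hC i t).trans (le_abs_self _)
    _ ≤ _ := by nlinarith [norm_nonneg x]

/-- stable subspace -/
def stS (a : E →L[ℝ] E) : Submodule ℝ E where
  carrier := {x | Tendsto (fun t : ℝ => fl a t x) atTop (𝓝 0)}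
  zero_mem' := by simp
  add_mem' := fun {x y} hx hy => by
    have := Tendsto.add hx hy
    simpa using this
  smul_mem' := fun c x hx => by
    have := Tendsto.const_smul hx c
    simpa using this

/-- unstable subspace -/
def unS (a : E →L[ℝ] E) : Submodule ℝ E where
  carrier := {x | Tendsto (fun t : ℝ => fl a t x) atBot (𝓝 0)}
  zero_mem' := by simp
  add_mem' := fun {x y} hx hy => by
    have := Tendsto.add hx hy
    simpa using this
  smul_mem' := fun c x hx => by
    have := Tendsto.const_smul hx c
    simpa using this

/-- central subspace -/
def ceS (a : E →L[ℝ] E) : Submodule ℝ E where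
  carrier := {x | ∀ ε > (0 : ℝ),
    Tendsto (fun t : ℝ => Real.exp (-(ε * |t|)) • fl a t x) (atBot ⊔ atTop) (𝓝 0)}
  zero_mem' := by simp
  add_mem' := fun {x y} hx hy ε hε => by
    have := Tendsto.add (hx ε hε) (hy ε hε)
    simpa using this
  smul_mem' := fun c x hx ε hε => by
    have := Tendsto.const_smul (hx ε hε) c
    simpa [smul_comm c] using this

lemma mem_stS {a : E →L[ℝ] E} {x : E} :
    x ∈ stS a ↔ Tendsto (fun t : ℝ => fl a t x) atTop (𝓝 0) := Iff.rfl
lemma mem_unS {a : E →L[ℝ] E} {x : E} :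
    x ∈ unS a ↔ Tendsto (fun t : ℝ => fl a t x) atBot (𝓝 0) := Iff.rfl
lemma mem_ceS {a : E →L[ℝ] E} {x : E} : x ∈ ceS a ↔ ∀ ε > (0 : ℝ),
    Tendsto (fun t : ℝ => Real.exp (-(ε * |t|)) • fl a t x) (atBot ⊔ atTop) (𝓝 0) := Iff.rfl

lemma unS_eq (a : E →L[ℝ] E) : unS a = stS (-a) := by
  ext x
  rw [mem_unS, mem_stS]
  simp_rw [fl_neg_gen]
  constructor
  · intro h; exact h.comp tendsto_neg_atTop_atBot
  · intro h; simpa [Function.comp_def] using h.comp tendsto_neg_atBot_atTop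

lemma stS_eq (a : E →L[ℝ] E) : stS a = unS (-a) := by rw [unS_eq, neg_neg]

lemma ceS_neg_le (a : E →L[ℝ] E) : ceS a ≤ ceS (-a) := by
  intro x hx ε hε
  have := hx ε hε
  simp_rw [fl_neg_gen]
  rw [tendsto_sup] at this ⊢
  constructor
  · simpa [Function.comp_def] using this.2.comp tendsto_neg_atBot_atTop
  · simpa [Function.comp_def] using this.1.comp tendsto_neg_atTop_atBot

lemma ceS_neg (a : E →L[ℝ] E) : ceS (-a) = ceS a :=
  le_antisymm (by simpa using ceS_neg_le (-a)) (ceS_neg_le a)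

lemma stS_fl (a : E →L[ℝ] E) (t : ℝ) {x : E} (hx : x ∈ stS a) : fl a t x ∈ stS a := by
  rw [mem_stS] at *
  have := hx.comp (tendsto_atTop_add_const_right _ t tendsto_id)
  simpa [Function.comp_def, fl_add_apply] using this

lemma unS_fl (a : E →L[ℝ] E) (t : ℝ) {x : E} (hx : x ∈ unS a) : fl a t x ∈ unS a := by
  rw [unS_eq] at *
  have := stS_fl (-a) (-t) hx
  simpa [fl_neg_gen] using this

lemma stS_inv (a b : E →L[ℝ] E) (h : Commute b a) {x : E} (hx : x ∈ stS a) : b x ∈ stS a := by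
  rw [mem_stS] at *
  have := (b.continuous.tendsto 0).comp hx
  simpa [Function.comp_def, fl_comm_apply a b h] using this

lemma unS_inv (a b : E →L[ℝ] E) (h : Commute b a) {x : E} (hx : x ∈ unS a) : b x ∈ unS a := by
  rw [unS_eq] at *
  exact stS_inv _ _ h.neg_right hx

lemma ceS_inv (a b : E →L[ℝ] E) (h : Commute b a) {x : E} (hx : x ∈ ceS a) : b x ∈ ceS a := by
  rw [mem_ceS] at *
  intro ε hε
  have := (b.continuous.tendsto 0).comp (hx ε hε)
  simpa [Function.comp_def, fl_comm_apply a b h] using this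

lemma ceS_fl (a : E →L[ℝ] E) (t : ℝ) {x : E} (hx : x ∈ ceS a) : fl a t x ∈ ceS a :=
  ceS_inv a _ (fl_commute a a (Commute.refl a) t).symm hx

/-- exponential bound on the stable subspace -/
lemma stS_bound (a : E →L[ℝ] E) : ∃ C l : ℝ, 0 < C ∧ 0 < l ∧ ∀ t, 0 ≤ t → ∀ x ∈ stS a,
    ‖fl a t x‖ ≤ C * Real.exp (-(l * t)) * ‖x‖ := by
  have h1 := unif_tendsto (stS a) (fun t : ℝ => fl a t) atTop (fun x hx => hx)
    (ε := Real.exp (-1)) (Real.exp_pos _)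
  obtain ⟨T, hT, hT0⟩ := (h1.and (eventually_gt_atTop 0)).exists
  have hk : ∀ k : ℕ, ∀ x ∈ stS a, ‖fl a (k * T) x‖ ≤ Real.exp (-(k:ℝ)) * ‖x‖ := by
    intro k
    induction k with
    | zero => intro x _; simp
    | succ k ih =>
      intro x hx
      have : ((k + 1 : ℕ) : ℝ) * T = k * T + T := by push_cast; ring
      rw [this, fl_add_apply]
      calc _ ≤ Real.exp (-(k:ℝ)) * ‖fl a T x‖ := ih _ (stS_fl a T hx)
        _ ≤ Real.exp (-(k:ℝ)) * (Real.exp (-1) * ‖x‖) := by gcongr; exact hT x hx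
        _ = _ := by rw [← mul_assoc, ← Real.exp_add]; push_cast; ring_nf
  obtain ⟨M, hM⟩ := (isCompact_Icc (a := (0:ℝ)) (b := T)).exists_bound_of_continuousOn
    (continuous_fl a).continuousOn
  refine ⟨(|M| + 1) * Real.exp 1, T⁻¹, by positivity, by positivity, fun t ht x hx => ?_⟩
  set k := ⌊t / T⌋₊
  have hk1 : (k:ℝ) * T ≤ t := by
    have := Nat.floor_le (div_nonneg ht hT0.le)
    rwa [le_div_iff₀ hT0] at this
  have hk2 : t < (k + 1) * T := by
    have := Nat.lt_floor_add_one (t / T)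
    rwa [div_lt_iff₀ hT0] at this
  have e : t = (t - k * T) + k * T := by ring
  have hMk : ‖fl a (t - k * T)‖ ≤ |M| + 1 :=
    (hM _ ⟨by linarith, by nlinarith⟩).trans ((le_abs_self M).trans (by linarith))
  have hexp : Real.exp (-(k:ℝ)) ≤ Real.exp 1 * Real.exp (-(T⁻¹ * t)) := by
    rw [← Real.exp_add]
    apply Real.exp_le_exp.2
    have : T⁻¹ * t < k + 1 := by
      rw [inv_mul_lt_iff₀ hT0]; linarith
    linarith
  calc ‖fl a t x‖ = ‖fl a (t - k * T) (fl a (k * T) x)‖ := by rw [← fl_add_apply, ← e]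
    _ ≤ ‖fl a (t - k * T)‖ * ‖fl a (k * T) x‖ := ContinuousLinearMap.le_opNorm _ _
    _ ≤ (|M| + 1) * (Real.exp (-(k:ℝ)) * ‖x‖) := by gcongr; exact hk k x hx
    _ ≤ (|M| + 1) * ((Real.exp 1 * Real.exp (-(T⁻¹ * t))) * ‖x‖) := by gcongr
    _ = _ := by ring

lemma indep_st (a : E →L[ℝ] E) {x c u : E} (hx : x ∈ stS a) (hc : c ∈ ceS a) (hu : u ∈ unS a)
    (h : x = c + u) : x = 0 := by
  obtain ⟨C, l, hC, hl, H⟩ := stS_bound a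
  have h1 : Tendsto (fun t : ℝ => Real.exp (-(l * |t|)) • fl a t x) atBot (𝓝 0) := by
    have hc1 := (tendsto_sup.1 (hc l hl)).1
    have hu1 : Tendsto (fun t : ℝ => Real.exp (-(l * |t|)) • fl a t u) atBot (𝓝 0) := by
      rw [tendsto_zero_iff_norm_tendsto_zero]
      refine squeeze_zero (fun _ => norm_nonneg _) (fun t => ?_)
        (tendsto_zero_iff_norm_tendsto_zero.1 hu)
      rw [norm_smul, Real.norm_eq_abs, abs_of_pos (Real.exp_pos _)]
      exact mul_le_of_le_one_left (norm_nonneg _) (Real.exp_le_one_iff.2 (by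
        have := abs_nonneg t
        nlinarith))
    have := hc1.add hu1
    rw [h]
    simpa using this
  have h2 : Tendsto (fun t : ℝ => C * ‖Real.exp (-(l * |t|)) • fl a t x‖) atBot (𝓝 0) := by
    simpa using (h1.norm).const_mul C
  have h3 : ∀ᶠ t : ℝ in atBot, ‖x‖ ≤ C * ‖Real.exp (-(l * |t|)) • fl a t x‖ := by
    filter_upwards [eventually_le_atBot 0] with t ht
    have := H (-t) (by linarith) (fl a t x) (stS_fl a t hx)
    rw [fl_neg_apply] at this
    rw [norm_smul, Real.norm_eq_abs, abs_of_pos (Real.exp_pos _), abs_of_nonpos ht]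
    linarith
  have := ge_of_tendsto h2 h3
  exact norm_le_zero_iff.1 this

lemma indep_un (a : E →L[ℝ] E) {x c u : E} (hx : x ∈ unS a) (hc : c ∈ ceS a) (hu : u ∈ stS a)
    (h : x = c + u) : x = 0 := by
  rw [unS_eq] at hx
  rw [stS_eq] at hu
  rw [← ceS_neg] at hc
  exact indep_st _ hx hc hu h

lemma indep_ce (a : E →L[ℝ] E) {x c u : E} (hx : x ∈ ceS a) (hc : c ∈ stS a) (hu : u ∈ unS a)
    (h : x = c + u) : x = 0 := by
  have h1 : u = 0 := indep_un a hu hx ((stS a).neg_mem hc) (by rw [h]; abel)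
  have h2 : c = 0 := indep_st a hc hx ((unS a).neg_mem hu) (by rw [h]; abel)
  rw [h, h1, h2, add_zero]

lemma eig_bound {a s n : E →L[ℝ] E} (H : SN a s n) {α β : ℝ} {x y : E} (h : IsEig s α β x y)
    {ε : ℝ} (hε : 0 < ε) : ∃ C, ∀ t, ‖fl a t x‖ ≤ C * Real.exp (α * t + ε * |t|) := by
  obtain ⟨N, hN⟩ := H.nil
  obtain ⟨C, hC0, hC⟩ := fl_nil_bound hN hε
  refine ⟨C * (‖x‖ + ‖y‖), fun t => ?_⟩
  have : fl a t x = fl n t (fl s t x) := by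
    rw [H.add, add_comm, fl_add_gen _ _ H.comm.symm]; rfl
  rw [this]
  have h1 : ‖fl s t x‖ ≤ Real.exp (α * t) * (‖x‖ + ‖y‖) := by
    rw [fl_eig h, norm_smul, Real.norm_eq_abs, abs_of_pos (Real.exp_pos _)]
    gcongr
    refine (norm_add_le _ _).trans ?_
    rw [norm_smul, norm_smul]
    gcongr
    · exact mul_le_of_le_one_left (norm_nonneg _) (Real.abs_cos_le_one _)
    · exact mul_le_of_le_one_left (norm_nonneg _) (Real.abs_sin_le_one _)
  calc _ ≤ C * Real.exp (ε * |t|) * ‖fl s t x‖ := hC _ _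
    _ ≤ C * Real.exp (ε * |t|) * (Real.exp (α * t) * (‖x‖ + ‖y‖)) := by gcongr
    _ = _ := by rw [Real.exp_add]; ring

lemma eig_st {a s n : E →L[ℝ] E} (H : SN a s n) {α β : ℝ} {x y : E} (h : IsEig s α β x y)
    (hα : α < 0) : x ∈ stS a := by
  obtain ⟨C, hC⟩ := eig_bound H h (ε := -α/2) (by linarith)
  rw [mem_stS]
  rw [tendsto_zero_iff_norm_tendsto_zero]
  have h1 : Tendsto (fun t : ℝ => C * Real.exp (α / 2 * t)) atTop (𝓝 0) := by
    have := (Real.tendsto_exp_atBot.comp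
      (tendsto_id.const_mul_atTop_of_neg (show α / 2 < 0 by linarith))).const_mul C
    simpa [Function.comp_def] using this
  refine squeeze_zero' (Eventually.of_forall fun _ => norm_nonneg _) ?_ h1
  filter_upwards [eventually_ge_atTop 0] with t ht
  have := hC t
  rw [abs_of_nonneg ht] at this
  convert this using 3; ring

lemma SN.neg {a s n : E →L[ℝ] E} (H : SN a s n) : SN (-a) (-s) (-n) := by
  refine ⟨by rw [H.add]; abel, H.comm.neg_left.neg_right, ?_, ?_, ?_, ?_⟩
  · obtain ⟨N, hN⟩ := H.nil
    exact ⟨N, by rw [neg_pow, hN, mul_zero]⟩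
  · rw [← H.spn]; congr 1; ext x; constructor
    · rintro ⟨α, β, y, hβ, h1, h2⟩
      refine ⟨-α, β, -y, hβ, ?_, ?_⟩
      · have : s x = -((-s) x) := by simp
        rw [this, h1]; module
      · have : s (-y) = ((-s) y) := by simp
        rw [this, h2]; module
    · rintro ⟨α, β, y, hβ, h1, h2⟩
      refine ⟨-α, β, -y, hβ, ?_, ?_⟩
      · simp [h1, add_comm]
      · simp [h2]
  · intro V hV x hx
    exact V.neg_mem (H.invs V (fun x hx => by simpa using V.neg_mem (hV x hx)) x hx)
  · intro V hV x hx
    exact V.neg_mem (H.invn V (fun x hx => by simpa using V.neg_mem (hV x hx)) x hx)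

lemma eig_un {a s n : E →L[ℝ] E} (H : SN a s n) {α β : ℝ} {x y : E} (h : IsEig s α β x y)
    (hα : 0 < α) : x ∈ unS a := by
  rw [unS_eq]
  refine eig_st H.neg (α := -α) (β := β) (y := -y) ⟨?_, ?_⟩ (by linarith)
  · have : (-s) x = -(s x) := rfl
    rw [this, h.1]; module
  · have : (-s) (-y) = (s y) := by simp
    rw [this, h.2]; module

lemma eig_ce {a s n : E →L[ℝ] E} (H : SN a s n) {β : ℝ} {x y : E} (h : IsEig s 0 β x y) :
    x ∈ ceS a := by
  rw [mem_ceS]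
  intro ε hε
  obtain ⟨C, hC⟩ := eig_bound H h (ε := ε/2) (by linarith)
  rw [tendsto_zero_iff_norm_tendsto_zero]
  have h0 : Tendsto (fun t : ℝ => |t|) (atBot ⊔ atTop) atTop :=
    tendsto_sup.2 ⟨tendsto_abs_atBot_atTop, tendsto_abs_atTop_atTop⟩
  have h1 : Tendsto (fun t : ℝ => C * Real.exp (-(ε / 2) * |t|)) (atBot ⊔ atTop) (𝓝 0) := by
    have := (Real.tendsto_exp_atBot.comp
      (h0.const_mul_atTop_of_neg (show -(ε / 2) < 0 by linarith))).const_mul C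
    simpa [Function.comp_def] using this
  refine squeeze_zero (fun _ => norm_nonneg _) (fun t => ?_) h1
  rw [norm_smul, Real.norm_eq_abs, abs_of_pos (Real.exp_pos _)]
  calc _ ≤ Real.exp (-(ε * |t|)) * (C * Real.exp (0 * t + ε / 2 * |t|)) := by gcongr; exact hC t
    _ = C * (Real.exp (-(ε * |t|)) * Real.exp (0 * t + ε / 2 * |t|)) := by ring
    _ = _ := by rw [← Real.exp_add]; congr 2; ring

/-- span of central eigenvectors -/
def ceE (s : E →L[ℝ] E) : Submodule ℝ E :=
  Submodule.span ℝ {x : E | ∃ β y, 0 ≤ β ∧ IsEig s 0 β x y}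

lemma ceE_le {a s n : E →L[ℝ] E} (H : SN a s n) : ceE s ≤ ceS a := by
  apply Submodule.span_le.2
  rintro x ⟨β, y, _, h⟩
  exact eig_ce H h

lemma decomp_aux {a s n : E →L[ℝ] E} (H : SN a s n) (x : E) :
    ∃ u ∈ stS a, ∃ c ∈ ceE s, ∃ v ∈ unS a, x = u + c + v := by
  have : x ∈ stS a ⊔ ceE s ⊔ unS a := by
    have hx : x ∈ Submodule.span ℝ {x : E | ∃ α β y, 0 ≤ β ∧ IsEig s α β x y} := by
      rw [H.spn]; trivial
    refine (Submodule.span_le.2 ?_) hx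
    rintro z ⟨α, β, y, hβ, h⟩
    rcases lt_trichotomy α 0 with hα | rfl | hα
    · exact Submodule.mem_sup_left (Submodule.mem_sup_left (eig_st H h hα))
    · exact Submodule.mem_sup_left (Submodule.mem_sup_right
        (Submodule.subset_span ⟨β, y, hβ, h⟩))
    · exact Submodule.mem_sup_right (eig_un H h hα)
  obtain ⟨w, hw, v, hv, rfl⟩ := Submodule.mem_sup.1 this
  obtain ⟨u, hu, c, hc, rfl⟩ := Submodule.mem_sup.1 hw
  exact ⟨u, hu, c, hc, v, hv, rfl⟩

lemma ceS_eq {a s n : E →L[ℝ] E} (H : SN a s n) : ceS a = ceE s := by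
  refine le_antisymm (fun x hx => ?_) (ceE_le H)
  obtain ⟨u, hu, c, hc, v, hv, h⟩ := decomp_aux H x
  have : x - c = 0 := indep_ce a ((ceS a).sub_mem hx (ceE_le H hc)) hu hv (by rw [h]; abel)
  rw [sub_eq_zero.1 this]; exact hc

lemma decomp (a : E →L[ℝ] E) (x : E) :
    ∃ u ∈ stS a, ∃ c ∈ ceS a, ∃ v ∈ unS a, x = u + c + v := by
  obtain ⟨s, n, H⟩ := exists_SN a
  obtain ⟨u, hu, c, hc, v, hv, h⟩ := decomp_aux H x
  exact ⟨u, hu, c, ceE_le H hc, v, hv, h⟩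

/-- spectral projections -/
structure Proj (a PS PC PU : E →L[ℝ] E) : Prop where
  memS : ∀ x, PS x ∈ stS a
  memC : ∀ x, PC x ∈ ceS a
  memU : ∀ x, PU x ∈ unS a
  sum : ∀ x, PS x + PC x + PU x = x
  uniq : ∀ u c v, u ∈ stS a → c ∈ ceS a → v ∈ unS a →
    PS (u + c + v) = u ∧ PC (u + c + v) = c ∧ PU (u + c + v) = v
  flS : ∀ t x, PS (fl a t x) = fl a t (PS x)
  flC : ∀ t x, PC (fl a t x) = fl a t (PC x)
  flU : ∀ t x, PU (fl a t x) = fl a t (PU x)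

lemma decomp_uniq (a : E →L[ℝ] E) {u c v u' c' v' : E} (hu : u ∈ stS a) (hc : c ∈ ceS a)
    (hv : v ∈ unS a) (hu' : u' ∈ stS a) (hc' : c' ∈ ceS a) (hv' : v' ∈ unS a)
    (h : u + c + v = u' + c' + v') : u = u' ∧ c = c' ∧ v = v' := by
  have h0 : (u - u') = (c' - c) + (v' - v) := by
    have : u - u' = (u + c + v) - (u' + c + v) := by abel
    rw [this, h]; abel
  have h1 := indep_st a ((stS a).sub_mem hu hu') ((ceS a).sub_mem hc' hc)
    ((unS a).sub_mem hv' hv) h0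
  have h2 := indep_ce a ((ceS a).sub_mem hc hc') ((stS a).sub_mem hu' hu)
    ((unS a).sub_mem hv' hv) (by
      have : c - c' = (u + c + v) - (u + c' + v) := by abel
      rw [this, h]; abel)
  have e1 := sub_eq_zero.1 h1
  have e2 := sub_eq_zero.1 h2
  subst e1 e2
  exact ⟨rfl, rfl, by simpa using h⟩

lemma exists_Proj (a : E →L[ℝ] E) : ∃ PS PC PU, Proj a PS PC PU := by
  choose f hf g hg k hk h using decomp a
  have key : ∀ x u c v, u ∈ stS a → c ∈ ceS a → v ∈ unS a → x = u + c + v →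
      f x = u ∧ g x = c ∧ k x = v := by
    intro x u c v hu hc hv e
    exact decomp_uniq a (hf x) (hg x) (hk x) hu hc hv (by rw [← h x, e])
  have hadd : ∀ x y, f (x + y) = f x + f y ∧ g (x + y) = g x + g y ∧ k (x + y) = k x + k y := by
    intro x y
    apply key _ _ _ _ ((stS a).add_mem (hf x) (hf y)) ((ceS a).add_mem (hg x) (hg y))
      ((unS a).add_mem (hk x) (hk y))
    nth_rewrite 1 [h x, h y]; abel
  have hsm : ∀ (r : ℝ) x, f (r • x) = r • f x ∧ g (r • x) = r • g x ∧ k (r • x) = r • k x := by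
    intro r x
    apply key _ _ _ _ ((stS a).smul_mem r (hf x)) ((ceS a).smul_mem r (hg x))
      ((unS a).smul_mem r (hk x))
    nth_rewrite 1 [h x]; module
  have hfl : ∀ t x, f (fl a t x) = fl a t (f x) ∧ g (fl a t x) = fl a t (g x) ∧
      k (fl a t x) = fl a t (k x) := by
    intro t x
    apply key _ _ _ _ (stS_fl a t (hf x)) (ceS_fl a t (hg x)) (unS_fl a t (hk x))
    nth_rewrite 1 [h x]; simp
  let F : E →ₗ[ℝ] E := ⟨⟨f, fun x y => (hadd x y).1⟩, fun r x => (hsm r x).1⟩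
  let G : E →ₗ[ℝ] E := ⟨⟨g, fun x y => (hadd x y).2.1⟩, fun r x => (hsm r x).2.1⟩
  let K : E →ₗ[ℝ] E := ⟨⟨k, fun x y => (hadd x y).2.2⟩, fun r x => (hsm r x).2.2⟩
  exact ⟨LinearMap.toContinuousLinearMap F, LinearMap.toContinuousLinearMap G,
    LinearMap.toContinuousLinearMap K, hf, hg, hk, fun x => (h x).symm,
    fun u c v hu hc hv => key _ u c v hu hc hv rfl, fun t x => (hfl t x).1,
    fun t x => (hfl t x).2.1, fun t x => (hfl t x).2.2⟩

end Struct

section mat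
variable {d : ℕ}
lemma XS_eq (A : Matrix (Fin d) (Fin d) ℝ) : XS A = stS (mcl A) := by
  have : stableSet A = (stS (mcl A) : Set (Euc d)) := by
    ext x; simp only [stableSet, linFlow_eq]; rfl
  rw [XS, this, Submodule.span_eq]
lemma XU_eq (A : Matrix (Fin d) (Fin d) ℝ) : XU A = unS (mcl A) := by
  have : unstableSet A = (unS (mcl A) : Set (Euc d)) := by
    ext x; simp only [unstableSet, linFlow_eq]; rfl
  rw [XU, this, Submodule.span_eq]
lemma XC_eq (A : Matrix (Fin d) (Fin d) ℝ) : XC A = ceS (mcl A) := by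
  have : centralSet A = (ceS (mcl A) : Set (Euc d)) := by
    ext x; simp only [centralSet, linFlow_eq]; rfl
  rw [XC, this, Submodule.span_eq]
lemma XH_eq (A : Matrix (Fin d) (Fin d) ℝ) : XH A = stS (mcl A) ⊔ unS (mcl A) := by
  rw [XH, XS_eq, XU_eq]
end mat


section G
variable {E : Type*} [NormedAddCommGroup E] [NormedSpace ℝ E] [FiniteDimensional ℝ E]
  [CompleteSpace E]
variable {F : Type*} [NormedAddCommGroup F] [NormedSpace ℝ F] [FiniteDimensional ℝ F]
  [CompleteSpace F]

/-- Hölder near zero, generic version -/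
def HNZ {E F : Type*} [NormedAddCommGroup E] [NormedAddCommGroup F] (β : ℝ) (f : E → F) : Prop :=
  ∃ r > (0 : ℝ), ∃ K : ℝ, ∀ x y, ‖x‖ < r → ‖y‖ < r → ‖f x - f y‖ ≤ K * ‖x - y‖ ^ β

/-- adapted norm and section -/
structure Sec (a : E →L[ℝ] E) (ρ : ℝ) where
  N : E → ℝ
  C : ℝ
  l : ℝ
  L : ℝ
  s : E → ℝ
  hC : 0 < C
  hl : 0 < l
  hL : 0 < L
  N_tri : ∀ x y, N x ≤ N y + N (x - y)
  N_symm : ∀ x, N (-x) = N x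
  le_N : ∀ x, ‖x‖ ≤ N x
  N_le : ∀ x, N x ≤ C * ‖x‖
  dec : ∀ t x, 0 ≤ t → N (fl a t x) ≤ Real.exp (-(l * t)) * N x
  inc : ∀ t x, 0 ≤ t → N (fl a (-t) x) ≤ Real.exp (L * t) * N x
  s_spec : ∀ x, x ≠ 0 → N (fl a (-s x) x) = ρ
  s_uniq : ∀ t x, N (fl a (-t) x) = ρ → s x = t

lemma fl_norm_le (a : E →L[ℝ] E) : ∃ L, 0 < L ∧ ∀ t x, 0 ≤ t → 
    ‖fl a t x‖ ≤ Real.exp (L * t) * ‖x‖ := by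
  refine ⟨‖a‖ + 1, by positivity, fun t x ht => ?_⟩
  have h := norm_le_gronwallBound_of_norm_deriv_right_le (f := fun u => fl a u x)
    (f' := fun u => a (fl a u x)) (δ := ‖x‖) (K := ‖a‖ + 1) (ε := 0) (a := 0) (b := t)
    (fun u _ => (hasDerivAt_fl a u x).continuousAt.continuousWithinAt)
    (fun u _ => (hasDerivAt_fl a u x).hasDerivWithinAt) (by simp)
    (fun u _ => by
      have := a.le_opNorm (fl a u x)
      nlinarith [norm_nonneg (fl a u x)]) t ⟨ht, le_rfl⟩
  rw [gronwallBound_ε0] at h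
  simpa [mul_comm] using h

lemma exists_Sec (a : E →L[ℝ] E) (ha : ∀ x, x ∈ stS a) {ρ : ℝ} (hρ : 0 < ρ) :
    Nonempty (Sec a ρ) := by
  obtain ⟨C, l, hC, hl, HB⟩ := stS_bound a
  obtain ⟨L, hL, HL⟩ := fl_norm_le (-a)
  let N : E → ℝ := fun x => ⨆ t : NNReal, Real.exp (l * t) * ‖fl a t x‖
  have hb : ∀ x (t : NNReal), Real.exp (l * t) * ‖fl a t x‖ ≤ C * ‖x‖ := by
    intro x t
    calc _ ≤ Real.exp (l * t) * (C * Real.exp (-(l * t)) * ‖x‖) := by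
          gcongr; exact HB t t.2 x (ha x)
      _ = (Real.exp (l * t) * Real.exp (-(l * t))) * (C * ‖x‖) := by ring
      _ = _ := by rw [← Real.exp_add]; simp
  have hbdd : ∀ x, BddAbove (Set.range fun t : NNReal => Real.exp (l * t) * ‖fl a t x‖) :=
    fun x => ⟨_, by rintro _ ⟨t, rfl⟩; exact hb x t⟩
  have le_sup : ∀ x (t : NNReal), Real.exp (l * t) * ‖fl a t x‖ ≤ N x := fun x t =>
    le_ciSup (hbdd x) t
  have N_le : ∀ x, N x ≤ C * ‖x‖ := fun x => ciSup_le (hb x)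
  have le_N : ∀ x, ‖x‖ ≤ N x := fun x => by simpa using le_sup x 0
  have N_tri : ∀ x y, N x ≤ N y + N (x - y) := by
    intro x y
    refine ciSup_le fun t => ?_
    have h1 := le_sup y t
    have h2 := le_sup (x - y) t
    have : ‖fl a t x‖ ≤ ‖fl a t y‖ + ‖fl a t (x - y)‖ := by
      have e : fl a t x = fl a t y + fl a t (x - y) := by simp
      rw [e]; exact norm_add_le _ _
    nlinarith [Real.exp_pos (l * t)]
  have dec : ∀ t x, 0 ≤ t → N (fl a t x) ≤ Real.exp (-(l * t)) * N x := by
    intro t x ht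
    refine ciSup_le fun u => ?_
    have h1 := le_sup x (u + ⟨t, ht⟩)
    rw [← fl_add_apply]
    calc Real.exp (l * u) * ‖fl a (u + t) x‖
        = Real.exp (-(l * t)) * (Real.exp (l * (u + t)) * ‖fl a (u + t) x‖) := by
          rw [← mul_assoc, ← Real.exp_add]; ring_nf
      _ ≤ _ := by gcongr; exact h1
  have inc : ∀ t x, 0 ≤ t → N (fl a (-t) x) ≤ Real.exp (L * t) * N x := by
    intro t x ht
    refine ciSup_le fun u => ?_
    have h1 := le_sup x u
    have h2 := HL t (fl a u x) ht
    rw [fl_neg_gen, ← fl_add_apply] at h2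
    rw [← fl_add_apply, add_comm]
    calc _ ≤ Real.exp (l * u) * (Real.exp (L * t) * ‖fl a u x‖) := by gcongr
      _ = Real.exp (L * t) * (Real.exp (l * u) * ‖fl a u x‖) := by ring
      _ ≤ _ := by gcongr
  have Ncont : Continuous N := by
    have : LipschitzWith ⟨C, hC.le⟩ N := by
      refine LipschitzWith.of_dist_le_mul fun x y => ?_
      rw [Real.dist_eq, abs_le, dist_eq_norm]
      change -(C * ‖x - y‖) ≤ _ ∧ _ ≤ C * ‖x - y‖
      have h1 := N_tri x y
      have h2 := N_tri y x
      have h3 := N_le (x - y)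
      have h4 := N_le (y - x)
      rw [norm_sub_rev] at h4
      constructor <;> linarith
    exact this.continuous
  have Nnn : ∀ x, 0 ≤ N x := fun x => (norm_nonneg x).trans (le_N x)
  have hex : ∀ x, x ≠ 0 → ∃ t, N (fl a (-t) x) = ρ := by
    intro x hx
    have hx0 : 0 < N x := (norm_pos_iff.2 hx).trans_le (le_N x)
    have hc : Continuous fun t => N (fl a (-t) x) :=
      Ncont.comp (((continuous_fl a).comp continuous_neg).clm_apply continuous_const)
    have hlow : ∃ t, N (fl a (-t) x) ≤ ρ := by
      have h1 : Tendsto (fun t : ℝ => Real.exp (-(l * t)) * N x) atTop (𝓝 0) := by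
        have := (Real.tendsto_exp_neg_atTop_nhds_zero.comp
          (tendsto_id.const_mul_atTop hl)).mul_const (N x)
        simpa [Function.comp_def] using this
      obtain ⟨t, ht, ht0⟩ := ((h1.eventually (gt_mem_nhds hρ)).and (eventually_ge_atTop 0)).exists
      exact ⟨-t, by simpa using (dec t x ht0).trans ht.le⟩
    have hhigh : ∃ t, ρ ≤ N (fl a (-t) x) := by
      have h1 : Tendsto (fun t : ℝ => Real.exp (l * t) * N x) atTop atTop := by
        exact (Real.tendsto_exp_atTop.comp
          (tendsto_id.const_mul_atTop hl)).atTop_mul_const hx0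
      obtain ⟨t, ht, ht0⟩ := ((h1.eventually_ge_atTop ρ).and (eventually_ge_atTop 0)).exists
      refine ⟨t, ht.trans ?_⟩
      have := dec t (fl a (-t) x) ht0
      rw [fl_neg_apply'] at this
      calc _ ≤ Real.exp (l * t) * (Real.exp (-(l * t)) * N (fl a (-t) x)) := by gcongr
        _ = _ := by rw [← mul_assoc, ← Real.exp_add]; simp
    exact mem_range_of_exists_le_of_exists_ge hc hlow hhigh
  have huq : ∀ x t t', t < t' → N (fl a (-t) x) = ρ → N (fl a (-t') x) = ρ → False := by
    intro x t t' htt h1 h2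
    have := dec (t' - t) (fl a (-t') x) (by linarith)
    rw [← fl_add_apply] at this
    have e : t' - t + -t' = -t := by ring
    rw [e, h1, h2] at this
    have : Real.exp (-(l * (t' - t))) < 1 := Real.exp_lt_one_iff.2 (by nlinarith)
    nlinarith
  have huq' : ∀ x t t', N (fl a (-t) x) = ρ → N (fl a (-t') x) = ρ → t = t' := by
    intro x t t' h1 h2
    rcases lt_trichotomy t t' with h | h | h
    · exact (huq x t t' h h1 h2).elim
    · exact h
    · exact (huq x t' t h h2 h1).elim
  classical
  let s : E → ℝ := fun x => if h : ∃ t, N (fl a (-t) x) = ρ then h.choose else 0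
  have hs : ∀ x, (∃ t, N (fl a (-t) x) = ρ) → N (fl a (-s x) x) = ρ := by
    intro x h
    simp only [s, dif_pos h]
    exact h.choose_spec
  exact ⟨⟨N, C, l, L, s, hC, hl, hL, N_tri, fun x => by simp [N], le_N, N_le, dec, inc, fun x hx => hs x (hex x hx),
    fun t x h => huq' x _ _ (hs x ⟨t, h⟩) h⟩⟩

namespace Sec
variable {a : E →L[ℝ] E} {ρ : ℝ} (S : Sec a ρ)

/-- projection to the section -/
def p (x : E) : E := fl a (-S.s x) x

lemma N_zero : S.N 0 = 0 := by
  have h1 := S.N_le 0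
  have h2 := S.le_N 0
  simp at h1 h2
  linarith

lemma N_nonneg (x : E) : 0 ≤ S.N x := (norm_nonneg x).trans (S.le_N x)

lemma N_neg (x y : E) : |S.N x - S.N y| ≤ S.C * ‖x - y‖ := by
  rw [abs_le]
  have h1 := S.N_tri x y
  have h2 := S.N_tri y x
  have h3 := S.N_le (x - y)
  have h4 := S.N_le (y - x)
  rw [norm_sub_rev] at h4
  constructor <;> linarith

lemma N_cont : Continuous S.N := by
  have : LipschitzWith ⟨S.C, S.hC.le⟩ S.N :=
    LipschitzWith.of_dist_le_mul fun x y => by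
      rw [Real.dist_eq, dist_eq_norm]; exact S.N_neg x y
  exact this.continuous

lemma ne_zero_of_N (hρ : 0 < ρ) {x : E} (h : S.N x = ρ) : x ≠ 0 := by
  rintro rfl; rw [S.N_zero] at h; linarith

lemma s_fl {x : E} (hx : x ≠ 0) (t : ℝ) : S.s (fl a t x) = S.s x + t := by
  apply S.s_uniq
  rw [← fl_add_apply, show -(S.s x + t) + t = -S.s x by ring]
  exact S.s_spec x hx

lemma s_of_N {x : E} (h : S.N x = ρ) : S.s x = 0 := by
  apply S.s_uniq; simpa

lemma p_fl {x : E} (hx : x ≠ 0) (t : ℝ) : S.p (fl a t x) = S.p x := by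
  unfold p
  rw [S.s_fl hx, ← fl_add_apply]; congr 2; ring

lemma N_p {x : E} (hx : x ≠ 0) : S.N (S.p x) = ρ := S.s_spec x hx

lemma p_of_N {x : E} (h : S.N x = ρ) : S.p x = x := by
  unfold p; rw [S.s_of_N h]; simp

lemma fl_p (x : E) : fl a (S.s x) (S.p x) = x := by simp [p]

lemma fl_ne {x : E} (hx : x ≠ 0) (t : ℝ) : fl a t x ≠ 0 := by
  intro h; apply hx; apply fl_injective a t; simpa using h

/-- `s ≥ 0` estimates -/
lemma N_ge {x : E} (hx : x ≠ 0) (hs : 0 ≤ S.s x) : Real.exp (-(S.L * S.s x)) * ρ ≤ S.N x := by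
  have := S.inc (S.s x) x hs
  rw [S.s_spec x hx] at this
  calc _ ≤ Real.exp (-(S.L * S.s x)) * (Real.exp (S.L * S.s x) * S.N x) := by gcongr
    _ = _ := by rw [← mul_assoc, ← Real.exp_add]; simp

lemma s_abs_le (hρ : 0 < ρ) {x : E} (hx : x ≠ 0) : S.l * |S.s x| ≤ |Real.log (S.N x / ρ)| := by
  have hN : 0 < S.N x := (norm_pos_iff.2 hx).trans_le (S.le_N x)
  rcases le_total 0 (S.s x) with h | h
  · have h1 := S.dec (S.s x) (S.p x) h
    rw [S.fl_p, S.N_p hx] at h1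
    have h2 : Real.log (S.N x / ρ) ≤ -(S.l * S.s x) := by
      rw [Real.log_le_iff_le_exp (by positivity), div_le_iff₀ hρ]; exact h1
    rw [abs_of_nonneg h]
    exact (by linarith : _ ≤ - Real.log (S.N x / ρ)).trans (neg_le_abs _)
  · have h1 := S.dec (-S.s x) x (by linarith)
    rw [S.s_spec x hx] at h1
    have h2 : S.l * (-S.s x) ≤ Real.log (S.N x / ρ) := by
      rw [Real.le_log_iff_exp_le (by positivity), le_div_iff₀ hρ]
      calc _ ≤ Real.exp (S.l * (-S.s x)) * (Real.exp (-(S.l * (-S.s x))) * S.N x) := by gcongr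
        _ = _ := by rw [← mul_assoc, ← Real.exp_add]; simp
    rw [abs_of_nonpos h]
    exact h2.trans (le_abs_self _)

lemma s_pos_of (hρ : 0 < ρ) {x : E} (hx : x ≠ 0) (h : S.N x ≤ ρ) : 0 ≤ S.s x := by
  by_contra hc
  push Not at hc
  have h1 := S.dec (-S.s x) x (by linarith)
  rw [S.s_spec x hx] at h1
  have : Real.exp (-(S.l * (-S.s x))) < 1 := Real.exp_lt_one_iff.2 (by nlinarith [S.hl])
  nlinarith [S.N_nonneg x, Real.exp_pos (-(S.l * (-S.s x)))]

lemma lip (hρ : 0 < ρ) : ∃ D, 0 < D ∧ ∀ u v, S.N u = ρ → S.N (v - u) ≤ ρ / 2 → v ≠ 0 ∧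
    |S.s v| ≤ D * ‖v - u‖ ∧ ‖S.p v - u‖ ≤ D * ‖v - u‖ ∧ ∀ z, ‖fl a (S.s v) z - z‖ ≤
      D * ‖v - u‖ * ‖z‖ := by
  obtain ⟨M, hM⟩ := (isCompact_Icc (a := -(1/S.l)) (b := 1/S.l)).exists_bound_of_continuousOn
    (f := fun t => a * fl a t) (continuous_const.mul (continuous_fl a)).continuousOn
  have hflip : ∀ σ, |σ| ≤ 1 / S.l → ∀ z, ‖fl a σ z - z‖ ≤ |M| * |σ| * ‖z‖ := by
    intro σ hσ z
    have h1 : ‖fl a σ - fl a 0‖ ≤ |M| * ‖σ - 0‖ := by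
      refine Convex.norm_image_sub_le_of_norm_hasDerivWithin_le (f := fun t => fl a t)
        (f' := fun t => a * fl a t) (s := Set.Icc (-(1/S.l)) (1/S.l))
        (fun t _ => (hasDerivAt_fl' a t).hasDerivWithinAt)
        (fun t ht => (hM t ht).trans (le_abs_self M)) (convex_Icc _ _) ?_ (abs_le.1 hσ)
      have := S.hl
      constructor
      · simp only [Left.neg_nonpos_iff]; positivity
      · positivity
    have h2 := (fl a σ - fl a 0).le_opNorm z
    simp [fl_zero] at h2 h1
    calc _ ≤ _ := h2
      _ ≤ _ := by gcongr
  set D1 := 2 * S.C / (ρ * S.l) with hD1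
  have hl := S.hl
  have hC := S.hC
  have hD1pos : 0 < D1 := by positivity
  have hsv : ∀ u v, S.N u = ρ → S.N (v - u) ≤ ρ / 2 → v ≠ 0 ∧ |S.s v| ≤ D1 * ‖v - u‖ ∧
      |S.s v| ≤ 1 / S.l ∧ S.N v ≤ 3 / 2 * ρ := by
    intro u v hu huv
    have hlow : ρ / 2 ≤ S.N v := by
      have h1 := S.N_tri u v
      have h2 : S.N (u - v) = S.N (v - u) := by
        rw [← S.N_symm, neg_sub]
      linarith
    have hv : v ≠ 0 := by
      rintro rfl; rw [S.N_zero] at hlow; linarith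
    have hup : S.N v ≤ 3 / 2 * ρ := by
      have := S.N_tri v u; linarith
    have h3 := S.s_abs_le hρ hv
    have hz : 1 / 2 ≤ S.N v / ρ := by rw [le_div_iff₀ hρ]; linarith
    have hz2 : S.N v / ρ ≤ 3 / 2 := by rw [div_le_iff₀ hρ]; linarith
    have hlog : |Real.log (S.N v / ρ)| ≤ 2 * |S.N v / ρ - 1| := by
      set z := S.N v / ρ
      have hz0 : 0 < z := by linarith
      rw [abs_le]
      constructor
      · have := Real.one_sub_inv_le_log_of_pos hz0
        have h5 : 1 - z⁻¹ = (z - 1) * z⁻¹ := by field_simp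
        have h6 : z⁻¹ ≤ 2 := by rw [inv_le_comm₀ hz0 (by norm_num)]; linarith
        have h7 := neg_abs_le (z - 1)
        have h8 : 0 < z⁻¹ := by positivity
        have h9 := abs_nonneg (z - 1)
        nlinarith
      · have := Real.log_le_sub_one_of_pos hz0
        have := le_abs_self (z - 1)
        linarith [abs_nonneg (z-1)]
    have h10 : |S.N v / ρ - 1| ≤ S.C * ‖v - u‖ / ρ := by
      have : S.N v / ρ - 1 = (S.N v - S.N u) / ρ := by rw [hu]; field_simp
      rw [this, abs_div, abs_of_pos hρ]
      gcongr
      exact S.N_neg v u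
    have h11 : |S.N v / ρ - 1| ≤ 1 / 2 := by
      rw [abs_le]; constructor <;> linarith
    refine ⟨hv, ?_, ?_, hup⟩
    · have : S.l * |S.s v| ≤ 2 * (S.C * ‖v - u‖ / ρ) := by linarith
      rw [hD1]
      rw [div_mul_eq_mul_div, le_div_iff₀ (by positivity)]
      have h12 := mul_le_mul_of_nonneg_left this hρ.le
      have h13 : ρ * (2 * (S.C * ‖v - u‖ / ρ)) = 2 * S.C * ‖v - u‖ := by field_simp
      linarith
    · rw [le_div_iff₀ hl]; linarith
  refine ⟨D1 + |M| * D1 + (|M| * D1 * (3/2 * ρ) + 1), by positivity, fun u v hu huv => ?_⟩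
  obtain ⟨hv, h1, h2, h3⟩ := hsv u v hu huv
  have hn := norm_nonneg (v - u)
  have hM0 := abs_nonneg M
  refine ⟨hv, ?_, ?_, ?_⟩
  · refine h1.trans ?_
    gcongr
    have : 0 ≤ |M| * D1 := by positivity
    have : 0 ≤ |M| * D1 * (3/2 * ρ) := by positivity
    linarith
  · have e : S.p v - u = (fl a (-S.s v) v - v) + (v - u) := by simp [p]
    rw [e]
    have h4 := hflip (-S.s v) (by simpa using h2) v
    rw [abs_neg] at h4
    have h5 : ‖v‖ ≤ 3/2 * ρ := (S.le_N v).trans h3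
    calc _ ≤ |M| * |S.s v| * ‖v‖ + ‖v - u‖ := (norm_add_le _ _).trans (by linarith)
      _ ≤ |M| * (D1 * ‖v - u‖) * (3/2 * ρ) + ‖v - u‖ := by gcongr
      _ = (|M| * D1 * (3/2 * ρ) + 1) * ‖v - u‖ := by ring
      _ ≤ _ := by
        apply mul_le_mul_of_nonneg_right _ hn
        have : 0 ≤ |M| * D1 := by positivity
        linarith
  · intro z
    have h4 := hflip (S.s v) h2 z
    calc _ ≤ |M| * (D1 * ‖v - u‖) * ‖z‖ := h4.trans (by gcongr)
      _ = (|M| * D1) * ‖v - u‖ * ‖z‖ := by ring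
      _ ≤ _ := by
        gcongr
        have : 0 ≤ |M| * D1 * (3/2 * ρ) := by positivity
        linarith

end Sec
end G


section G
variable {E : Type*} [NormedAddCommGroup E] [NormedSpace ℝ E] [FiniteDimensional ℝ E]
  [CompleteSpace E]
variable {F : Type*} [NormedAddCommGroup F] [NormedSpace ℝ F] [FiniteDimensional ℝ F]
  [CompleteSpace F]

lemma rpow_interp {q q0 β γ : ℝ} (hq : 0 ≤ q) (hq0 : q ≤ q0) (hβ : 0 < β) (h : β ≤ γ) :
    q ^ γ ≤ q0 ^ (γ - β) * q ^ β := by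
  rcases hq.eq_or_lt with rfl | hq
  · rw [Real.zero_rpow (by linarith), Real.zero_rpow (by linarith)]; simp
  · calc q ^ γ = q ^ (γ - β) * q ^ β := by rw [← Real.rpow_add hq]; ring_nf
      _ ≤ _ := by gcongr

lemma HNZ.mono {E F : Type*} [NormedAddCommGroup E] [NormedAddCommGroup F] {β γ : ℝ} {f : E → F}
    (hβ : 0 < β) (h : β ≤ γ) (H : HNZ γ f) : HNZ β f := by
  obtain ⟨r, hr, K, hK⟩ := H
  refine ⟨r, hr, |K| * (2 * r) ^ (γ - β), fun x y hx hy => (hK x y hx hy).trans ?_⟩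
  have h1 : ‖x - y‖ ≤ 2 * r := (norm_sub_le x y).trans (by linarith)
  have h2 := rpow_interp (norm_nonneg (x - y)) h1 hβ h
  have h3 : 0 ≤ ‖x - y‖ ^ γ := by positivity
  calc K * ‖x - y‖ ^ γ ≤ |K| * ‖x - y‖ ^ γ := by gcongr; exact le_abs_self K
    _ ≤ |K| * ((2 * r) ^ (γ - β) * ‖x - y‖ ^ β) := by gcongr
    _ = _ := by ring

lemma fl_lip (a : E →L[ℝ] E) (R : ℝ) : ∃ M, 0 ≤ M ∧ ∀ σ, |σ| ≤ R → ∀ z,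
    ‖fl a σ z - z‖ ≤ M * |σ| * ‖z‖ := by
  obtain ⟨M, hM⟩ := (isCompact_Icc (a := -R) (b := R)).exists_bound_of_continuousOn
    (f := fun t => a * fl a t) (continuous_const.mul (continuous_fl a)).continuousOn
  refine ⟨|M|, abs_nonneg _, fun σ hσ z => ?_⟩
  have hR : 0 ≤ R := (abs_nonneg σ).trans hσ
  have h1 : ‖fl a σ - fl a 0‖ ≤ |M| * ‖σ - 0‖ := by
    refine Convex.norm_image_sub_le_of_norm_hasDerivWithin_le (f := fun t => fl a t)
      (f' := fun t => a * fl a t) (s := Set.Icc (-R) R)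
      (fun t _ => (hasDerivAt_fl' a t).hasDerivWithinAt)
      (fun t ht => (hM t ht).trans (le_abs_self M)) (convex_Icc _ _) ?_ (abs_le.1 hσ)
    constructor <;> linarith
  have h2 := (fl a σ - fl a 0).le_opNorm z
  simp [fl_zero] at h2 h1
  calc _ ≤ _ := h2
    _ ≤ _ := by gcongr

lemma fl_bdd (a : E →L[ℝ] E) (R : ℝ) : ∃ M, 0 ≤ M ∧ ∀ σ, |σ| ≤ R → ∀ z,
    ‖fl a σ z‖ ≤ M * ‖z‖ := by
  obtain ⟨M, hM⟩ := (isCompact_Icc (a := -R) (b := R)).exists_bound_of_continuousOn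
    (f := fun t => fl a t) (continuous_fl a).continuousOn
  refine ⟨|M|, abs_nonneg _, fun σ hσ z => ((fl a σ).le_opNorm z).trans ?_⟩
  gcongr
  exact (hM σ (abs_le.1 hσ)).trans (le_abs_self M)

namespace Sec
variable {a : E →L[ℝ] E} {ρ : ℝ} (S : Sec a ρ)

lemma p_lip (hρ : 0 < ρ) {K : Set E} (hK : IsCompact K) (h0 : (0 : E) ∉ K) :
    ∃ D, 0 ≤ D ∧ ∀ z ∈ K, ∀ z' ∈ K, ‖S.p z' - S.p z‖ ≤ D * ‖z' - z‖ := by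
  have hne : ∀ z ∈ K, z ≠ 0 := fun z hz h => h0 (h ▸ hz)
  obtain ⟨R0, hR0⟩ := hK.exists_bound_of_continuousOn (f := fun z => Real.log (S.N z / ρ)) (by
    refine ContinuousOn.log (S.N_cont.div_const ρ).continuousOn fun z hz => ?_
    have : 0 < S.N z := (norm_pos_iff.2 (hne z hz)).trans_le (S.le_N z)
    positivity)
  have hl := S.hl
  have hC := S.hC
  have hs : ∀ z ∈ K, |-S.s z| ≤ R0 / S.l := fun z hz => by
    rw [le_div_iff₀ hl, abs_neg]
    have := S.s_abs_le hρ (hne z hz)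
    have := hR0 z hz
    rw [Real.norm_eq_abs] at this
    linarith
  obtain ⟨M, hM0, hM⟩ := fl_bdd a (R0 / S.l)
  obtain ⟨D, hD0, hD⟩ := S.lip hρ
  refine ⟨D * M + 4 * S.C * M, by positivity, fun z hz z' hz' => ?_⟩
  have h1 := hM _ (hs z hz) (z' - z)
  rw [map_sub] at h1
  have hn := norm_nonneg (z' - z)
  change ‖fl a (-S.s z) z' - S.p z‖ ≤ _ at h1
  by_cases hc : S.N (fl a (-S.s z) z' - S.p z) ≤ ρ / 2
  · obtain ⟨-, -, h2, -⟩ := hD _ _ (S.N_p (hne z hz)) hc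
    rw [S.p_fl (hne z' hz')] at h2
    calc _ ≤ D * (M * ‖z' - z‖) := h2.trans (by gcongr)
      _ ≤ _ := by rw [add_mul]; have : 0 ≤ 4 * S.C * M * ‖z' - z‖ := by positivity
                  linarith
  · push Not at hc
    have h2 := S.N_le (fl a (-S.s z) z' - S.p z)
    have h3 : ‖S.p z' - S.p z‖ ≤ 2 * ρ := by
      have e1 := S.le_N (S.p z); have e2 := S.le_N (S.p z')
      rw [S.N_p (hne _ ‹_›)] at e1 e2
      exact (norm_sub_le _ _).trans (by linarith)
    have h4 : S.C * ‖fl a (-S.s z) z' - S.p z‖ ≤ S.C * (M * ‖z' - z‖) := by gcongr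
    have : 0 ≤ D * M * ‖z' - z‖ := by positivity
    nlinarith

variable {b : F →L[ℝ] F} {ρ' : ℝ} (S' : Sec b ρ')
open Classical in
/-- conjugating map -/
def H (k : E → F) (x : E) : F := if x = 0 then 0 else fl b (S.s x) (k (S.p x))

lemma H_zero (k : E → F) : S.H (b := b) k 0 = 0 := by simp [H]

lemma H_fl (k : E → F) (t : ℝ) (x : E) : S.H (b := b) k (fl a t x) = fl b t (S.H (b := b) k x) := by
  by_cases hx : x = 0
  · simp [H, hx]
  · simp only [H, hx, Sec.fl_ne hx, if_false]
    rw [S.s_fl hx, S.p_fl hx, ← fl_add_apply, add_comm]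

lemma H_holder (hρ : 0 < ρ) (hρ' : 0 < ρ') {k : E → F} {K γ : ℝ} (hγ : 0 < γ)
    (hk : ∀ u, S.N u = ρ → S'.N (k u) = ρ')
    (hk2 : ∀ u v, S.N u = ρ → S.N v = ρ → ‖k u - k v‖ ≤ K * ‖u - v‖ ^ γ) :
    ∃ β > 0, HNZ β (S.H (b := b) k) := by
  have hl := S'.hl
  have hL := S.hL
  have hC := S.hC
  have hC' := S'.hC
  obtain ⟨β, hβ, hβγ, hβ1, hβL⟩ : ∃ β > 0, β ≤ γ ∧ β ≤ 1 ∧ β * S.L ≤ S'.l := by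
    refine ⟨min γ (min 1 (S'.l / S.L)), by positivity, min_le_left _ _,
      (min_le_right _ _).trans (min_le_left _ _), ?_⟩
    rw [← le_div_iff₀ hL]
    exact (min_le_right _ _).trans (min_le_right _ _)
  have hK1 : ∃ K1, 0 ≤ K1 ∧ ∀ u v, S.N u = ρ → S.N v = ρ → ‖k u - k v‖ ≤ K1 * ‖u - v‖ ^ β := by
    refine ⟨|K| * (2 * ρ) ^ (γ - β), by positivity, fun u v hu hv => (hk2 u v hu hv).trans ?_⟩
    have h1 : ‖u - v‖ ≤ 2 * ρ := by
      have e1 := S.le_N u; have e2 := S.le_N v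
      exact (norm_sub_le _ _).trans (by linarith)
    have h2 := rpow_interp (norm_nonneg (u - v)) h1 hβ hβγ
    calc K * ‖u - v‖ ^ γ ≤ |K| * ‖u - v‖ ^ γ := by gcongr; exact le_abs_self K
      _ ≤ |K| * ((2 * ρ) ^ (γ - β) * ‖u - v‖ ^ β) := by gcongr
      _ = _ := by ring
  obtain ⟨K1, hK10, hK1⟩ := hK1
  obtain ⟨D, hD0, hD⟩ := S.lip hρ
  obtain ⟨M, hM0, hM⟩ := fl_lip b (D * (ρ / 2))
  set K2 := K1 * D ^ β + M * D * ρ' * (ρ / 2) ^ (1 - β) with hK2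
  have hK20 : 0 ≤ K2 := by positivity
  set K3 := S'.C * K2 * S.C ^ β + 2 * ρ' * (2 * S.C / ρ) ^ β with hK3
  have exp_le : ∀ s, 0 ≤ s → Real.exp (-(S'.l * s)) * (Real.exp (S.L * s)) ^ β ≤ 1 := by
    intro s hs
    rw [← Real.exp_mul, ← Real.exp_add]
    apply Real.exp_le_one_iff.2
    nlinarith
  have key : ∀ x y, x ≠ 0 → 0 ≤ S.s x → (y = 0 ∨ y ≠ 0 ∧ S.s x ≤ S.s y) →
      ‖S.H (b := b) k x - S.H (b := b) k y‖ ≤ K3 * ‖x - y‖ ^ β := by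
    intro x y hx hs hy
    set s := S.s x with hsdef
    set u := fl a (-s) x with hu
    set v := fl a (-s) y with hv
    have hNu : S.N u = ρ := S.N_p hx
    have hu0 : u ≠ 0 := Sec.fl_ne hx _
    have hxu : x = fl a s u := by simp [hu]
    have hyv : y = fl a s v := by simp [hv]
    have hNB : ∀ z : F, ‖fl b s z‖ ≤ Real.exp (-(S'.l * s)) * S'.N z := fun z =>
      (S'.le_N _).trans (S'.dec s z hs)
    have hvu : S.N (v - u) ≤ Real.exp (S.L * s) * (S.C * ‖x - y‖) := by
      have h1 := S.inc s (y - x) hs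
      rw [map_sub] at h1
      refine h1.trans ?_
      gcongr
      rw [norm_sub_rev]; exact S.N_le _
    have hpos : 0 ≤ ‖x - y‖ := norm_nonneg _
    have hee := exp_le s hs
    by_cases hc : S.N (v - u) ≤ ρ / 2
    · obtain ⟨hv0, h1, h2, -⟩ := hD u v hNu hc
      have hvun : ‖v - u‖ ≤ ρ / 2 := (S.le_N _).trans hc
      have hHu : S.H (b := b) k u = k u := by
        simp only [H, hu0, if_false]; rw [S.s_of_N hNu, S.p_of_N hNu]; simp
      have hHv : S.H (b := b) k v = fl b (S.s v) (k (S.p v)) := by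
        simp only [H, hv0, if_false]
      have hb : ‖S.H (b := b) k u - S.H (b := b) k v‖ ≤ K2 * ‖v - u‖ ^ β := by
        rw [hHu, hHv]
        have e : k u - fl b (S.s v) (k (S.p v)) =
          (k u - k (S.p v)) - (fl b (S.s v) (k (S.p v)) - k (S.p v)) := by abel
        rw [e]
        have h3 : ‖k u - k (S.p v)‖ ≤ K1 * (D * ‖v - u‖) ^ β := by
          refine (hK1 u (S.p v) hNu (S.N_p hv0)).trans ?_
          rw [norm_sub_rev]
          gcongr
        have h4 := hM (S.s v) (h1.trans (by gcongr)) (k (S.p v))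
        have h5 : ‖k (S.p v)‖ ≤ ρ' := (S'.le_N _).trans (hk _ (S.N_p hv0)).le
        have h6 := rpow_interp (norm_nonneg (v - u)) hvun hβ hβ1
        rw [Real.rpow_one] at h6
        calc _ ≤ K1 * (D * ‖v - u‖) ^ β + M * (D * ‖v - u‖) * ρ' := by
              refine (norm_sub_le _ _).trans (add_le_add h3 (h4.trans ?_))
              gcongr
          _ = K1 * D ^ β * ‖v - u‖ ^ β + M * D * ρ' * ‖v - u‖ := by
              rw [Real.mul_rpow hD0.le (norm_nonneg _)]; ring
          _ ≤ K1 * D ^ β * ‖v - u‖ ^ β +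
                M * D * ρ' * ((ρ / 2) ^ (1 - β) * ‖v - u‖ ^ β) := by gcongr
          _ = _ := by rw [hK2]; ring
      have hxy : S.H (b := b) k x - S.H (b := b) k y =
          fl b s (S.H (b := b) k u - S.H (b := b) k v) := by
        rw [map_sub, ← S.H_fl, ← S.H_fl, ← hxu, ← hyv]
      rw [hxy]
      have h7 : ‖v - u‖ ≤ Real.exp (S.L * s) * (S.C * ‖x - y‖) := (S.le_N _).trans hvu
      calc _ ≤ Real.exp (-(S'.l * s)) * (S'.C * (K2 * (Real.exp (S.L * s) * (S.C * ‖x - y‖)) ^ β)) := by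
            refine (hNB _).trans ?_
            gcongr
            refine (S'.N_le _).trans ?_
            gcongr
            refine hb.trans ?_
            gcongr
        _ = (Real.exp (-(S'.l * s)) * (Real.exp (S.L * s)) ^ β) *
              (S'.C * K2 * S.C ^ β * ‖x - y‖ ^ β) := by
            rw [Real.mul_rpow (Real.exp_pos _).le (by positivity), Real.mul_rpow hC.le hpos]
            ring
        _ ≤ 1 * (S'.C * K2 * S.C ^ β * ‖x - y‖ ^ β) := by gcongr
        _ ≤ _ := by
            rw [hK3, one_mul, add_mul]
            have : 0 ≤ 2 * ρ' * (2 * S.C / ρ) ^ β * ‖x - y‖ ^ β := by positivity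
            linarith
    · push Not at hc
      have hx1 : ‖S.H (b := b) k x‖ ≤ Real.exp (-(S'.l * s)) * ρ' := by
        simp only [H, hx, if_false]
        refine (hNB _).trans ?_
        rw [hk _ (S.N_p hx)]
      have hy1 : ‖S.H (b := b) k y‖ ≤ Real.exp (-(S'.l * s)) * ρ' := by
        rcases hy with rfl | ⟨hy0, hsy⟩
        · rw [H_zero]; simp; positivity
        · simp only [H, hy0, if_false]
          refine ((S'.le_N _).trans (S'.dec _ _ (hs.trans hsy))).trans ?_
          rw [hk _ (S.N_p hy0)]
          gcongr
      have h8 : 1 ≤ Real.exp (S.L * s) * (2 * S.C / ρ * ‖x - y‖) := by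
        have := hc.le.trans hvu
        have e : Real.exp (S.L * s) * (2 * S.C / ρ * ‖x - y‖) =
          (Real.exp (S.L * s) * (S.C * ‖x - y‖)) / (ρ / 2) := by field_simp
        rw [e, le_div_iff₀ (by positivity)]; linarith
      have h9 : 1 ≤ Real.exp (S.L * s) ^ β * ((2 * S.C / ρ) ^ β * ‖x - y‖ ^ β) := by
        rw [← Real.mul_rpow (by positivity) hpos, ← Real.mul_rpow (by positivity) (by positivity)]
        exact Real.one_le_rpow h8 hβ.le
      calc _ ≤ 2 * ρ' * Real.exp (-(S'.l * s)) := (norm_sub_le _ _).trans (by linarith)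
        _ = 2 * ρ' * Real.exp (-(S'.l * s)) * 1 := by ring
        _ ≤ 2 * ρ' * Real.exp (-(S'.l * s)) *
            (Real.exp (S.L * s) ^ β * ((2 * S.C / ρ) ^ β * ‖x - y‖ ^ β)) := by gcongr
        _ = (Real.exp (-(S'.l * s)) * (Real.exp (S.L * s)) ^ β) *
            (2 * ρ' * (2 * S.C / ρ) ^ β * ‖x - y‖ ^ β) := by ring
        _ ≤ 1 * (2 * ρ' * (2 * S.C / ρ) ^ β * ‖x - y‖ ^ β) := by gcongr
        _ ≤ _ := by
            rw [hK3, one_mul, add_mul]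
            have : 0 ≤ S'.C * K2 * S.C ^ β * ‖x - y‖ ^ β := by positivity
            linarith
  have hsn : ∀ x, x ≠ 0 → ‖x‖ < ρ / S.C → 0 ≤ S.s x := fun x hx hxr => by
    refine S.s_pos_of hρ hx ((S.N_le x).trans ?_)
    rw [lt_div_iff₀ hC] at hxr; linarith
  refine ⟨β, hβ, ρ / S.C, by positivity, K3, fun x y hxr hyr => ?_⟩
  by_cases hx : x = 0
  · by_cases hy : y = 0
    · rw [hx, hy]; simp; rw [Real.zero_rpow hβ.ne']; simp
    · rw [norm_sub_rev, norm_sub_rev x y]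
      exact key y x hy (hsn y hy hyr) (Or.inl hx)
  · by_cases hy : y = 0
    · exact key x y hx (hsn x hx hxr) (Or.inl hy)
    · rcases le_total (S.s x) (S.s y) with h | h
      · exact key x y hx (hsn x hx hxr) (Or.inr ⟨hy, h⟩)
      · rw [norm_sub_rev, norm_sub_rev x y]
        exact key y x hy (hsn y hy hyr) (Or.inr ⟨hx, h⟩)

lemma H_inv {h : E → F} {h' : F → E} (hinj : ∀ x, h' (h x) = x) (h'0 : h' 0 = 0) (hρ : 0 < ρ) (hρ' : 0 < ρ')
    (horb : ∀ t y, ∃ t', h' (fl b t y) = fl a t' (h' y)) (x : E) :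
    S'.H (b := a) (fun y => S.p (h' y)) (S.H (b := b) (fun x => S'.p (h x)) x) = x := by
  by_cases hx : x = 0
  · rw [hx, H_zero, H_zero]
  · have hpx : S.p x ≠ 0 := Sec.fl_ne hx _
    have hz : h (S.p x) ≠ 0 := fun hh => hpx (by rw [← hinj (S.p x), hh, h'0])
    have hz2 : S'.p (h (S.p x)) ≠ 0 := Sec.fl_ne hz _
    conv_lhs => rw [H, if_neg (by simp only [H, hx, if_false]; exact Sec.fl_ne hz2 _)]
    simp only [H, hx, if_false]
    rw [S'.s_fl hz2, S'.p_fl hz2, S'.p_of_N (S'.N_p hz), S'.s_of_N (S'.N_p hz), zero_add]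
    obtain ⟨t', ht'⟩ := horb (-S'.s (h (S.p x))) (h (S.p x))
    change h' (S'.p (h (S.p x))) = _ at ht'
    rw [ht', hinj, S.p_fl hpx, S.p_of_N (S.N_p hx), S.fl_p]

end Sec

lemma cont_of_HNZ (a : E →L[ℝ] E) (b : F →L[ℝ] F) (ha : ∀ x, x ∈ stS a) {β : ℝ} (hβ : 0 < β)
    {H : E → F} (hH : HNZ β H) (hc : ∀ t x, H (fl a t x) = fl b t (H x)) : Continuous H := by
  obtain ⟨r, hr, K, hK⟩ := hH
  have hon : ContinuousOn H (Metric.ball 0 r) := by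
    intro x hx
    refine ContinuousAt.continuousWithinAt ?_
    rw [ContinuousAt, tendsto_iff_norm_sub_tendsto_zero]
    have h1 : ∀ᶠ y in 𝓝 x, ‖H y - H x‖ ≤ K * ‖y - x‖ ^ β := by
      filter_upwards [Metric.isOpen_ball.mem_nhds hx] with y hy
      exact hK y x (by simpa using hy) (by simpa using hx)
    refine squeeze_zero' (Eventually.of_forall fun _ => norm_nonneg _) h1 ?_
    have : Tendsto (fun y => K * ‖y - x‖ ^ β) (𝓝 x) (𝓝 (K * ‖x - x‖ ^ β)) := by
      refine Tendsto.const_mul K ?_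
      exact ((continuous_id.sub continuous_const).norm.tendsto x).rpow_const (Or.inr hβ.le)
    simpa [Real.zero_rpow hβ.ne'] using this
  rw [continuous_iff_continuousAt]
  intro x
  have hx := ha x
  rw [mem_stS] at hx
  obtain ⟨t, ht⟩ := (hx.eventually (Metric.ball_mem_nhds 0 hr)).exists
  have e : H = fun y => fl b (-t) (H (fl a t y)) := by
    funext y; rw [hc]; simp
  rw [e]
  have h2 : ContinuousAt H (fl a t x) := hon.continuousAt (Metric.isOpen_ball.mem_nhds ht)
  exact (fl b (-t)).continuous.continuousAt.comp (ContinuousAt.comp h2 (fl a t).continuous.continuousAt)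

/-- Lemma G: orbit equivalence of stable flows, Hölder, gives Hölder conjugacy -/
lemma lemG (a : E →L[ℝ] E) (b : F →L[ℝ] F) (ha : ∀ x, x ∈ stS a) (hb : ∀ x, x ∈ stS b)
    (h : E ≃ₜ F) (h0 : h 0 = 0) (horb : ∀ t x, ∃ t', h (fl a t x) = fl b t' (h x))
    (horb' : ∀ t y, ∃ t', h.symm (fl b t y) = fl a t' (h.symm y))
    {γ : ℝ} (hγ : 0 < γ) (h1 : HNZ γ h) (h2 : HNZ γ h.symm) :
    ∃ H : E ≃ₜ F, H 0 = 0 ∧ (∀ t x, H (fl a t x) = fl b t (H x)) ∧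
      ∃ β > 0, HNZ β H ∧ HNZ β H.symm := by
  obtain ⟨r1, hr1, K1, hK1⟩ := h1
  obtain ⟨r2, hr2, K2, hK2⟩ := h2
  obtain ⟨S⟩ := exists_Sec a ha (half_pos hr1)
  obtain ⟨S'⟩ := exists_Sec b hb (half_pos hr2)
  have h0' : h.symm 0 = 0 := by rw [← h0]; simp
  have hcomp1 : IsCompact (h '' {u | S.N u = r1 / 2}) := by
    refine IsCompact.image ?_ h.continuous
    refine Metric.isCompact_of_isClosed_isBounded (isClosed_eq S.N_cont continuous_const) ?_
    refine (Metric.isBounded_closedBall (x := (0 : E)) (r := r1 / 2)).subset fun u hu => ?_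
    simpa using (S.le_N u).trans hu.le
  have hcomp2 : IsCompact (h.symm '' {u | S'.N u = r2 / 2}) := by
    refine IsCompact.image ?_ h.symm.continuous
    refine Metric.isCompact_of_isClosed_isBounded (isClosed_eq S'.N_cont continuous_const) ?_
    refine (Metric.isBounded_closedBall (x := (0 : F)) (r := r2 / 2)).subset fun u hu => ?_
    simpa using (S'.le_N u).trans hu.le
  have hn1 : ∀ u, S.N u = r1 / 2 → h u ≠ 0 := fun u hu hh =>
    S.ne_zero_of_N (half_pos hr1) hu (by rw [← h.symm_apply_apply u, hh, h0'])
  have hn2 : ∀ u, S'.N u = r2 / 2 → h.symm u ≠ 0 := fun u hu hh =>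
    S'.ne_zero_of_N (half_pos hr2) hu (by rw [← h.apply_symm_apply u, hh, h0])
  obtain ⟨D1, hD10, hD1⟩ := S'.p_lip (half_pos hr2) hcomp1 (by
    rintro ⟨u, hu, hu'⟩; exact hn1 u hu hu')
  obtain ⟨D2, hD20, hD2⟩ := S.p_lip (half_pos hr1) hcomp2 (by
    rintro ⟨u, hu, hu'⟩; exact hn2 u hu hu')
  obtain ⟨β1, hβ1, HH1⟩ := S.H_holder S' (half_pos hr1) (half_pos hr2) (k := fun x => S'.p (h x))
    (K := D1 * K1) hγ (fun u hu => S'.N_p (hn1 u hu)) (fun u v hu hv => by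
      refine (hD1 _ ⟨v, hv, rfl⟩ _ ⟨u, hu, rfl⟩).trans ?_
      rw [mul_assoc]
      refine mul_le_mul_of_nonneg_left (hK1 u v ?_ ?_) hD10
      · have := S.le_N u; linarith [hu.le]
      · have := S.le_N v; linarith [hv.le])
  obtain ⟨β2, hβ2, HH2⟩ := S'.H_holder S (half_pos hr2) (half_pos hr1) (k := fun x => S.p (h.symm x))
    (K := D2 * K2) hγ (fun u hu => S.N_p (hn2 u hu)) (fun u v hu hv => by
      refine (hD2 _ ⟨v, hv, rfl⟩ _ ⟨u, hu, rfl⟩).trans ?_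
      rw [mul_assoc]
      refine mul_le_mul_of_nonneg_left (hK2 u v ?_ ?_) hD20
      · have := S'.le_N u; linarith [hu.le]
      · have := S'.le_N v; linarith [hv.le])
  refine ⟨⟨⟨_, _, fun x => S.H_inv S' h.symm_apply_apply h0' (half_pos hr1) (half_pos hr2) horb' x,
    fun x => S'.H_inv S h.apply_symm_apply h0 (half_pos hr2) (half_pos hr1) horb x⟩,
    cont_of_HNZ a b ha hβ1 HH1 (S.H_fl (b := b) (fun x => S'.p (h x))),
    cont_of_HNZ b a hb hβ2 HH2 (S'.H_fl (b := a) (fun y => S.p (h.symm y)))⟩,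
    S.H_zero (b := b) (fun x => S'.p (h x)), fun t x => S.H_fl (b := b) (fun x => S'.p (h x)) t x, min β1 β2, lt_min hβ1 hβ2, HH1.mono (lt_min hβ1 hβ2) (min_le_left _ _),
    HH2.mono (lt_min hβ1 hβ2) (min_le_right _ _)⟩

end G


section Central
variable {E : Type*} [NormedAddCommGroup E] [NormedSpace ℝ E] [FiniteDimensional ℝ E]
  [CompleteSpace E]

/-- central generator with Jordan decomposition -/
structure Cen (a s n : E →L[ℝ] E) : Prop where
  add : a = s + n
  comm : Commute s n
  nil : ∃ N, n ^ N = 0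
  spn : ceE s = ⊤

lemma exists_Cen (a : E →L[ℝ] E) (ha : ∀ x, x ∈ ceS a) : ∃ s n, Cen a s n := by
  obtain ⟨s, n, H⟩ := exists_SN a
  refine ⟨s, n, H.add, H.comm, H.nil, ?_⟩
  rw [← ceS_eq H]
  exact eq_top_iff.2 fun x _ => ha x

variable {a s n : E →L[ℝ] E}

lemma Cen.rot (H : Cen a s n) : ∃ C, 1 ≤ C ∧ ∀ t x, ‖fl s t x‖ ≤ C * ‖x‖ := by
  obtain ⟨C, hC, h⟩ := unif_bounded (⊤ : Submodule ℝ E) (fun t : ℝ => fl s t) (fun x hxt => by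
    clear hxt
    have hx : x ∈ ceE s := by rw [H.spn]; trivial
    unfold ceE at hx
    induction hx using Submodule.span_induction with
    | mem x hx =>
      obtain ⟨β, y, -, hxy⟩ := hx
      refine ⟨‖x‖ + ‖y‖, fun t => ?_⟩
      rw [fl_eig hxy]
      simp only [zero_mul, Real.exp_zero, one_smul]
      refine (norm_add_le _ _).trans (add_le_add ?_ ?_)
      · rw [norm_smul]
        exact mul_le_of_le_one_left (norm_nonneg _) (Real.abs_cos_le_one _)
      · rw [norm_smul]
        exact mul_le_of_le_one_left (norm_nonneg _) (Real.abs_sin_le_one _)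
    | zero => exact ⟨0, fun t => by simp⟩
    | add x y _ _ hx hy =>
      obtain ⟨C, hC⟩ := hx
      obtain ⟨D, hD⟩ := hy
      exact ⟨C + D, fun t => by
        rw [map_add]; exact (norm_add_le _ _).trans (add_le_add (hC t) (hD t))⟩
    | smul r x _ hx =>
      obtain ⟨C, hC⟩ := hx
      exact ⟨‖r‖ * C, fun t => by rw [map_smul, norm_smul]; gcongr; exact hC t⟩)
  refine ⟨max C 1, le_max_right _ _, fun t x => (h t x trivial).trans ?_⟩
  gcongr
  exact le_max_left _ _

lemma Cen.fl_eq (H : Cen a s n) (t : ℝ) (x : E) : fl a t x = fl s t (fl n t x) := by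
  rw [H.add, fl_add_gen s n H.comm]; rfl

/-- return times -/
lemma Cen.ret (H : Cen a s n) : ∃ T : ℕ → ℝ, (∀ j, 1 ≤ T j) ∧ Tendsto T atTop atTop ∧
    ∀ (y : ℕ → E) (z : E), Tendsto y atTop (𝓝 z) →
      Tendsto (fun j => fl s (T j) (y j)) atTop (𝓝 z) := by
  obtain ⟨C, hC, hrot⟩ := H.rot
  have hb : ∀ j : ℕ, fl s (j : ℝ) ∈ Metric.closedBall (0 : E →L[ℝ] E) C := fun j => by
    rw [mem_closedBall_zero_iff]
    exact ContinuousLinearMap.opNorm_le_bound _ (by linarith) (hrot _)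
  obtain ⟨L, -, φ, hφ, hL⟩ := (isCompact_closedBall (0 : E →L[ℝ] E) C).tendsto_subseq hb
  have hcau := hL.cauchySeq
  rw [Metric.cauchySeq_iff] at hcau
  have key : ∀ N : ℕ, ∃ T : ℝ, (N + 1 : ℝ) ≤ T ∧
      ∀ x, ‖fl s T x - x‖ ≤ 1 / (N + 1 : ℝ) * ‖x‖ := by
    intro N
    obtain ⟨M, hM⟩ := hcau (1 / (C * (N + 1))) (by positivity)
    have h1 := hM (M + (N + 1)) (by omega) M le_rfl
    have h2 : ∀ k, φ M + k ≤ φ (M + k) := by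
      intro k
      induction k with
      | zero => simp
      | succ k ih =>
        have := hφ (show M + k < M + (k + 1) by omega)
        omega
    refine ⟨(φ (M + (N + 1)) : ℝ) - φ M, ?_, fun x => ?_⟩
    · have := h2 (N + 1)
      have h3 : ((φ M + (N + 1) : ℕ) : ℝ) ≤ φ (M + (N + 1)) := by exact_mod_cast this
      push_cast at h3; linarith
    · have e : fl s ((φ (M + (N + 1)) : ℝ) - φ M) x - x =
          fl s (-(φ M : ℝ)) ((fl s (φ (M + (N + 1)) : ℝ) - fl s (φ M : ℝ)) x) := by
        rw [ContinuousLinearMap.sub_apply, map_sub, ← fl_add_apply, fl_neg_apply]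
        congr 3; ring
      rw [e]
      rw [dist_eq_norm] at h1
      calc _ ≤ C * ‖(fl s (φ (M + (N + 1)) : ℝ) - fl s (φ M : ℝ)) x‖ := hrot _ _
        _ ≤ C * (1 / (C * (N + 1)) * ‖x‖) := by
          gcongr
          exact (ContinuousLinearMap.le_opNorm _ _).trans
            (mul_le_mul_of_nonneg_right h1.le (norm_nonneg _))
        _ = _ := by field_simp
  choose T hT1 hT2 using key
  refine ⟨T, fun j => ?_, ?_, fun y z hy => ?_⟩
  · have := hT1 j; have : (0:ℝ) ≤ j := Nat.cast_nonneg j; linarith [hT1 j]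
  · refine tendsto_atTop_mono (fun j => ?_) tendsto_natCast_atTop_atTop
    linarith [hT1 j]
  · have h1 : Tendsto (fun j => fl s (T j) (y j) - y j) atTop (𝓝 0) := by
      refine squeeze_zero_norm (fun j => hT2 j (y j)) ?_
      have := tendsto_one_div_add_atTop_nhds_zero_nat (𝕜 := ℝ) |>.mul hy.norm
      simpa using this
    simpa using h1.add hy

lemma nil_last {N : ℕ} (hN : n ^ N = 0) {x : E} (m : ℕ) (hx : (n ^ m) x ≠ 0) :
    ∃ k, m ≤ k ∧ (n ^ k) x ≠ 0 ∧ (n ^ (k + 1)) x = 0 := by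
  by_contra hcon
  push Not at hcon
  have h : ∀ k, (n ^ (m + k)) x ≠ 0 := by
    intro k
    induction k with
    | zero => exact hx
    | succ k ih => exact hcon (m + k) (by omega) ih
  apply h N
  rw [pow_add, hN, mul_zero]; rfl

lemma fl_lin {v : E} (h : n (n v) = 0) (t : ℝ) : fl n t v = v + t • n v := by
  have := fl_unique n (fun t => v + t • n v) (fun t => ?_) t
  · simpa using this.symm
  have h1 : HasDerivAt (fun t : ℝ => v + t • n v) ((1:ℝ) • n v) t :=
    ((hasDerivAt_id t).smul_const (n v)).const_add v
  simpa [h] using h1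

lemma pow_fl (k : ℕ) (t : ℝ) (x : E) : (n ^ k) (fl n t x) = fl n t ((n ^ k) x) :=
  fl_comm_apply n (n ^ k) ((Commute.refl n).pow_left k) t x

/-- unbounded orbits of unipotent flows escape -/
lemma nil_escape {N : ℕ} (hN : n ^ N = 0) {x : E} (hx : n x ≠ 0) :
    ∃ c > 0, ∃ D : ℝ, ∀ t : ℝ, c * |t| - D ≤ ‖fl n t x‖ := by
  obtain ⟨k, hk, h1, h2⟩ := nil_last hN 1 (by simpa using hx)
  obtain ⟨m, rfl⟩ : ∃ m, k = m + 1 := ⟨k - 1, by omega⟩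
  set v := (n ^ m) x with hv
  have e1 : n v = (n ^ (m + 1)) x := by rw [pow_succ']; rfl
  have e2 : n (n v) = 0 := by rw [e1, ← h2, pow_succ' n (m + 1)]; rfl
  have hpos : 0 < ‖n v‖ := by rw [e1]; exact norm_pos_iff.2 h1
  refine ⟨‖n v‖ / (‖n ^ m‖ + 1), by positivity, ‖v‖ / (‖n ^ m‖ + 1), fun t => ?_⟩
  have h3 : ‖v + t • n v‖ ≤ ‖n ^ m‖ * ‖fl n t x‖ := by
    rw [← fl_lin e2, hv, ← pow_fl]; exact (n ^ m).le_opNorm _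
  have h4 : ‖n v‖ * |t| - ‖v‖ ≤ ‖v + t • n v‖ := by
    have := norm_sub_norm_le (t • n v) (-v)
    rw [norm_smul, norm_neg, sub_neg_eq_add, add_comm (t • n v)] at this
    rw [Real.norm_eq_abs] at this; linarith
  have h5 : (0:ℝ) < ‖n ^ m‖ + 1 := by positivity
  rw [div_mul_eq_mul_div, ← sub_div, div_le_iff₀ h5]
  nlinarith [norm_nonneg (fl n t x)]

lemma Cen.escape (H : Cen a s n) {x : E} (hx : n x ≠ 0) :
    ∃ c > 0, ∃ D : ℝ, ∀ t : ℝ, c * |t| - D ≤ ‖fl a t x‖ := by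
  obtain ⟨N, hN⟩ := H.nil
  obtain ⟨c, hc, D, h⟩ := nil_escape hN hx
  obtain ⟨C, hC, hrot⟩ := H.rot
  have hC0 : 0 < C := by linarith
  refine ⟨c / C, by positivity, D / C, fun t => ?_⟩
  rw [H.fl_eq]
  have h1 := hrot (-t) (fl s t (fl n t x))
  rw [fl_neg_apply] at h1
  rw [div_mul_eq_mul_div, ← sub_div, div_le_iff₀ hC0]
  linarith [h t]

/-- bounded orbit -/
def Bd (a : E →L[ℝ] E) (x : E) : Prop := ∃ M, ∀ t, ‖fl a t x‖ ≤ M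

lemma Cen.bd_iff (H : Cen a s n) {x : E} : Bd a x ↔ n x = 0 := by
  constructor
  · rintro ⟨M, hM⟩
    by_contra hx
    obtain ⟨c, hc, D, h⟩ := H.escape hx
    have h1 := h ((|M| + |D| + 1) / c)
    have h2 := hM ((|M| + |D| + 1) / c)
    rw [abs_of_nonneg (by positivity), mul_div_cancel₀ _ hc.ne'] at h1
    linarith [le_abs_self M, le_abs_self D]
  · intro hx
    obtain ⟨C, hC, hrot⟩ := H.rot
    refine ⟨C * ‖x‖, fun t => ?_⟩
    rw [H.fl_eq, fl_lin (n := n) (v := x) (by rw [hx, map_zero]), hx, smul_zero, add_zero]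
    exact hrot t x

lemma Cen.fl_of_bd (H : Cen a s n) {x : E} (hx : n x = 0) (t : ℝ) : fl a t x = fl s t x := by
  rw [H.fl_eq, fl_lin (n := n) (v := x) (by rw [hx, map_zero]), hx, smul_zero, add_zero]

lemma Cen.n_fl (H : Cen a s n) (t : ℝ) (x : E) : n (fl a t x) = fl a t (n x) :=
  fl_comm_apply a n (by rw [H.add]; exact (H.comm.symm).add_right (Commute.refl n)) t x

lemma Cen.n_rot (H : Cen a s n) (t : ℝ) (x : E) : n (fl s t x) = fl s t (n x) :=
  fl_comm_apply s n H.comm.symm t x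

lemma Cen.pow_rot (H : Cen a s n) (k : ℕ) (t : ℝ) (x : E) :
    (n ^ k) (fl s t x) = fl s t ((n ^ k) x) :=
  fl_comm_apply s (n ^ k) (H.comm.symm.pow_left k) t x

end Central


section PolyCurves
open Polynomial

lemma eval_der (c : ℝ) (m : ℕ) : ∀ (q : ℝ[X]) (k : ℕ), k ≤ m →
    (derivative^[k] ((X - C c) ^ m * q)).eval c = if k = m then (m.factorial : ℝ) * q.eval c else 0 := by
  induction m with
  | zero => intro q k hk; obtain rfl : k = 0 := by omega
            simp
  | succ m ih =>
    intro q k hk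
    cases k with
    | zero => simp
    | succ k =>
      have e : derivative ((X - C c) ^ (m + 1) * q) =
          (X - C c) ^ m * (C ((m : ℝ) + 1) * q + (X - C c) * derivative q) := by
        rw [derivative_mul, derivative_X_sub_C_pow]
        simp only [Nat.add_sub_cancel, Nat.cast_add, Nat.cast_one, map_add, map_natCast, map_one]
        ring
      rw [Function.iterate_succ_apply, e, ih _ k (by omega)]
      by_cases h : k = m
      · simp only [h, if_true]
        simp [Nat.factorial_succ]; ring
      · rw [if_neg h, if_neg (by omega)]

lemma eval_der_lt {q : ℝ[X]} {c : ℝ} {m k : ℕ} (h : (X - C c) ^ m ∣ q) (hk : k < m) :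
    (derivative^[k] q).eval c = 0 := by
  obtain ⟨r, rfl⟩ := h
  rw [eval_der c m r k hk.le, if_neg hk.ne]

variable {E : Type*} [NormedAddCommGroup E] [NormedSpace ℝ E] [FiniteDimensional ℝ E]
  [CompleteSpace E] {a s n : E →L[ℝ] E}

/-- derivative coefficients -/
def dc (q : ℝ[X]) (T : ℝ) (k : ℕ) (t : ℝ) : ℝ := (derivative^[k] q).eval (t / T) * (T⁻¹) ^ k

lemma dc_deriv (q : ℝ[X]) (T : ℝ) (k : ℕ) (t : ℝ) :
    HasDerivAt (dc q T k) (dc q T (k + 1) t) t := by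
  unfold dc
  rw [Function.iterate_succ_apply', pow_succ]
  have h1 : HasDerivAt (fun u : ℝ => u / T) (T⁻¹) t := by
    simpa [div_eq_mul_inv] using (hasDerivAt_id t).mul_const (T⁻¹)
  have h2 := ((derivative^[k] q).hasDerivAt (t / T)).comp t h1
  have h3 := h2.mul_const ((T⁻¹) ^ k)
  refine h3.congr_deriv ?_
  ring

lemma dc_top (q : ℝ[X]) {N : ℕ} (hq : q.natDegree ≤ N) (T t : ℝ) : dc q T (N + 1) t = 0 := by
  unfold dc
  rw [iterate_derivative_eq_zero (by omega)]; simp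

lemma pow_succ_app (k : ℕ) (x : E) : n ((n ^ k) x) = (n ^ (k + 1)) x := by
  rw [pow_succ']; rfl

lemma pow_succ_app' (k : ℕ) (x : E) : (n ^ k) (n x) = (n ^ (k + 1)) x := by
  rw [pow_succ]; rfl

lemma pow_add_app (k l : ℕ) (x : E) : (n ^ k) ((n ^ l) x) = (n ^ (k + l)) x := by
  rw [pow_add]; rfl

/-- explicit orbits of the unipotent flow -/
lemma cur_fl (q : ℝ[X]) {N : ℕ} (hq : q.natDegree ≤ N) (T : ℝ) {z : E} (hz : (n ^ (N + 1)) z = 0)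
    (t : ℝ) : ∑ k ∈ Finset.range (N + 1), dc q T k t • (n ^ (N - k)) z =
    fl n t (∑ k ∈ Finset.range (N + 1), dc q T k 0 • (n ^ (N - k)) z) := by
  refine fl_unique n (fun t => ∑ k ∈ Finset.range (N + 1), dc q T k t • (n ^ (N - k)) z)
    (fun t => ?_) t
  have h1 : HasDerivAt (fun t => ∑ k ∈ Finset.range (N + 1), dc q T k t • (n ^ (N - k)) z)
      (∑ k ∈ Finset.range (N + 1), dc q T (k + 1) t • (n ^ (N - k)) z) t :=
    HasDerivAt.fun_sum fun k _ => (dc_deriv q T k t).smul_const _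
  convert h1 using 1
  rw [map_sum, Finset.sum_range_succ', Finset.sum_range_succ _ N, dc_top q hq]
  simp only [map_smul, pow_succ_app, Nat.sub_zero, hz, smul_zero, zero_smul]
  congr 1
  refine Finset.sum_congr rfl fun k hk => ?_
  rw [Finset.mem_range] at hk
  congr 3; omega

lemma const_mod (V : Submodule ℝ E) (f f' : ℝ → E) (hf : ∀ t, HasDerivAt f (f' t) t)
    (hV : ∀ t, f' t ∈ V) (t : ℝ) : f t - f 0 ∈ V := by
  obtain ⟨W, hW⟩ := V.exists_isCompl
  let P : E →L[ℝ] W := LinearMap.toContinuousLinearMap (W.linearProjOfIsCompl V hW.symm)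
  have hP : ∀ x, P x = 0 ↔ x ∈ V := fun x => Submodule.linearProjOfIsCompl_apply_eq_zero_iff hW.symm
  have h1 : ∀ t, HasDerivAt (fun t => P (f t)) 0 t := fun t => by
    have := P.hasFDerivAt.comp_hasDerivAt t (hf t)
    rw [(hP _).2 (hV t)] at this
    exact this
  have h2 := is_const_of_deriv_eq_zero (fun t => (h1 t).differentiableAt) (fun t => (h1 t).deriv) t 0
  rw [← hP, map_sub, h2, sub_self]

/-- image of a subspace under a power -/
def img (n : E →L[ℝ] E) (m : ℕ) (Y : Submodule ℝ E) : Submodule ℝ E :=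
  Y.map ((n ^ m : E →L[ℝ] E) : E →ₗ[ℝ] E)

lemma mem_img {m : ℕ} {Y : Submodule ℝ E} {x : E} : x ∈ img n m Y ↔ ∃ y ∈ Y, (n ^ m) y = x :=
  Iff.rfl

/-- invariance -/
structure Inv (s n : E →L[ℝ] E) (Y : Submodule ℝ E) : Prop where
  hs : ∀ x ∈ Y, s x ∈ Y
  hn : ∀ x ∈ Y, n x ∈ Y

lemma Inv.pow {Y : Submodule ℝ E} (I : Inv s n Y) (k : ℕ) {x : E} (hx : x ∈ Y) : (n ^ k) x ∈ Y := by
  induction k with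
  | zero => exact hx
  | succ k ih => rw [← pow_succ_app]; exact I.hn _ ih

lemma Inv.mem_le {Y : Submodule ℝ E} (I : Inv s n Y) {k l : ℕ} (hkl : k ≤ l) {x : E} (hx : x ∈ img n l Y) :
    x ∈ img n k Y := by
  obtain ⟨y, hy, rfl⟩ := hx
  exact ⟨(n ^ (l - k)) y, I.pow _ hy, by
    change (n ^ k) ((n ^ (l - k)) y) = (n ^ l) y
    rw [pow_add_app]; congr 2; omega⟩

lemma Inv.img {Y : Submodule ℝ E} (hc : Commute s n) (I : Inv s n Y) (m : ℕ) :
    Inv s n (img n m Y) := by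
  constructor
  · rintro x ⟨y, hy, rfl⟩
    refine ⟨s y, I.hs y hy, ?_⟩
    have := congrArg (fun f : E →L[ℝ] E => f y) (hc.pow_right m).eq
    exact this.symm
  · rintro x ⟨y, hy, rfl⟩
    refine ⟨n y, I.hn y hy, ?_⟩
    change (n ^ m) (n y) = n ((n ^ m) y)
    rw [pow_succ_app, pow_succ_app']

/-- the basic identity -/
lemma up_id (q : ℝ[X]) {N : ℕ} (hq : q.natDegree ≤ N) (T : ℝ) (Y : Submodule ℝ E)
    (I : Inv s n Y) {v : E} (hv : v ∈ Y) (t : ℝ) :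
    ∑ k ∈ Finset.range (N + 1), ((-1) ^ k * dc q T k t) • (n ^ (N - k)) (fl n t v) -
    ∑ k ∈ Finset.range (N + 1), ((-1) ^ k * dc q T k 0) • (n ^ (N - k)) v ∈ img n (N + 1) Y := by
  have key := const_mod (img n (N + 1) Y)
    (fun t => ∑ k ∈ Finset.range (N + 1), ((-1) ^ k * dc q T k t) • (n ^ (N - k)) (fl n t v))
    (fun t => dc q T 0 t • (n ^ (N + 1)) (fl n t v)) (fun t => ?_)
    (fun t => Submodule.smul_mem _ _ ⟨fl n t v, fl_mem n Y I.hn t v hv, rfl⟩) t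
  · simpa using key
  have h1 : HasDerivAt
      (fun t => ∑ k ∈ Finset.range (N + 1), ((-1) ^ k * dc q T k t) • (n ^ (N - k)) (fl n t v))
      (∑ k ∈ Finset.range (N + 1), (((-1) ^ k * dc q T k t) • (n ^ (N - k)) (n (fl n t v)) +
        ((-1) ^ k * dc q T (k + 1) t) • (n ^ (N - k)) (fl n t v))) t :=
    HasDerivAt.fun_sum fun k _ => ((dc_deriv q T k t).const_mul ((-1) ^ k)).smul
      ((n ^ (N - k)).hasFDerivAt.comp_hasDerivAt t (hasDerivAt_fl n t v))
  convert h1 using 1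
  rw [Finset.sum_add_distrib, Finset.sum_range_succ', Finset.sum_range_succ _ N, dc_top q hq]
  simp only [pow_succ_app', Nat.sub_zero, mul_zero, zero_smul, add_zero, pow_zero, one_mul]
  have : ∑ k ∈ Finset.range N, ((-1) ^ (k + 1) * dc q T (k + 1) t) • (n ^ (N - (k + 1) + 1)) (fl n t v)
      = - ∑ k ∈ Finset.range N, ((-1) ^ k * dc q T (k + 1) t) • (n ^ (N - k)) (fl n t v) := by
    rw [← Finset.sum_neg_distrib]
    refine Finset.sum_congr rfl fun k hk => ?_
    rw [Finset.mem_range] at hk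
    rw [show N - (k + 1) + 1 = N - k by omega, ← neg_smul]
    congr 1; ring
  rw [this]; abel

lemma inv_tendsto {T : ℕ → ℝ} (hT : Tendsto (fun j => |T j|) atTop atTop) :
    Tendsto (fun j => (T j)⁻¹) atTop (𝓝 0) := by
  rw [tendsto_zero_iff_norm_tendsto_zero]
  have := tendsto_inv_atTop_zero.comp hT
  simpa [Function.comp_def] using this

lemma coef_tendsto {T : ℕ → ℝ} (hT : Tendsto (fun j => |T j|) atTop atTop) {i k : ℕ} (hik : i < k) :
    Tendsto (fun j => T j ^ i * (T j)⁻¹ ^ k) atTop (𝓝 0) := by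
  have h1 : Tendsto (fun j => (T j)⁻¹ ^ (k - i)) atTop (𝓝 0) := by
    have := (inv_tendsto hT).pow (k - i)
    rwa [zero_pow (by omega)] at this
  refine h1.congr' ?_
  filter_upwards [hT.eventually (eventually_gt_atTop 0)] with j hj
  have hj : T j ≠ 0 := abs_pos.1 hj
  rw [show k = i + (k - i) by omega, pow_add, ← mul_assoc, ← mul_pow, mul_inv_cancel₀ hj, one_pow,
    one_mul]
  congr 1; omega

lemma lim_bdd {T : ℕ → ℝ} (hT : Tendsto (fun j => |T j|) atTop atTop) (e : ℕ → ℝ) {i N : ℕ}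
    (he : ∀ k ≤ i, e k = 0) {y : ℕ → E} {M : ℝ} (hy : ∀ j, ‖y j‖ ≤ M) :
    Tendsto (fun j => ∑ k ∈ Finset.range (N + 1), (e k * (T j ^ i * (T j)⁻¹ ^ k)) • (n ^ (N - k)) (y j))
      atTop (𝓝 0) := by
  rw [show (0 : E) = ∑ k ∈ Finset.range (N + 1), 0 by simp]
  refine tendsto_finset_sum _ fun k _ => ?_
  by_cases hk : k ≤ i
  · simp [he k hk]
  · have h1 := (coef_tendsto hT (not_le.1 hk)).const_mul (e k)
    rw [mul_zero] at h1
    refine squeeze_zero_norm (a := fun j => ‖e k * (T j ^ i * (T j)⁻¹ ^ k)‖ * (‖n ^ (N - k)‖ * M))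
      (fun j => ?_) ?_
    · rw [norm_smul]
      gcongr
      exact ((n ^ (N - k)).le_opNorm _).trans (by gcongr; exact hy j)
    · simpa using h1.norm.mul_const (‖n ^ (N - k)‖ * M)

lemma lim_conv {T : ℕ → ℝ} (hT : Tendsto (fun j => |T j|) atTop atTop) (e : ℕ → ℝ) {i N : ℕ}
    (hiN : i ≤ N) (he : ∀ k < i, e k = 0) {y : ℕ → E} {z : E} (hy : Tendsto y atTop (𝓝 z)) :
    Tendsto (fun j => ∑ k ∈ Finset.range (N + 1), (e k * (T j ^ i * (T j)⁻¹ ^ k)) • (n ^ (N - k)) (y j))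
      atTop (𝓝 (e i • (n ^ (N - i)) z)) := by
  have : e i • (n ^ (N - i)) z = ∑ k ∈ Finset.range (N + 1),
      (if k = i then e i else 0) • (n ^ (N - k)) z := by
    rw [Finset.sum_eq_single i]
    · simp
    · intro k _ hk; simp [hk]
    · intro h; exact absurd (Finset.mem_range.2 (by omega)) h
  rw [this]
  refine tendsto_finset_sum _ fun k _ => ?_
  have h2 : Tendsto (fun j => (n ^ (N - k)) (y j)) atTop (𝓝 ((n ^ (N - k)) z)) :=
    ((n ^ (N - k)).continuous.tendsto z).comp hy
  refine Tendsto.smul ?_ h2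
  rcases lt_trichotomy k i with hk | rfl | hk
  · simp [he k hk, hk.ne]
  · simp only [if_true]
    refine tendsto_const_nhds.congr' ?_
    filter_upwards [hT.eventually (eventually_gt_atTop 0)] with j hj
    have hj : T j ≠ 0 := abs_pos.1 hj
    rw [← mul_pow, mul_inv_cancel₀ hj, one_pow, mul_one]
  · have h1 := (coef_tendsto hT hk).const_mul (e k)
    simpa [hk.ne'] using h1

end PolyCurves


section Upper
open Polynomial
variable {E : Type*} [NormedAddCommGroup E] [NormedSpace ℝ E] [FiniteDimensional ℝ E]
  [CompleteSpace E] {a s n : E →L[ℝ] E}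

lemma up_mem0 (q : ℝ[X]) {N : ℕ} (hq : q.natDegree ≤ N) {T : ℝ} (hT : T ≠ 0) (i : ℕ)
    (Y : Submodule ℝ E) (I : Inv s n Y) {v : E} (hv : v ∈ Y) :
    ∑ k ∈ Finset.range (N + 1), (((-1) ^ k * (derivative^[k] q).eval 1) * (T ^ i * T⁻¹ ^ k)) •
      (n ^ (N - k)) (fl n T v) -
    ∑ k ∈ Finset.range (N + 1), (((-1) ^ k * (derivative^[k] q).eval 0) * (T ^ i * T⁻¹ ^ k)) •
      (n ^ (N - k)) v ∈ img n (N + 1) Y := by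
  have h := (img n (N + 1) Y).smul_mem (T ^ i) (up_id q hq T Y I hv T)
  rw [smul_sub, Finset.smul_sum, Finset.smul_sum] at h
  unfold dc at h
  rw [div_self hT, zero_div] at h
  have e : ∀ c : ℝ, ∀ z : E, ∀ k, (T ^ i) • ((-1) ^ k * (c * T⁻¹ ^ k)) • z =
      (((-1) ^ k * c) * (T ^ i * T⁻¹ ^ k)) • z := fun c z k => by
    rw [smul_smul]; congr 1; ring
  simp only [e] at h
  exact h

lemma up_mem1 (H : Cen a s n) (q : ℝ[X]) {N : ℕ} (hq : q.natDegree ≤ N) {T : ℝ} (hT : T ≠ 0) (i : ℕ)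
    (Y : Submodule ℝ E) (I : Inv s n Y) {v : E} (hv : v ∈ Y) :
    ∑ k ∈ Finset.range (N + 1), (((-1) ^ k * (derivative^[k] q).eval 1) * (T ^ i * T⁻¹ ^ k)) •
      (n ^ (N - k)) (fl a T v) -
    ∑ k ∈ Finset.range (N + 1), (((-1) ^ k * (derivative^[k] q).eval 0) * (T ^ i * T⁻¹ ^ k)) •
      (n ^ (N - k)) (fl s T v) ∈ img n (N + 1) Y := by
  have h := fl_mem s _ (I.img H.comm (N + 1)).hs T _ (up_mem0 q hq hT i Y I hv)
  rw [map_sub, map_sum, map_sum] at h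
  simp only [map_smul, ← H.pow_rot, ← H.fl_eq] at h
  exact h

lemma deg_le (i j : ℕ) : ((X : ℝ[X]) ^ i * (X - C 1) ^ j).natDegree ≤ i + j := by
  refine (natDegree_mul_le).trans (add_le_add (natDegree_X_pow_le i) ?_)
  refine (natDegree_pow_le).trans ?_
  rw [natDegree_X_sub_C, mul_one]

lemma ev_zero_lt {i j k : ℕ} (h : k < i) :
    (derivative^[k] ((X : ℝ[X]) ^ i * (X - C 1) ^ j)).eval 0 = 0 :=
  eval_der_lt (c := 0) (m := i) ⟨(X - C 1) ^ j, by simp⟩ h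

lemma ev_one_lt {i j k : ℕ} (h : k < j) :
    (derivative^[k] ((X : ℝ[X]) ^ i * (X - C 1) ^ j)).eval 1 = 0 :=
  eval_der_lt (c := 1) (m := j) ⟨X ^ i, by ring⟩ h

lemma ev_zero {i j : ℕ} :
    (derivative^[i] ((X : ℝ[X]) ^ i * (X - C 1) ^ j)).eval 0 = (i.factorial : ℝ) * (-1) ^ j := by
  have := eval_der 0 i (((X : ℝ[X]) - C 1) ^ j) i le_rfl
  rw [map_zero, sub_zero, if_pos rfl] at this
  rw [this]; simp

lemma ev_one {i j : ℕ} :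
    (derivative^[j] ((X : ℝ[X]) ^ i * (X - C 1) ^ j)).eval 1 = (j.factorial : ℝ) := by
  have := eval_der 1 j ((X : ℝ[X]) ^ i) j le_rfl
  rw [mul_comm, if_pos rfl] at this
  rw [this]; simp

lemma up_rho_aux (H : Cen a s n) {Y : Submodule ℝ E} (I : Inv s n Y) {x : ℕ → E} {t : ℕ → ℝ} {y : E}
    (hx : ∀ j, x j ∈ Y) (hx0 : Tendsto x atTop (𝓝 0))
    (hy : Tendsto (fun j => fl a (t j) (x j)) atTop (𝓝 y))
    (ht : Tendsto (fun j => |t j|) atTop atTop) (i : ℕ) :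
    (n ^ i) y ∈ img n (2 * i + 1) Y := by
  obtain ⟨C', hC, hrot⟩ := H.rot
  have hr : Tendsto (fun j => fl s (t j) (x j)) atTop (𝓝 0) := by
    refine squeeze_zero_norm (fun j => hrot (t j) (x j)) ?_
    simpa using hx0.norm.const_mul C'
  let q : ℝ[X] := X ^ i * (X - C 1) ^ i
  have hq : q.natDegree ≤ 2 * i := (deg_le i i).trans (by omega)
  have l1 := lim_conv (n := n) (N := 2 * i) (i := i) ht
    (fun k => (-1) ^ k * (derivative^[k] q).eval 1) (by omega)
    (fun k hk => by simp only [q, ev_one_lt hk, mul_zero]) hy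
  have l2 := lim_conv (n := n) (N := 2 * i) (i := i) ht
    (fun k => (-1) ^ k * (derivative^[k] q).eval 0) (by omega)
    (fun k hk => by simp only [q, ev_zero_lt hk, mul_zero]) hr
  have l3 := l1.sub l2
  have hcl : IsClosed (img n (2 * i + 1) Y : Set E) := Submodule.closed_of_finiteDimensional _
  have hm := hcl.mem_of_tendsto l3 (by
    filter_upwards [ht.eventually (eventually_gt_atTop 0)] with j hj
    exact up_mem1 H q hq (abs_pos.1 hj) i Y I (hx j))
  simp only [map_zero, smul_zero, sub_zero, q, ev_one] at hm
  have h2 := (img n (2 * i + 1) Y).smul_mem (((-1) ^ i * (i.factorial : ℝ))⁻¹) hm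
  rw [smul_smul, inv_mul_cancel₀ (by positivity), one_smul, show 2 * i - i = i by omega] at h2
  exact h2

lemma up_rho (H : Cen a s n) {Y : Submodule ℝ E} (I : Inv s n Y) {x : ℕ → E} {t : ℕ → ℝ} {y : E}
    (hx : ∀ j, x j ∈ Y) (hx0 : Tendsto x atTop (𝓝 0))
    (hy : Tendsto (fun j => fl a (t j) (x j)) atTop (𝓝 y)) (i : ℕ) :
    (n ^ i) y ∈ img n (2 * i + 1) Y := by
  by_cases hb : ∃ R, ∃ᶠ j in atTop, |t j| ≤ R
  · obtain ⟨R, hR⟩ := hb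
    obtain ⟨M, hM, h1⟩ := fl_bdd a R
    have : y = 0 := by
      by_contra hne
      have hp : 0 < ‖y‖ := norm_pos_iff.2 hne
      have e1 := hy.norm.eventually (lt_mem_nhds (show ‖y‖ / 2 < ‖y‖ by linarith))
      have e2 : Tendsto (fun j => M * ‖x j‖) atTop (𝓝 0) := by simpa using hx0.norm.const_mul M
      have e3 := e2.eventually (gt_mem_nhds (show 0 < ‖y‖ / 2 by linarith))
      obtain ⟨j, hj, hj1, hj2⟩ := (hR.and_eventually (e1.and e3)).exists
      linarith [h1 (t j) hj (x j)]
    rw [this, map_zero]; exact Submodule.zero_mem _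
  · push Not at hb
    refine up_rho_aux H I hx hx0 hy (tendsto_atTop.2 fun R => ?_) i
    have := hb R
    filter_upwards [this] with j hj
    exact hj.le

lemma up_pi (H : Cen a s n) {Y : Submodule ℝ E} (I : Inv s n Y) {x : ℕ → E} {t : ℕ → ℝ} {y : E}
    {M : ℝ} (hx : ∀ j, x j ∈ Y) (hx0 : Tendsto x atTop (𝓝 y))
    (hy : ∀ j, ‖fl a (t j) (x j)‖ ≤ M)
    (ht : Tendsto (fun j => |t j|) atTop atTop) (i : ℕ) :
    (n ^ i) y ∈ img n (2 * i) Y := by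
  cases i with
  | zero =>
    have hcl : IsClosed (Y : Set E) := Submodule.closed_of_finiteDimensional _
    exact ⟨y, hcl.mem_of_tendsto hx0 (Eventually.of_forall hx), rfl⟩
  | succ i =>
  obtain ⟨C', hC, hrot⟩ := H.rot
  have hz : ∀ j, ‖fl n (t j) (x j)‖ ≤ C' * M := fun j => by
    have := hrot (-t j) (fl a (t j) (x j))
    rw [H.fl_eq, fl_neg_apply, ← H.fl_eq] at this
    exact this.trans (by gcongr; exact hy j)
  let q : ℝ[X] := X ^ i * (X - C 1) ^ (i + 1)
  have hq : q.natDegree ≤ 2 * i + 1 := (deg_le i (i + 1)).trans (by omega)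
  have l1 := lim_bdd (n := n) (N := 2 * i + 1) (i := i) ht
    (fun k => (-1) ^ k * (derivative^[k] q).eval 1)
    (fun k hk => by simp only [q, ev_one_lt (Nat.lt_succ_of_le hk), mul_zero]) hz
  have l2 := lim_conv (n := n) (N := 2 * i + 1) (i := i) ht
    (fun k => (-1) ^ k * (derivative^[k] q).eval 0) (by omega)
    (fun k hk => by simp only [q, ev_zero_lt hk, mul_zero]) hx0
  have l3 := l1.sub l2
  have hcl : IsClosed (img n (2 * i + 1 + 1) Y : Set E) := Submodule.closed_of_finiteDimensional _
  have hm := hcl.mem_of_tendsto l3 (by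
    filter_upwards [ht.eventually (eventually_gt_atTop 0)] with j hj
    exact up_mem0 q hq (abs_pos.1 hj) i Y I (hx j))
  simp only [zero_sub, q, ev_zero, ← neg_smul] at hm
  have hne : -((-1) ^ i * ((i.factorial : ℝ) * (-1) ^ (i + 1))) ≠ 0 := by
    refine neg_ne_zero.2 (mul_ne_zero (by positivity) (mul_ne_zero (by positivity) (by positivity)))
  have h2 := (img n (2 * i + 1 + 1) Y).smul_mem
    ((-((-1) ^ i * ((i.factorial : ℝ) * (-1) ^ (i + 1))))⁻¹) hm
  rw [smul_smul, inv_mul_cancel₀ hne, one_smul, show 2 * i + 1 - i = i + 1 by omega] at h2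
  exact h2

/-- the two derived subspaces (`δ = 0, 1`) -/
def rp (n : E →L[ℝ] E) (δ : ℕ) (Y : Submodule ℝ E) : Submodule ℝ E where
  carrier := {x | x ∈ Y ∧ ∀ j, (n ^ j) x ∈ img n (2 * j + δ) Y}
  zero_mem' := ⟨Y.zero_mem, fun j => by rw [map_zero]; exact Submodule.zero_mem _⟩
  add_mem' := fun {x y} hx hy => ⟨Y.add_mem hx.1 hy.1, fun j => by
    rw [map_add]; exact Submodule.add_mem _ (hx.2 j) (hy.2 j)⟩
  smul_mem' := fun c x hx => ⟨Y.smul_mem c hx.1, fun j => by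
    rw [map_smul]; exact Submodule.smul_mem _ c (hx.2 j)⟩

lemma mem_rp {δ : ℕ} {Y : Submodule ℝ E} {x : E} :
    x ∈ rp n δ Y ↔ x ∈ Y ∧ ∀ j, (n ^ j) x ∈ img n (2 * j + δ) Y := Iff.rfl

lemma Inv.rp {δ : ℕ} {Y : Submodule ℝ E} (hc : Commute s n) (I : Inv s n Y) :
    Inv s n (rp n δ Y) := by
  constructor
  · rintro x ⟨h1, h2⟩
    refine ⟨I.hs x h1, fun j => ?_⟩
    have : (n ^ j) (s x) = s ((n ^ j) x) :=
      congrArg (fun f : E →L[ℝ] E => f x) (hc.pow_right j).eq.symm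
    rw [this]
    exact (I.img hc _).hs _ (h2 j)
  · rintro x ⟨h1, h2⟩
    refine ⟨I.hn x h1, fun j => ?_⟩
    rw [pow_succ_app', ← pow_succ_app]
    exact (I.img hc _).hn _ (h2 j)

lemma rp_basic {δ j : ℕ} {Y : Submodule ℝ E} (I : Inv s n Y) {w : E} (hw : w ∈ Y)
    (h0 : (n ^ (2 * j + δ + 1)) w = 0) : (n ^ (j + δ)) w ∈ rp n δ Y := by
  refine ⟨I.pow _ hw, fun m => ?_⟩
  rw [pow_add_app]
  by_cases hm : m ≤ j
  · exact I.mem_le (show 2 * m + δ ≤ m + (j + δ) by omega) ⟨w, hw, rfl⟩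
  · have : (n ^ (m + (j + δ))) w = 0 := by
      rw [show m + (j + δ) = (m - j - 1) + (2 * j + δ + 1) by omega, ← pow_add_app, h0, map_zero]
    rw [this]; exact Submodule.zero_mem _

lemma rp_ind {δ : ℕ} {Y : Submodule ℝ E} (I : Inv s n Y) (hnil : ∃ N, n ^ N = 0) (P : E → Prop)
    (P0 : P 0) (Padd : ∀ x y, P x → P y → P (x + y))
    (Pb : ∀ j w, w ∈ Y → (n ^ (2 * j + δ + 1)) w = 0 → P ((n ^ (j + δ)) w)) :
    ∀ x ∈ rp n δ Y, P x := by
  obtain ⟨N, hN⟩ := hnil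
  have key : ∀ m, ∀ x ∈ rp n δ Y, (n ^ m) x = 0 → P x := by
    intro m
    induction m with
    | zero => intro x _ h; have : x = 0 := h
              rw [this]; exact P0
    | succ j ih =>
      intro x hx h
      obtain ⟨w, hw, hwx⟩ := hx.2 j
      have hwx : (n ^ (2 * j + δ)) w = (n ^ j) x := hwx
      have hw0 : (n ^ (2 * j + δ + 1)) w = 0 := by
        rw [← pow_succ_app, hwx, pow_succ_app, h]
      have hb := rp_basic I hw hw0
      have h2 : P (x - (n ^ (j + δ)) w) := by
        refine ih _ (Submodule.sub_mem _ hx hb) ?_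
        rw [map_sub, pow_add_app, show j + (j + δ) = 2 * j + δ by omega, hwx, sub_self]
      have := Padd _ _ h2 (Pb j w hw hw0)
      rwa [sub_add_cancel] at this
  intro x hx
  exact key N x hx (by rw [hN]; rfl)

/-- the filtration of bounded orbits -/
def Fil (n : E →L[ℝ] E) (m : ℕ) (Y : Submodule ℝ E) : Submodule ℝ E :=
  LinearMap.ker (n : E →ₗ[ℝ] E) ⊓ img n m Y

lemma mem_Fil {m : ℕ} {Y : Submodule ℝ E} {x : E} :
    x ∈ Fil n m Y ↔ n x = 0 ∧ ∃ y ∈ Y, (n ^ m) y = x := Iff.rfl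

lemma Fil_rp {δ : ℕ} {Y : Submodule ℝ E} (I : Inv s n Y) (j : ℕ) :
    Fil n j (rp n δ Y) = Fil n (2 * j + δ) Y := by
  ext x
  rw [mem_Fil, mem_Fil]
  constructor
  · rintro ⟨h, y, hy, rfl⟩
    exact ⟨h, hy.2 j⟩
  · rintro ⟨h, w, hw, rfl⟩
    refine ⟨h, (n ^ (j + δ)) w, rp_basic I hw (by rw [← pow_succ_app, h]), ?_⟩
    rw [pow_add_app]; congr 2; omega

/-- constructions -/
lemma reach_basic {δ j : ℕ} (hδ : δ ≤ 1) {Y : Submodule ℝ E} (I : Inv s n Y) {w : E} (hw : w ∈ Y)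
    (h0 : (n ^ (2 * j + δ + 1)) w = 0) {T : ℕ → ℝ} (hT1 : ∀ i, 1 ≤ T i) (hT : Tendsto T atTop atTop) :
    ∃ x : ℕ → E, (∀ i, x i ∈ Y) ∧
      Tendsto x atTop (𝓝 ((if δ = 0 then (j.factorial : ℝ) * (-1) ^ j else 0) • (n ^ (j + δ)) w)) ∧
      Tendsto (fun i => fl n (T i) (x i)) atTop (𝓝 ((j.factorial : ℝ) • (n ^ (j + δ)) w)) := by
  let q : ℝ[X] := X ^ (j + δ) * (X - C 1) ^ j
  have hq : q.natDegree ≤ 2 * j + δ := (deg_le _ _).trans (by omega)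
  have hTa : Tendsto (fun i => |T i|) atTop atTop := tendsto_abs_atTop_atTop.comp hT
  have hT0 : ∀ i, T i ≠ 0 := fun i => by have := hT1 i; positivity
  refine ⟨fun i => T i ^ j • ∑ k ∈ Finset.range (2 * j + δ + 1), dc q (T i) k 0 •
    (n ^ (2 * j + δ - k)) w, fun i => ?_, ?_, ?_⟩
  · exact Y.smul_mem _ (Y.sum_mem fun k _ => Y.smul_mem _ (I.pow _ hw))
  · have l := lim_conv (n := n) (N := 2 * j + δ) (i := j) hTa
      (fun k => (derivative^[k] q).eval 0) (by omega)
      (fun k hk => by simp only [q]; exact ev_zero_lt (by omega)) (tendsto_const_nhds (x := w))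
    have e : (derivative^[j] q).eval 0 = if δ = 0 then (j.factorial : ℝ) * (-1) ^ j else 0 := by
      by_cases h : δ = 0
      · subst h; rw [if_pos rfl]; exact ev_zero
      · rw [if_neg h]; exact ev_zero_lt (by omega)
    rw [e, show 2 * j + δ - j = j + δ by omega] at l
    refine l.congr fun i => ?_
    rw [Finset.smul_sum]
    refine Finset.sum_congr rfl fun k _ => ?_
    unfold dc
    rw [zero_div, smul_smul]; congr 1; ring
  · have l := lim_conv (n := n) (N := 2 * j + δ) (i := j) hTa
      (fun k => (derivative^[k] q).eval 1) (by omega)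
      (fun k hk => by simp only [q]; exact ev_one_lt (by omega)) (tendsto_const_nhds (x := w))
    simp only [q, ev_one] at l
    rw [show 2 * j + δ - j = j + δ by omega] at l
    refine l.congr fun i => ?_
    rw [map_smul, ← cur_fl q hq (T i) h0, Finset.smul_sum]
    refine Finset.sum_congr rfl fun k _ => ?_
    unfold dc
    rw [div_self (hT0 i), smul_smul]; congr 1; ring

lemma reach_rho {Y : Submodule ℝ E} (I : Inv s n Y) (hnil : ∃ N, n ^ N = 0)
    {T : ℕ → ℝ} (hT1 : ∀ i, 1 ≤ T i) (hT : Tendsto T atTop atTop) :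
    ∀ y ∈ rp n 1 Y, ∃ x : ℕ → E, (∀ i, x i ∈ Y) ∧ Tendsto x atTop (𝓝 0) ∧
      Tendsto (fun i => fl n (T i) (x i)) atTop (𝓝 y) := by
  refine rp_ind I hnil _ ⟨fun _ => 0, fun _ => Y.zero_mem, tendsto_const_nhds, by simp⟩ ?_ ?_
  · rintro y y' ⟨x, h1, h2, h3⟩ ⟨x', h1', h2', h3'⟩
    refine ⟨fun i => x i + x' i, fun i => Y.add_mem (h1 i) (h1' i), by simpa using h2.add h2', ?_⟩
    simpa using h3.add h3'
  · intro j w hw h0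
    obtain ⟨x, h1, h2, h3⟩ := reach_basic le_rfl I hw h0 hT1 hT
    refine ⟨fun i => (j.factorial : ℝ)⁻¹ • x i, fun i => Y.smul_mem _ (h1 i), ?_, ?_⟩
    · simpa using h2.const_smul (j.factorial : ℝ)⁻¹
    · have := h3.const_smul (j.factorial : ℝ)⁻¹
      rw [smul_smul, inv_mul_cancel₀ (by positivity), one_smul] at this
      simpa using this

lemma reach_pi {Y : Submodule ℝ E} (I : Inv s n Y) (hnil : ∃ N, n ^ N = 0)
    {T : ℕ → ℝ} (hT1 : ∀ i, 1 ≤ T i) (hT : Tendsto T atTop atTop) :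
    ∀ y ∈ rp n 0 Y, ∃ x : ℕ → E, (∀ i, x i ∈ Y) ∧ Tendsto x atTop (𝓝 y) ∧
      ∃ z, Tendsto (fun i => fl n (T i) (x i)) atTop (𝓝 z) := by
  refine rp_ind I hnil _ ⟨fun _ => 0, fun _ => Y.zero_mem, tendsto_const_nhds, 0, by simp⟩ ?_ ?_
  · rintro y y' ⟨x, h1, h2, z, h3⟩ ⟨x', h1', h2', z', h3'⟩
    refine ⟨fun i => x i + x' i, fun i => Y.add_mem (h1 i) (h1' i), h2.add h2', z + z', ?_⟩
    simpa using h3.add h3'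
  · intro j w hw h0
    obtain ⟨x, h1, h2, h3⟩ := reach_basic (δ := 0) (by omega) I hw h0 hT1 hT
    rw [if_pos rfl] at h2
    have hne : (j.factorial : ℝ) * (-1) ^ j ≠ 0 := mul_ne_zero (by positivity) (by positivity)
    refine ⟨fun i => ((j.factorial : ℝ) * (-1) ^ j)⁻¹ • x i, fun i => Y.smul_mem _ (h1 i), ?_, ?_⟩
    · have := h2.const_smul ((j.factorial : ℝ) * (-1) ^ j)⁻¹
      rwa [smul_smul, inv_mul_cancel₀ hne, one_smul] at this
    · have := h3.const_smul ((j.factorial : ℝ) * (-1) ^ j)⁻¹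
      exact ⟨_, by simpa only [map_smul] using this⟩

end Upper


section CentralStep
variable {E : Type*} [NormedAddCommGroup E] [NormedSpace ℝ E] [FiniteDimensional ℝ E]
  [CompleteSpace E] {a s n : E →L[ℝ] E}
variable {F : Type*} [NormedAddCommGroup F] [NormedSpace ℝ F] [FiniteDimensional ℝ F]
  [CompleteSpace F] {b s' n' : F →L[ℝ] F}

/-- the properties of the central part of an orbit equivalence -/
structure CM (a : E →L[ℝ] E) (b : F →L[ℝ] F) (g : E → F) (τ : E → ℝ → ℝ) : Prop where
  cont : Continuous g
  zero : g 0 = 0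
  orb : ∀ x t, g (fl a t x) = fl b (τ x t) (g x)
  exc : ∀ R M : ℝ, ∃ M', ∀ x t, ‖x‖ ≤ M → 0 ≤ t → |τ x t| ≤ R → ∀ u ∈ Set.Icc 0 t, ‖fl a u x‖ ≤ M'
  bd : ∀ x, Bd a x → Bd b (g x)

variable {g : E → F} {τ : E → ℝ → ℝ}

lemma CM.rho (G : CM a b g τ) (H : Cen a s n) (H' : Cen b s' n') {Y : Submodule ℝ E}
    {Y' : Submodule ℝ F} (I : Inv s n Y) (I' : Inv s' n' Y') (hg : ∀ x ∈ Y, g x ∈ Y') :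
    ∀ x ∈ rp n 1 Y, g x ∈ rp n' 1 Y' := by
  intro y hy
  obtain ⟨T, hT1, hT, hret⟩ := H.ret
  obtain ⟨x, h1, h2, h3⟩ := reach_rho I H.nil hT1 hT y hy
  have h4 := hret _ _ h3
  simp only [← H.fl_eq] at h4
  have h5 := (G.cont.tendsto y).comp h4
  have h6 := (G.cont.tendsto 0).comp h2
  rw [G.zero] at h6
  simp only [Function.comp_def, G.orb] at h5
  exact ⟨hg y hy.1, up_rho H' I' (fun j => hg _ (h1 j)) h6 h5⟩

lemma fl_quad {v : E} (hv : n (n (n v)) = 0) (T t : ℝ) :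
    fl n t (T • n v - (2:ℝ) • v) = (T * t - t ^ 2) • n (n v) + (T - 2 * t) • n v - (2:ℝ) • v := by
  have := fl_unique n (fun t => (T * t - t ^ 2) • n (n v) + (T - 2 * t) • n v - (2:ℝ) • v)
    (fun t => ?_) t
  · simpa using this.symm
  have d1 : HasDerivAt (fun t : ℝ => T * t - t ^ 2) (T - 2 * t) t := by
    have := ((hasDerivAt_id t).const_mul T).fun_sub ((hasDerivAt_id t).fun_pow 2)
    refine this.congr_deriv ?_
    simp
  have d2 : HasDerivAt (fun t : ℝ => T - 2 * t) (-2) t := by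
    simpa using ((hasDerivAt_id t).const_mul 2).const_sub T
  have h1 := ((d1.smul_const (n (n v))).add (d2.smul_const (n v))).sub_const ((2:ℝ) • v)
  refine h1.congr_deriv ?_
  simp only [map_sub, map_add, map_smul, hv, smul_zero, neg_smul]
  abel

lemma sq_tend {T : ℕ → ℝ} (hT : Tendsto T atTop atTop) :
    Tendsto (fun i => (T i * √(T i))⁻¹) atTop (𝓝 0) ∧
    Tendsto (fun i => (T i * √(T i))⁻¹ * T i) atTop (𝓝 0) ∧
    Tendsto (fun i => (T i * √(T i))⁻¹ * (T i) ^ 2) atTop atTop := by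
  have h1 : Tendsto (fun i => √(T i)) atTop atTop := Real.tendsto_sqrt_atTop.comp hT
  refine ⟨?_, ?_, ?_⟩
  · exact tendsto_inv_atTop_zero.comp (hT.atTop_mul_atTop₀ h1)
  · refine (tendsto_inv_atTop_zero.comp h1).congr' ?_
    filter_upwards [hT.eventually (eventually_gt_atTop 0)] with i hi
    have := Real.sqrt_pos.2 hi
    simp only [Function.comp]
    field_simp
  · refine h1.congr' ?_
    filter_upwards [hT.eventually (eventually_gt_atTop 0)] with i hi
    have := Real.sqrt_pos.2 hi
    have h2 := Real.sq_sqrt hi.le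
    field_simp
    exact h2

lemma sign_choice (u e : E) : ∃ σ : ℝ, |σ| ≤ 1 ∧ ‖e‖ ≤ ‖u + σ • e‖ := by
  by_cases h : ‖e‖ ≤ ‖u + e‖
  · exact ⟨1, by simp, by simpa using h⟩
  · refine ⟨-1, by simp, ?_⟩
    have h1 : ‖(u + e) - (u + (-1:ℝ) • e)‖ = 2 * ‖e‖ := by
      rw [show (u + e) - (u + (-1:ℝ) • e) = (2:ℝ) • e by rw [two_smul, neg_one_smul]; abel, norm_smul]
      norm_num
    have := norm_sub_le (u + e) (u + (-1:ℝ) • e)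
    linarith

lemma CM.pi (G : CM a b g τ) (H : Cen a s n) (H' : Cen b s' n') {Y : Submodule ℝ E}
    {Y' : Submodule ℝ F} (I : Inv s n Y) (I' : Inv s' n' Y') (hg : ∀ x ∈ Y, g x ∈ Y') :
    ∀ x ∈ rp n 0 Y, g x ∈ rp n' 0 Y' := by
  intro y hy
  refine ⟨hg y hy.1, ?_⟩
  by_cases hny : n y = 0
  · have := H'.bd_iff.1 (G.bd y (H.bd_iff.2 hny))
    intro j
    cases j with
    | zero => exact ⟨g y, hg y hy.1, rfl⟩
    | succ j => rw [← pow_succ_app', this, map_zero]; exact Submodule.zero_mem _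
  obtain ⟨w, hw, hwy⟩ := hy.2 1
  have hwy : (n ^ 2) w = n y := hwy
  obtain ⟨N, hN⟩ := H.nil
  obtain ⟨k, hk, hk1, hk2⟩ := nil_last hN 2 (by rw [hwy]; exact hny)
  set v := (n ^ (k - 2)) w with hv
  have hvY : v ∈ Y := I.pow _ hw
  have hv2 : n (n v) ≠ 0 := by
    rw [hv, pow_succ_app, pow_succ_app, show k - 2 + 1 + 1 = k by omega]; exact hk1
  have hv3 : n (n (n v)) = 0 := by
    rw [hv, pow_succ_app, pow_succ_app, pow_succ_app, show k - 2 + 1 + 1 + 1 = k + 1 by omega]; exact hk2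
  obtain ⟨T, hT1, hT, hret⟩ := H.ret
  obtain ⟨x, h1, h2, z, h3⟩ := reach_pi I H.nil hT1 hT y hy
  obtain ⟨q1, q2, q3⟩ := sq_tend hT
  set α : ℕ → ℝ := fun i => (T i * √(T i))⁻¹ with hα
  let e : ℕ → E := fun i => α i • (T i • n v - (2:ℝ) • v)
  have he : ∀ i t, fl n t (e i) = α i • ((T i * t - t ^ 2) • n (n v) + (T i - 2 * t) • n v - (2:ℝ) • v) :=
    fun i t => by simp only [e]; rw [map_smul, fl_quad hv3]
  have he0 : Tendsto e atTop (𝓝 0) := by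
    have := (q2.smul_const (n v)).sub ((q1.smul_const v).const_smul (2:ℝ))
    simp only [zero_smul, smul_zero, sub_zero] at this
    refine this.congr fun i => ?_
    simp only [e, smul_sub, smul_smul]; congr 2; ring
  have heT : Tendsto (fun i => fl n (T i) (e i)) atTop (𝓝 0) := by
    have := ((q2.smul_const (n v)).const_smul (-1:ℝ)).sub ((q1.smul_const v).const_smul (2:ℝ))
    simp only [zero_smul, smul_zero, sub_zero] at this
    refine this.congr fun i => ?_
    rw [he, show T i * T i - T i ^ 2 = 0 by ring]
    simp only [smul_sub, smul_add, smul_smul, zero_smul, mul_zero, zero_add]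
    congr 2 <;> ring
  have heM : Tendsto (fun i => ‖fl n (T i / 2) (e i)‖) atTop atTop := by
    have m1 : Tendsto (fun i => α i * T i ^ 2 * (‖n (n v)‖ / 4) + (-1)) atTop atTop :=
      tendsto_atTop_add_const_right _ _ (q3.atTop_mul_const (by positivity))
    have m2 : Tendsto (fun i => ‖(2 * α i) • v‖) atTop (𝓝 0) := by
      simpa using ((q1.const_mul 2).smul_const v).norm
    refine tendsto_atTop_mono' _ ?_ m1
    filter_upwards [m2.eventually (gt_mem_nhds one_pos)] with i hi
    rw [he]
    have e1 : α i • ((T i * (T i / 2) - (T i / 2) ^ 2) • n (n v) + (T i - 2 * (T i / 2)) • n v - (2:ℝ) • v)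
        = (α i * T i ^ 2 / 4) • n (n v) - (2 * α i) • v := by
      rw [show T i - 2 * (T i / 2) = 0 by ring]
      simp only [smul_sub, smul_add, smul_smul, zero_smul, mul_zero, add_zero]
      congr 2 <;> ring
    rw [e1]
    have e2 := norm_sub_norm_le ((α i * T i ^ 2 / 4) • n (n v)) ((2 * α i) • v)
    have e3 : ‖(α i * T i ^ 2 / 4) • n (n v)‖ = α i * T i ^ 2 * (‖n (n v)‖ / 4) := by
      rw [norm_smul, Real.norm_eq_abs, abs_of_nonneg]
      · ring
      · have := hT1 i
        simp only [hα]; positivity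
    rw [e3] at e2
    linarith
  choose σ hσ1 hσ2 using fun i => sign_choice (fl n (T i / 2) (x i)) (fl n (T i / 2) (e i))
  have hσ0 : ∀ {f : ℕ → E}, Tendsto f atTop (𝓝 0) → Tendsto (fun i => σ i • f i) atTop (𝓝 0) := by
    intro f hf
    refine squeeze_zero_norm (fun i => ?_) (tendsto_zero_iff_norm_tendsto_zero.1 hf)
    rw [norm_smul]
    exact mul_le_of_le_one_left (norm_nonneg _) (hσ1 i)
  let x' : ℕ → E := fun i => x i + σ i • e i
  have hx'Y : ∀ i, x' i ∈ Y := fun i => Y.add_mem (h1 i) (Y.smul_mem _ (Y.smul_mem _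
    (Y.sub_mem (Y.smul_mem _ (I.hn _ hvY)) (Y.smul_mem _ hvY))))
  have hx' : Tendsto x' atTop (𝓝 y) := by simpa using h2.add (hσ0 he0)
  have hx'T : Tendsto (fun i => fl n (T i) (x' i)) atTop (𝓝 z) := by
    simpa [x'] using h3.add (hσ0 heT)
  have h4 := hret _ _ hx'T
  simp only [← H.fl_eq] at h4
  have h5 := (G.cont.tendsto z).comp h4
  have h6 := (G.cont.tendsto y).comp hx'
  simp only [Function.comp_def, G.orb] at h5
  obtain ⟨M, hM⟩ := h5.norm.bddAbove_range
  obtain ⟨M0, hM0⟩ := hx'.norm.bddAbove_range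
  refine up_pi H' I' (fun j => hg _ (hx'Y j)) h6 (fun j => hM ⟨j, rfl⟩) ?_
  obtain ⟨C, hC, hrot⟩ := H.rot
  refine tendsto_atTop.2 fun R => ?_
  obtain ⟨M', hM'⟩ := G.exc R M0
  filter_upwards [heM.eventually (eventually_gt_atTop (C * M'))] with j hj
  by_contra hcon
  have h7 := hM' (x' j) (T j) (hM0 ⟨j, rfl⟩) (by linarith [hT1 j]) (not_le.1 hcon).le (T j / 2)
    ⟨by linarith [hT1 j], by linarith [hT1 j]⟩
  have h8 := hrot (-(T j / 2)) (fl a (T j / 2) (x' j))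
  rw [H.fl_eq, fl_neg_apply, ← H.fl_eq] at h8
  have h9 := hσ2 j
  have h10 : fl n (T j / 2) (x' j) = fl n (T j / 2) (x j) + σ j • fl n (T j / 2) (e j) := by
    simp [x']
  rw [← h10] at h9
  have := mul_le_mul_of_nonneg_left h7 (by linarith : (0:ℝ) ≤ C)
  linarith

lemma CM.fil (G : CM a b g τ) (H : Cen a s n) (H' : Cen b s' n') : ∀ (m : ℕ) {Y : Submodule ℝ E}
    {Y' : Submodule ℝ F}, Inv s n Y → Inv s' n' Y' → (∀ x ∈ Y, g x ∈ Y') →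
    ∀ x ∈ Fil n m Y, g x ∈ Fil n' m Y' := by
  intro m
  induction m using Nat.strong_induction_on with
  | _ m ih =>
  intro Y Y' I I' hg x hx
  have hb : n' (g x) = 0 := H'.bd_iff.1 (G.bd x (H.bd_iff.2 hx.1))
  rcases Nat.eq_zero_or_pos m with rfl | hm
  · obtain ⟨y, hy, rfl⟩ := hx.2
    exact ⟨hb, g y, hg y hy, rfl⟩
  · have hd : m = 2 * (m / 2) + m % 2 := by omega
    have hgδ : ∀ x ∈ rp n (m % 2) Y, g x ∈ rp n' (m % 2) Y' := by
      rcases Nat.mod_two_eq_zero_or_one m with h | h <;> rw [h]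
      · exact G.pi H H' I I' hg
      · exact G.rho H H' I I' hg
    rw [hd, ← Fil_rp I'] 
    rw [hd, ← Fil_rp I] at hx
    exact ih (m / 2) (by omega) (I.rp H.comm) (I'.rp H'.comm) hgδ x hx

lemma CM.fil_top (G : CM a b g τ) (H : Cen a s n) (H' : Cen b s' n') (m : ℕ) :
    ∀ x ∈ Fil n m ⊤, g x ∈ Fil n' m ⊤ :=
  G.fil H H' m ⟨fun _ _ => trivial, fun _ _ => trivial⟩ ⟨fun _ _ => trivial, fun _ _ => trivial⟩
    fun _ _ => trivial

end CentralStep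


section Rotation
open Polynomial
variable {E : Type*} [NormedAddCommGroup E] [NormedSpace ℝ E] [FiniteDimensional ℝ E]
  [CompleteSpace E] {a : E →L[ℝ] E}

lemma rot_cen (h : ceE a = ⊤) : Cen a a 0 :=
  ⟨by simp, Commute.zero_right a, ⟨1, by simp⟩, h⟩

lemma rot_of_bdd (h : ∀ x, Bd a x) : ceE a = ⊤ := by
  obtain ⟨s, n, H⟩ := exists_Cen a (fun x => by
    rw [mem_ceS]
    intro ε hε
    obtain ⟨M, hM⟩ := h x
    have h0 : Tendsto (fun t : ℝ => |t|) (atBot ⊔ atTop) atTop :=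
      tendsto_sup.2 ⟨tendsto_abs_atBot_atTop, tendsto_abs_atTop_atTop⟩
    have h1 : Tendsto (fun t : ℝ => Real.exp (-(ε * |t|)) * M) (atBot ⊔ atTop) (𝓝 0) := by
      have := (Real.tendsto_exp_neg_atTop_nhds_zero.comp (h0.const_mul_atTop hε)).mul_const M
      simpa [Function.comp_def] using this
    refine squeeze_zero_norm (fun t => ?_) h1
    rw [norm_smul, Real.norm_eq_abs, abs_of_pos (Real.exp_pos _)]
    exact mul_le_mul_of_nonneg_left (hM t) (Real.exp_pos _).le)
  have hn : n = 0 := by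
    ext x; exact H.bd_iff.1 (h x)
  have := H.add
  rw [hn, add_zero] at this
  rw [this]; exact H.spn

lemma lin_bdd {c K : ℝ} (h : ∀ t : ℝ, |c * t| ≤ K) : c = 0 := by
  by_contra hc
  have := h ((|K| + 1) / c)
  rw [mul_div_cancel₀ _ hc] at this
  have h2 := abs_nonneg K
  rw [abs_of_pos (by linarith)] at this
  linarith [le_abs_self K]

lemma rot_sq (h : ceE a = ⊤) {x : E} (hx : a (a x) = 0) : a x = 0 := by
  obtain ⟨C, hC, hr⟩ := (rot_cen h).rot
  have h1 : ‖a x‖ = 0 := lin_bdd (K := C * ‖x‖ + ‖x‖) fun t => by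
    have h2 := hr t x
    rw [fl_lin hx] at h2
    have h3 : ‖t • a x‖ ≤ ‖x + t • a x‖ + ‖x‖ := by
      have := norm_sub_le (x + t • a x) x
      simpa using this
    rw [abs_mul, abs_norm, mul_comm, ← Real.norm_eq_abs, ← norm_smul]
    linarith
  exact norm_eq_zero.1 h1

lemma rot_real (h : ceE a = ⊤) {x : E} {k : ℝ} (hx : a x = k • x) : a x = 0 := by
  by_cases hk : k = 0
  · rw [hx, hk, zero_smul]
  obtain ⟨C, hC, hr⟩ := (rot_cen h).rot
  have hE : IsEig a k 0 x 0 := ⟨by simp [hx], by simp⟩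
  have hx0 : ‖x‖ = 0 := by
    by_contra hne
    have hp : 0 < ‖x‖ := lt_of_le_of_ne (norm_nonneg _) (Ne.symm hne)
    have := hr (C / k) x
    rw [fl_eig hE] at this
    simp only [zero_mul, Real.cos_zero, one_smul, Real.sin_zero, zero_smul, add_zero, norm_smul,
      mul_div_cancel₀ _ hk] at this
    rw [Real.norm_eq_abs, abs_of_pos (Real.exp_pos _)] at this
    have h2 := Real.add_one_le_exp C
    nlinarith
  rw [norm_eq_zero.1 hx0, map_zero]

lemma exists_ann (x : E) (hx : x ∈ ceE a) :
    ∃ l : List ℝ, aeval a (l.map (fun ω => (X : ℝ[X]) ^ 2 + C (ω ^ 2))).prod x = 0 := by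
  unfold ceE at hx
  induction hx using Submodule.span_induction with
  | mem x hx =>
    obtain ⟨β, y, _, h1, h2⟩ := hx
    refine ⟨[β], ?_⟩
    simp only [zero_smul, zero_add, zero_sub] at h1 h2
    simp [pow_two, h1, h2, Algebra.algebraMap_eq_smul_one, smul_smul]
  | zero => exact ⟨[], by simp⟩
  | add x y _ _ hx hy =>
    obtain ⟨l, hl⟩ := hx
    obtain ⟨l', hl'⟩ := hy
    refine ⟨l ++ l', ?_⟩
    rw [List.map_append, List.prod_append, map_add, map_mul]
    nth_rewrite 1 [← map_mul, mul_comm, map_mul]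
    simp only [ContinuousLinearMap.mul_apply, hl, hl', map_zero, add_zero]
  | smul c x _ hx =>
    obtain ⟨l, hl⟩ := hx
    exact ⟨l, by rw [map_smul, hl, smul_zero]⟩

lemma exists_eigR (l : List ℝ) : ∀ x : E, x ≠ 0 →
    aeval a (l.map (fun ω => (X : ℝ[X]) ^ 2 + C (ω ^ 2))).prod x = 0 →
    ∃ (r : ℝ[X]) (ω : ℝ), aeval a r x ≠ 0 ∧ a (a (aeval a r x)) = -(ω ^ 2 • aeval a r x) := by
  induction l with
  | nil => intro x hx h; exact absurd (by simpa using h) hx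
  | cons ω l ih =>
    intro x hx h
    by_cases h0 : aeval a ((X : ℝ[X]) ^ 2 + C (ω ^ 2)) x = 0
    · refine ⟨1, ω, by simpa using hx, ?_⟩
      rw [map_add, map_pow, aeval_X, aeval_C, Algebra.algebraMap_eq_smul_one, pow_two] at h0
      simpa using eq_neg_of_add_eq_zero_left h0
    · obtain ⟨r, ω', h1, h2⟩ := ih _ h0 (by
        rw [List.map_cons, List.prod_cons, mul_comm, map_mul] at h
        exact h)
      refine ⟨r * ((X : ℝ[X]) ^ 2 + C (ω ^ 2)), ω', ?_, ?_⟩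
      · rw [map_mul]; exact h1
      · rw [map_mul]; exact h2

lemma exists_L (h : ceE a = ⊤) {w : E} (hw : a w ≠ 0) : ∃ (L : E → ℂ) (ω : ℝ), Continuous L ∧ ω ≠ 0 ∧
    L w ≠ 0 ∧ ∀ t : ℝ, L (fl a t w) = Complex.exp ((ω * t : ℝ) * Complex.I) * L w := by
  obtain ⟨l, hl⟩ := exists_ann (a := a) (a w) (by rw [h]; trivial)
  obtain ⟨r, ω, h1, h2⟩ := exists_eigR l _ hw hl
  let R : E →L[ℝ] E := aeval a r * a
  set u := R w with hu
  have h1 : u ≠ 0 := h1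
  have h2 : a (a u) = -(ω ^ 2 • u) := h2
  have hR : Commute R a := by
    have h3 : Commute (aeval a r) a := by
      have := Commute.map (Commute.all r X) (aeval a : ℝ[X] →ₐ[ℝ] (E →L[ℝ] E))
      rwa [aeval_X] at this
    exact h3.mul_left (Commute.refl a)
  have hω : ω ≠ 0 := by
    rintro rfl
    simp only [ne_eq, OfNat.ofNat_ne_zero, not_false_eq_true, zero_pow, zero_smul, neg_zero] at h2
    have h3 := rot_sq h h2
    have h4 : u = a (aeval a r w) := by
      have h3 : Commute (aeval a r) a := by
        have := Commute.map (Commute.all r X) (aeval a : ℝ[X] →ₐ[ℝ] (E →L[ℝ] E))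
        rwa [aeval_X] at this
      exact congrArg (fun f : E →L[ℝ] E => f w) h3.eq
    rw [h4] at h3 h1
    exact h1 (rot_sq h h3)
  let y := ω⁻¹ • a u
  have hE : IsEig a 0 ω u y := by
    refine ⟨?_, ?_⟩
    · simp only [y, smul_smul, mul_inv_cancel₀ hω]; simp
    · simp only [y, map_smul, h2, smul_neg, smul_smul]
      rw [pow_two, ← mul_assoc, inv_mul_cancel₀ hω]; simp
  have hRf : ∀ t, R (fl a t w) = Real.cos (ω * t) • u + Real.sin (ω * t) • y := fun t => by
    rw [fl_comm_apply a R hR, ← hu, fl_eig hE]; simp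
  have hRf' : ∀ t, ω⁻¹ • R (a (fl a t w)) = Real.cos (ω * t) • y - Real.sin (ω * t) • u := fun t => by
    have : R (a (fl a t w)) = a (R (fl a t w)) := congrArg (fun f : E →L[ℝ] E => f (fl a t w)) hR.eq
    rw [this, hRf, map_add, map_smul, map_smul, hE.1, hE.2]
    simp only [zero_smul, zero_add, zero_sub, smul_add, smul_smul, smul_neg]
    rw [sub_eq_add_neg, ← neg_smul, ← neg_smul]
    congr 2
    · field_simp
    · field_simp
  obtain ⟨f, hf⟩ := SeparatingDual.exists_ne_zero (R := ℝ) h1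
  let L : E → ℂ := fun v => (f (R v) : ℂ) - (f (ω⁻¹ • R (a v)) : ℂ) * Complex.I
  have hL : ∀ t : ℝ, L (fl a t w) = Complex.exp ((ω * t : ℝ) * Complex.I) * ((f u : ℂ) - (f y : ℂ) * Complex.I) := by
    intro t
    simp only [L, hRf, hRf']
    rw [Complex.exp_mul_I, ← Complex.ofReal_cos, ← Complex.ofReal_sin]
    simp only [map_add, map_sub, map_smul, smul_eq_mul, Complex.ofReal_add, Complex.ofReal_sub,
      Complex.ofReal_mul]
    linear_combination ((Complex.ofReal (Real.sin (ω * t)) * f y)) * Complex.I_sq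
  have hL0 : L w = (f u : ℂ) - (f y : ℂ) * Complex.I := by
    have := hL 0
    simpa using this
  refine ⟨L, ω, ?_, hω, ?_, fun t => by rw [hL, hL0]⟩
  · simp only [L]
    fun_prop
  · rw [hL0]
    intro h0
    have := congrArg Complex.re h0
    simp at this
    exact hf this

lemma const_count {Y : Type*} [MetricSpace Y] {f : ℝ → Y} (hf : Continuous f) {S : Set Y}
    (hS : S.Countable) (h : ∀ t, f t ∈ S) (t : ℝ) : f t = f 0 := by
  have h1 := hS.isTotallyDisconnected (Set.range f) (by rintro _ ⟨t, rfl⟩; exact h t)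
    (isPreconnected_range hf)
  exact h1 ⟨t, rfl⟩ ⟨0, rfl⟩

lemma count_exp {ω : ℝ} (hω : ω ≠ 0) :
    {σ : ℝ | Complex.exp ((ω * σ : ℝ) * Complex.I) = 1}.Countable := by
  refine (Set.countable_range (fun k : ℤ => k * (2 * Real.pi) / ω)).mono ?_
  intro σ hσ
  obtain ⟨k, hk⟩ := Complex.exp_eq_one_iff.1 hσ
  refine ⟨k, ?_⟩
  have h1 : ((ω * σ : ℝ) : ℂ) = ((k * (2 * Real.pi) : ℝ) : ℂ) := by
    have h2 : ((ω * σ : ℝ) : ℂ) * Complex.I = ((k * (2 * Real.pi) : ℝ) : ℂ) * Complex.I := by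
      rw [hk]; push_cast; ring
    exact mul_right_cancel₀ Complex.I_ne_zero h2
  have h3 : ω * σ = k * (2 * Real.pi) := by exact_mod_cast h1
  simp only
  rw [← h3]; field_simp

lemma per_const (h : ceE a = ⊤) {w : E} (hw : a w ≠ 0) {f : ℝ → ℝ} (hf : Continuous f)
    (hp : ∀ t, fl a (f t) w = w) (t : ℝ) : f t = f 0 := by
  obtain ⟨L, ω, hL, hω, hL0, hLf⟩ := exists_L h hw
  refine const_count hf (count_exp hω) (fun t => ?_) t
  have := hLf (f t)
  rw [hp] at this
  exact mul_right_cancel₀ hL0 (by rw [← this, one_mul])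

lemma lift_time (h : ceE a = ⊤) {w : E} (hw : a w ≠ 0) {γ : ℝ → E} (hγ : Continuous γ) (h0 : γ 0 = w)
    (ho : ∀ t, ∃ t', γ t = fl a t' w) :
    ∃ τ : ℝ → ℝ, Continuous τ ∧ τ 0 = 0 ∧ ∀ t, γ t = fl a (τ t) w := by
  obtain ⟨L, ω, hL, hω, hL0, hLf⟩ := exists_L h hw
  have hn : ∀ t, L (γ t) / L w ∈ Submonoid.unitSphere ℂ := fun t => by
    obtain ⟨t', ht'⟩ := ho t
    rw [ht', hLf, mul_div_cancel_right₀ _ hL0]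
    exact mem_sphere_zero_iff_norm.2 (Complex.norm_exp_ofReal_mul_I _)
  let ζ : C(ℝ, Circle) := ⟨fun t => ⟨L (γ t) / L w, hn t⟩, by
    refine Continuous.subtype_mk ?_ _
    exact (hL.comp hγ).div_const _⟩
  obtain ⟨θ, ⟨hθ0, hθ⟩, -⟩ := Circle.isCoveringMap_exp.existsUnique_continuousMap_lifts ζ 0 0 (by
    apply Circle.ext
    have : ((ζ 0 : Circle) : ℂ) = L (γ 0) / L w := rfl
    rw [this, h0, div_self hL0]
    simp)
  have hθ' : ∀ t, L (γ t) = Complex.exp ((θ t : ℝ) * Complex.I) * L w := fun t => by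
    have h1 := congrArg (fun f => ((f t : Circle) : ℂ)) hθ
    simp only [Function.comp_def] at h1
    rw [Circle.coe_exp] at h1
    rw [h1]
    simp only [ζ]
    exact (div_mul_cancel₀ _ hL0).symm
  let τ : ℝ → ℝ := fun t => θ t / ω
  have hτ : Continuous τ := θ.continuous.div_const _
  have hτ0 : τ 0 = 0 := by simp [τ, hθ0]
  refine ⟨τ, hτ, hτ0, fun t => ?_⟩
  have hc : Continuous (fun t => fl a (-τ t) (γ t)) :=
    (continuous_fl_uncurry a).comp (hτ.neg.prodMk hγ)
  have key := const_count hc ((count_exp hω).image (fun σ => fl a σ w)) (fun t => by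
    obtain ⟨t', ht'⟩ := ho t
    refine ⟨-τ t + t', ?_, by simp only [ht', fl_add_apply]⟩
    have h1 := hθ' t
    rw [ht', hLf] at h1
    have h2 := mul_right_cancel₀ hL0 h1
    simp only [Set.mem_setOf_eq]
    rw [show ω * (-τ t + t') = -θ t + ω * t' by simp only [τ]; field_simp, Complex.ofReal_add, add_mul,
      Complex.exp_add, h2, ← Complex.exp_add, ← add_mul, ← Complex.ofReal_add]
    simp) t
  simp only [hτ0, neg_zero, fl_zero_apply, h0] at key
  rw [← key, fl_neg_apply']

end Rotation


section RotNum
variable {E : Type*} [NormedAddCommGroup E] [NormedSpace ℝ E] [FiniteDimensional ℝ E]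
  [CompleteSpace E] {a : E →L[ℝ] E}
variable {F : Type*} [NormedAddCommGroup F] [NormedSpace ℝ F] [FiniteDimensional ℝ F]
  [CompleteSpace F] {b : F →L[ℝ] F}

/-- orbit equivalences of rotations -/
structure RE (a : E →L[ℝ] E) (b : F →L[ℝ] F) (g : E ≃ₜ F) : Prop where
  ra : ceE a = ⊤
  rb : ceE b = ⊤
  orb : ∀ x t, ∃ t', g (fl a t x) = fl b t' (g x)
  orb' : ∀ y t, ∃ t', g.symm (fl b t y) = fl a t' (g.symm y)

variable {g : E ≃ₜ F}

lemma RE.symm (H : RE a b g) : RE b a g.symm := ⟨H.rb, H.ra, H.orb', H.orb⟩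

lemma fl_fix {x : E} (hx : a x = 0) (t : ℝ) : fl a t x = x := by
  have := fl_lin (n := a) (v := x) (by rw [hx, map_zero]) t
  rw [this, hx]; simp

lemma fix_of_fl {x : E} (h : ∀ t, fl a t x = x) : a x = 0 := by
  have h1 := hasDerivAt_fl a 0 x
  have h2 : (fun u => fl a u x) = fun _ => x := funext h
  rw [h2] at h1
  have := h1.unique (hasDerivAt_const 0 x)
  simpa using this

lemma RE.nonfix (H : RE a b g) {x : E} (hx : a x ≠ 0) : b (g x) ≠ 0 := by
  intro h
  apply hx
  apply fix_of_fl
  intro t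
  obtain ⟨t', ht'⟩ := H.orb x t
  rw [fl_fix h] at ht'
  exact g.injective ht'

/-- continuous time lifts -/
structure Lf (a : E →L[ℝ] E) (b : F →L[ℝ] F) (g : E ≃ₜ F) (x : E) (τ : ℝ → ℝ) : Prop where
  cont : Continuous τ
  zero : τ 0 = 0
  eq : ∀ t, g (fl a t x) = fl b (τ t) (g x)

lemma RE.lift (H : RE a b g) {x : E} (hx : a x ≠ 0) : ∃ τ, Lf a b g x τ := by
  obtain ⟨τ, h1, h2, h3⟩ := lift_time H.rb (H.nonfix hx) (γ := fun t => g (fl a t x))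
    (g.continuous.comp ((continuous_fl_uncurry a).comp (continuous_id.prodMk continuous_const)))
    (by simp) (H.orb x)
  exact ⟨τ, h1, h2, h3⟩

lemma RE.inv (H : RE a b g) {x : E} (hx : a x ≠ 0) {τ τ' : ℝ → ℝ} (h : Lf a b g x τ)
    (h' : Lf b a g.symm (g x) τ') (t : ℝ) : τ' (τ t) = t := by
  have key := per_const H.ra hx (f := fun t => -t + τ' (τ t))
    (continuous_neg.add (h'.cont.comp h.cont)) (fun t => by
      have := h'.eq (τ t)
      rw [← h.eq, g.symm_apply_apply, g.symm_apply_apply] at this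
      rw [fl_add_apply, ← this, fl_neg_apply]) t
  simp only [h.zero, h'.zero] at key
  linarith

lemma RE.per (H : RE a b g) {x : E} (hx : a x ≠ 0) {τ : ℝ → ℝ} (h : Lf a b g x τ) {T : ℝ}
    (hT : fl a T x = x) (t : ℝ) : τ (t + T) = τ t + τ T := by
  have key := per_const H.rb (H.nonfix hx) (f := fun t => -τ t + τ (t + T))
    (h.cont.neg.add (h.cont.comp (continuous_id.add continuous_const))) (fun t => by
      rw [fl_add_apply, ← h.eq, fl_add_apply, hT, h.eq, fl_neg_apply]) t
  simp only [h.zero, zero_add, neg_zero] at key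
  linarith

lemma RE.per_mul (H : RE a b g) {x : E} (hx : a x ≠ 0) {τ : ℝ → ℝ} (h : Lf a b g x τ) {T : ℝ}
    (hT : fl a T x = x) (m : ℕ) : τ (m * T) = m * τ T := by
  induction m with
  | zero => simp [h.zero]
  | succ m ih =>
    push_cast
    rw [add_mul, one_mul, H.per hx h hT, ih]; ring

lemma nat_bdd {c K : ℝ} (h : ∀ m : ℕ, |m * c| ≤ K) : c = 0 := by
  by_contra hc
  obtain ⟨m, hm⟩ := exists_nat_gt (K / |c|)
  have := h m
  rw [abs_mul, Nat.abs_cast] at this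
  rw [div_lt_iff₀ (abs_pos.2 hc)] at hm
  linarith

lemma RE.rotnum (H : RE a b g) {x : E} (hx : a x ≠ 0) {τ : ℝ → ℝ} (h : Lf a b g x τ) {T0 : ℝ}
    (hT0 : T0 ≠ 0) (hT : fl a T0 x = x) :
    ∃ c K : ℝ, (∀ t, |τ t - c * t| ≤ K) ∧ ∀ T, fl a T x = x → fl b (c * T) (g x) = g x := by
  set c := τ T0 / T0 with hc
  have hper : Function.Periodic (fun t => τ t - c * t) T0 := fun t => by
    simp only [H.per hx h hT, hc]; field_simp; ring
  have hbd : ∃ K, ∀ t, |τ t - c * t| ≤ K := by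
    have hcont : Continuous (fun t => τ t - c * t) := h.cont.sub (continuous_const.mul continuous_id)
    obtain ⟨K, hK⟩ := (isCompact_Icc (a := (0:ℝ)) (b := |T0|)).exists_bound_of_continuousOn
      hcont.continuousOn
    refine ⟨K, fun t => ?_⟩
    have hp2 : Function.Periodic (fun t => τ t - c * t) |T0| := by
      rcases abs_choice T0 with h | h <;> rw [h]
      · exact hper
      · exact hper.neg
    obtain ⟨y, hy, hy2⟩ := hp2.exists_mem_Ico₀ (abs_pos.2 hT0) t
    rw [show τ t - c * t = _ from hy2]
    exact hK y ⟨hy.1, hy.2.le⟩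
  obtain ⟨K, hK⟩ := hbd
  refine ⟨c, K, hK, fun T hT1 => ?_⟩
  have : τ T - c * T = 0 := nat_bdd (K := K) fun m => by
    have := hK (m * T)
    rw [H.per_mul hx h hT1] at this
    rwa [show (m:ℝ) * (τ T - c * T) = m * τ T - c * (m * T) by ring]
  rw [show c * T = τ T by linarith, ← h.eq, hT1]

lemma RE.rot1 (H : RE a b g) {x : E} (hx : a x ≠ 0) {τ : ℝ → ℝ} (h : Lf a b g x τ) {T0 : ℝ}
    (hT0 : T0 ≠ 0) (hT : fl a T0 x = x) :
    ∃ c K : ℝ, c ≠ 0 ∧ (∀ t, |τ t - c * t| ≤ K) ∧ ∀ T, fl a T x = x ↔ fl b (c * T) (g x) = g x := by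
  obtain ⟨c, K, h1, h2⟩ := H.rotnum hx h hT0 hT
  have hy := H.nonfix hx
  obtain ⟨τ', h'⟩ := H.symm.lift hy
  have hinv := H.inv hx h h'
  have hc : c ≠ 0 := by
    rintro rfl
    obtain ⟨M, hM⟩ := (isCompact_Icc (a := -K) (b := K)).exists_bound_of_continuousOn
      h'.cont.continuousOn
    have := hM (τ (M + 1)) (by have := h1 (M + 1); rw [zero_mul, sub_zero] at this; exact abs_le.1 this)
    rw [hinv] at this
    have := (le_abs_self (M + 1)).trans this
    linarith
  obtain ⟨c', K', h3, h4⟩ := H.symm.rotnum hy h' (mul_ne_zero hc hT0) (h2 T0 hT)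
  have hcc : 1 - c' * c = 0 := lin_bdd (K := K' + |c'| * K) fun t => by
    have e1 := h3 (τ t)
    rw [hinv] at e1
    have e2 : |c' * (τ t - c * t)| ≤ |c'| * K := by
      rw [abs_mul]; exact mul_le_mul_of_nonneg_left (h1 t) (abs_nonneg _)
    rw [show (1 - c' * c) * t = (t - c' * τ t) + c' * (τ t - c * t) by ring]
    exact (abs_add_le _ _).trans (add_le_add e1 e2)
  refine ⟨c, K, hc, h1, fun T => ⟨h2 T, fun hS => ?_⟩⟩
  have := h4 _ hS
  rw [← mul_assoc, show c' * c = 1 by linarith, one_mul, g.symm_apply_apply] at this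
  exact this

lemma RE.rot2 (H : RE a b g) {x : E} (hx : a x ≠ 0) {τ : ℝ → ℝ} (h : Lf a b g x τ)
    (hp : (∃ T0, T0 ≠ 0 ∧ fl a T0 x = x) ∨ ∃ T0, T0 ≠ 0 ∧ fl b T0 (g x) = g x) :
    ∃ c K : ℝ, c ≠ 0 ∧ (∀ t, |τ t - c * t| ≤ K) ∧ ∀ T, fl a T x = x ↔ fl b (c * T) (g x) = g x := by
  rcases hp with ⟨T0, h0, hT⟩ | ⟨T0, h0, hT⟩
  · exact H.rot1 hx h h0 hT
  have hy := H.nonfix hx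
  obtain ⟨τ', h'⟩ := H.symm.lift hy
  have hinv := H.inv hx h h'
  obtain ⟨c, K, hc, h1, h2⟩ := H.symm.rot1 hy h' h0 hT
  refine ⟨c⁻¹, |c|⁻¹ * K, inv_ne_zero hc, fun t => ?_, fun T => ?_⟩
  · have := h1 (τ t)
    rw [hinv] at this
    rw [show τ t - c⁻¹ * t = -c⁻¹ * (t - c * τ t) by field_simp; ring, abs_mul, abs_neg, abs_inv]
    exact mul_le_mul_of_nonneg_left this (by positivity)
  · rw [h2, ← mul_assoc, mul_inv_cancel₀ hc, one_mul, g.symm_apply_apply]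

lemma RE.loc (H : RE a b g) {x : E} (hx : a x ≠ 0) {τ : ℝ → ℝ} (h : Lf a b g x τ) :
    ∀ᶠ y in 𝓝 x, ∀ τy, Lf a b g y τy → ∃ K, ∀ t, |τ t - τy t| ≤ K := by
  have hw := H.nonfix hx
  obtain ⟨σ, hσ, hσw⟩ : ∃ σ > 0, fl b σ (g x) ≠ g x := by
    by_contra hcon
    push Not at hcon
    refine hw (fix_of_fl fun t => ?_)
    rcases lt_trichotomy t 0 with ht | rfl | ht
    · have := hcon (-t) (by linarith)
      have h2 := fl_neg_apply' b t (g x)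
      rwa [this] at h2
    · simp
    · exact hcon t ht
  set w := g x with hwd
  obtain ⟨C, hC, hr⟩ := (rot_cen H.rb).rot
  obtain ⟨C1, hC1, hr1⟩ := (rot_cen H.ra).rot
  set ε := ‖fl b σ w - w‖ with hε
  have hε0 : 0 < ε := norm_pos_iff.2 (sub_ne_zero.2 hσw)
  have hεm : ε ≤ C * ‖fl b (-σ) w - w‖ := by
    have := hr σ (fl b (-σ) w - w)
    rwa [map_sub, fl_neg_apply', norm_sub_rev] at this
  have hC0 : 0 < C := by linarith
  set η := ε / (2 * C * (C + 1)) with hη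
  have hη0 : 0 < η := by positivity
  have huc := (isCompact_closedBall (0 : E) (C1 * (‖x‖ + 1))).uniformContinuousOn_of_continuous
    (f := g) g.continuous.continuousOn
  rw [Metric.uniformContinuousOn_iff] at huc
  obtain ⟨δ, hδ, hu⟩ := huc η hη0
  filter_upwards [Metric.ball_mem_nhds x (show 0 < min 1 (δ / C1) by positivity)] with y hy τy hτy
  rw [Metric.mem_ball, lt_min_iff] at hy
  have hny : ‖y‖ ≤ ‖x‖ + 1 := by
    have := norm_le_norm_add_norm_sub' y x
    rw [← dist_eq_norm] at this
    rw [dist_eq_norm] at hy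
    have h2 := norm_sub_norm_le y x
    linarith [hy.1]
  have hclose : ∀ t, ‖g (fl a t x) - g (fl a t y)‖ ≤ η := fun t => by
    rw [← dist_eq_norm]
    refine (hu _ ?_ _ ?_ ?_).le
    · rw [mem_closedBall_zero_iff]
      exact (hr1 t x).trans (by gcongr; linarith)
    · rw [mem_closedBall_zero_iff]
      exact (hr1 t y).trans (by gcongr)
    · rw [dist_eq_norm, ← map_sub]
      refine (hr1 t _).trans_lt ?_
      rw [← dist_eq_norm, dist_comm]
      have := (lt_div_iff₀ (by linarith : 0 < C1)).1 hy.2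
      linarith
  have hD : ∀ t, ‖fl b (τ t - τy t) w - w‖ < ε / C := fun t => by
    have e1 := hclose t
    rw [h.eq, hτy.eq] at e1
    have e2 := hr (-τy t) (fl b (τ t) w - fl b (τy t) (g y))
    rw [map_sub, fl_neg_apply, ← fl_add_apply, show -τy t + τ t = τ t - τy t by ring] at e2
    have e3 := hclose 0
    simp only [fl_zero_apply] at e3
    have e4 := norm_sub_le_norm_sub_add_norm_sub (fl b (τ t - τy t) w) (g y) w
    rw [norm_sub_rev (g y) w] at e4
    have e5 : C * ‖fl b (τ t) w - fl b (τy t) (g y)‖ ≤ C * η := by gcongr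
    have e6 : (C + 1) * η = ε / C / 2 := by rw [hη]; field_simp
    have e7 : 0 < ε / C := by positivity
    have e8 : ‖w - g y‖ ≤ η := e3
    linarith
  refine ⟨σ, fun t => ?_⟩
  by_contra hcon
  have hcont : Continuous (fun t => |τ t - τy t|) := (h.cont.sub hτy.cont).abs
  obtain ⟨t1, ht1⟩ := mem_range_of_exists_le_of_exists_ge hcont (c := σ)
    ⟨0, by simp [h.zero, hτy.zero, hσ.le]⟩ ⟨t, (not_le.1 hcon).le⟩
  have h3 := hD t1
  simp only at ht1
  rw [lt_div_iff₀ hC0] at h3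
  rcases (abs_eq hσ.le).1 ht1 with h4 | h4 <;> rw [h4] at h3
  · rw [← hε] at h3; nlinarith
  · linarith

/-- asymptotically equal time lifts -/
def SL (a : E →L[ℝ] E) (b : F →L[ℝ] F) (g : E ≃ₜ F) (x y : E) : Prop :=
  ∀ τ τ', Lf a b g x τ → Lf a b g y τ' → ∃ K, ∀ t, |τ t - τ' t| ≤ K

lemma SL.symm {x y : E} (h : SL a b g x y) : SL a b g y x := fun τ τ' h1 h2 => by
  obtain ⟨K, hK⟩ := h τ' τ h2 h1
  exact ⟨K, fun t => by rw [abs_sub_comm]; exact hK t⟩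

lemma SL.trans (H : RE a b g) {x y z : E} (hy : a y ≠ 0) (h : SL a b g x y) (h' : SL a b g y z) :
    SL a b g x z := fun τ τ' h1 h2 => by
  obtain ⟨ρ, hρ⟩ := H.lift hy
  obtain ⟨K, hK⟩ := h τ ρ h1 hρ
  obtain ⟨K', hK'⟩ := h' ρ τ' hρ h2
  refine ⟨K + K', fun t => ?_⟩
  have := abs_sub_le (τ t) (ρ t) (τ' t)
  linarith [hK t, hK' t]

lemma RE.sl_loc (H : RE a b g) {x : E} (hx : a x ≠ 0) : ∀ᶠ y in 𝓝 x, SL a b g x y := by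
  obtain ⟨ρ, hρ⟩ := H.lift hx
  filter_upwards [H.loc hx hρ, H.loc hx hρ] with y hy _ τ τ' h1 h2
  have e : τ = ρ := by
    funext t
    have key := per_const H.rb (H.nonfix hx) (f := fun t => -τ t + ρ t) (h1.cont.neg.add hρ.cont)
      (fun t => by rw [fl_add_apply, ← hρ.eq, h1.eq, fl_neg_apply]) t
    simp only [h1.zero, hρ.zero] at key
    linarith
  rw [e]
  exact hy τ' h2

lemma RE.sl_line (H : RE a b g) {x y : E} (hl : ∀ c : ℝ, a (x + c • (y - x)) ≠ 0) : SL a b g x y := by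
  let z : ℝ → E := fun c => x + c • (y - x)
  have hz : Continuous z := by fun_prop
  have h0 : z 0 = x := by simp [z]
  have h1 : z 1 = y := by simp [z]
  have hclopen : IsClopen {c | SL a b g x (z c)} := by
    constructor
    · rw [← isOpen_compl_iff, isOpen_iff_mem_nhds]
      intro c hc
      filter_upwards [hz.continuousAt (H.sl_loc (hl c))] with c' hc' hcon
      exact hc (SL.trans H (hl c') hcon (SL.symm hc'))
    · rw [isOpen_iff_mem_nhds]
      intro c hc
      filter_upwards [hz.continuousAt (H.sl_loc (hl c))] with c' hc'
      exact SL.trans H (hl c) hc hc'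
  have hself : SL a b g x x := (H.sl_loc (x := x) (by simpa using hl 0)).self_of_nhds
  have := hclopen.eq_univ ⟨0, by simpa only [Set.mem_setOf_eq, h0] using hself⟩
  have h2 : (1:ℝ) ∈ {c | SL a b g x (z c)} := by rw [this]; trivial
  simpa [h1] using h2

lemma RE.sl_indep (H : RE a b g) {x y : E} (hl : LinearIndependent ℝ ![a x, a y]) : SL a b g x y := by
  refine H.sl_line fun c hc => ?_
  rw [LinearIndependent.pair_iff] at hl
  have := hl (1 - c) c (by
    rw [← hc, map_add, map_smul, map_sub, sub_smul, one_smul, smul_sub]; abel)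
  linarith [this.1, this.2]

lemma indep_self (ha : ceE a = ⊤) {x : E} (hx : a x ≠ 0) : LinearIndependent ℝ ![a x, a (a x)] := by
  rw [LinearIndependent.pair_iff' hx]
  intro k hk
  exact hx (rot_sq ha (rot_real ha hk.symm))

lemma RE.sl_all (H : RE a b g) {x y : E} (hx : a x ≠ 0) (hy : a y ≠ 0) : SL a b g x y := by
  by_cases hl : LinearIndependent ℝ ![a x, a y]
  · exact H.sl_indep hl
  rw [LinearIndependent.pair_iff' hx] at hl
  push Not at hl
  obtain ⟨k, hk⟩ := hl
  have hk0 : k ≠ 0 := by rintro rfl; exact hy (by rw [← hk, zero_smul])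
  have hx2 : a (a x) ≠ 0 := fun h => hx (rot_sq H.ra h)
  refine SL.trans H hx2 (H.sl_indep (indep_self H.ra hx)) (SL.symm (H.sl_indep ?_))
  have := indep_self H.ra hx
  rw [LinearIndependent.pair_iff' hx] at this
  rw [LinearIndependent.pair_iff' hy]
  intro m hm
  exact this (m * k) (by rw [mul_smul, hk, hm])

theorem RE.main (H : RE a b g) : ∃ c : ℝ, c ≠ 0 ∧ ∀ x T, fl a T x = x ↔ fl b (c * T) (g x) = g x := by
  let P : E → Prop := fun x => a x ≠ 0 ∧
    ((∃ T0, T0 ≠ 0 ∧ fl a T0 x = x) ∨ ∃ T0, T0 ≠ 0 ∧ fl b T0 (g x) = g x)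
  have hfix : ∀ x, a x = 0 → ∀ (c T : ℝ), fl a T x = x ↔ fl b (c * T) (g x) = g x := by
    intro x hx c T
    have hgx : b (g x) = 0 := by
      by_contra hne
      have := H.symm.nonfix hne
      rw [g.symm_apply_apply] at this
      exact this hx
    simp [fl_fix hx, fl_fix hgx]
  have hnP : ∀ x, a x ≠ 0 → ¬ P x → ∀ (c T : ℝ), c ≠ 0 → (fl a T x = x ↔ fl b (c * T) (g x) = g x) := by
    intro x hx hP c T hc
    by_cases hT : T = 0
    · simp [hT]
    · refine ⟨fun h => absurd ⟨hx, Or.inl ⟨T, hT, h⟩⟩ hP, fun h => absurd ⟨hx, Or.inr ⟨_, mul_ne_zero hc hT, h⟩⟩ hP⟩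
  by_cases hex : ∃ x, P x
  · obtain ⟨x0, hx0, hp0⟩ := hex
    obtain ⟨τ0, h0⟩ := H.lift hx0
    obtain ⟨c, K, hc, hK, -⟩ := H.rot2 hx0 h0 hp0
    refine ⟨c, hc, fun x T => ?_⟩
    by_cases hx : a x = 0
    · exact hfix x hx c T
    by_cases hP : P x
    · obtain ⟨τ, h⟩ := H.lift hx
      obtain ⟨c', K', hc', hK', hiff⟩ := H.rot2 hx h hP.2
      obtain ⟨M, hM⟩ := H.sl_all hx0 hx τ0 τ h0 h
      have : c - c' = 0 := lin_bdd (K := K + M + K') fun t => by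
        rw [show (c - c') * t = (-(τ0 t - c * t)) + (τ0 t - τ t) + (τ t - c' * t) by ring]
        refine (abs_add_three _ _ _).trans ?_
        rw [abs_neg]
        linarith [hK t, hK' t, hM t]
      rw [sub_eq_zero.1 this]
      exact hiff T
    · exact hnP x hx hP c T hc
  · refine ⟨1, one_ne_zero, fun x T => ?_⟩
    by_cases hx : a x = 0
    · exact hfix x hx 1 T
    · exact hnP x hx (fun h => hex ⟨x, h⟩) 1 T one_ne_zero

end RotNum


section LinAlg
open Polynomial
variable {V : Type*} [AddCommGroup V] [Module ℝ V] [FiniteDimensional ℝ V]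

/-- the irreducible polynomial with roots `±iω` -/
def pw (ω : ℝ) : ℝ[X] := if ω = 0 then X else X ^ 2 + C (ω ^ 2)

lemma pw_monic (ω : ℝ) : (pw ω).Monic := by
  unfold pw; split_ifs
  · exact monic_X
  · exact monic_X_pow_add_C _ two_ne_zero

lemma pw_eval (ω : ℝ) : (pw ω).eval 0 = ω ^ 2 := by
  unfold pw; split_ifs with h <;> simp [h]

lemma pw_irred (ω : ℝ) : Irreducible (pw ω) := by
  have hm := pw_monic ω
  unfold pw at hm ⊢; split_ifs with h
  · exact irreducible_X
  · rw [if_neg h] at hm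
    have hd : (X ^ 2 + C (ω ^ 2) : ℝ[X]).natDegree = 2 := natDegree_X_pow_add_C
    rw [hm.irreducible_iff_roots_eq_zero_of_degree_le_three (by omega) (by omega)]
    rw [Multiset.eq_zero_iff_forall_notMem]
    intro x hx
    have := isRoot_of_mem_roots hx
    simp only [IsRoot.def, eval_add, eval_pow, eval_X, eval_C] at this
    have : 0 < ω ^ 2 := by positivity
    nlinarith [sq_nonneg x]

lemma coprime_or_eq {p q : ℝ[X]} (hp : p.Monic) (hp' : Irreducible p) (hq : q.Monic)
    (hq' : Irreducible q) : IsCoprime p q ∨ p = q := by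
  rw [or_iff_not_imp_left, hp'.coprime_iff_not_dvd, not_not]
  intro h
  exact eq_of_monic_of_associated hp hq (hp'.associated_of_dvd hq' h)

lemma pw_coprime {ω ω' : ℝ} (h : 0 ≤ ω) (h' : 0 ≤ ω') (hne : ω ≠ ω') :
    IsCoprime (pw ω) (pw ω') := by
  refine (coprime_or_eq (pw_monic _) (pw_irred _) (pw_monic _) (pw_irred _)).resolve_right ?_
  intro e
  have := congrArg (eval 0) e
  rw [pw_eval, pw_eval] at this
  exact hne ((sq_eq_sq₀ h h').1 this)

/-- linear version of a central Jordan decomposition -/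
structure CL (a s n : V →ₗ[ℝ] V) (Ω : Finset ℝ) : Prop where
  add : a = s + n
  comm : Commute s n
  nil : ∃ N, n ^ N = 0
  pos : ∀ ω ∈ Ω, 0 ≤ ω
  ann : aeval s (∏ ω ∈ Ω, pw ω) = 0

variable {a s n : V →ₗ[ℝ] V} {Ω : Finset ℝ}

lemma CL.mono (H : CL a s n Ω) {Ω' : Finset ℝ} (h : Ω ⊆ Ω') (h' : ∀ ω ∈ Ω', 0 ≤ ω) :
    CL a s n Ω' := by
  refine ⟨H.add, H.comm, H.nil, h', ?_⟩
  rw [← Finset.prod_sdiff h, map_mul, H.ann, mul_zero]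

lemma aeval_mul_apply' (p q : ℝ[X]) (x : V) : aeval s (p * q) x = aeval s p (aeval s q x) := by
  rw [map_mul]; rfl

lemma bez {p q : ℝ[X]} (h : IsCoprime p q) : ∃ u v : ℝ[X], ∀ x : V,
    aeval s u (aeval s p x) + aeval s v (aeval s q x) = x := by
  obtain ⟨u, v, huv⟩ := h
  refine ⟨u, v, fun x => ?_⟩
  rw [← aeval_mul_apply', ← aeval_mul_apply', ← LinearMap.add_apply, ← map_add, huv, map_one]
  rfl

lemma aeval_swap (p q : ℝ[X]) (x : V) : aeval s p (aeval s q x) = aeval s q (aeval s p x) := by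
  rw [← aeval_mul_apply', mul_comm, aeval_mul_apply']

lemma mem_aeval {Y : Submodule ℝ V} (hY : ∀ x ∈ Y, s x ∈ Y) (p : ℝ[X]) {x : V} (hx : x ∈ Y) :
    aeval s p x ∈ Y := by
  induction p using Polynomial.induction_on' with
  | add p q hp hq => rw [map_add]; exact Y.add_mem hp hq
  | monomial k c =>
    rw [aeval_monomial]
    have : ∀ k : ℕ, (s ^ k) x ∈ Y := by
      intro k
      induction k with
      | zero => exact hx
      | succ k ih => rw [pow_succ']; exact hY _ ih
    exact Y.smul_mem c (this k)

lemma finrank_ker_mul {Y : Submodule ℝ V} (hY : ∀ x ∈ Y, s x ∈ Y) {p q : ℝ[X]}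
    (h : IsCoprime p q) : Module.finrank ℝ (Y ⊓ (aeval s (p * q)).ker : Submodule ℝ V) =
      Module.finrank ℝ (Y ⊓ (aeval s p).ker : Submodule ℝ V) +
      Module.finrank ℝ (Y ⊓ (aeval s q).ker : Submodule ℝ V) := by
  obtain ⟨u, v, huv⟩ := bez (s := s) h
  have h1 : (Y ⊓ (aeval s (p * q)).ker : Submodule ℝ V) =
      (Y ⊓ (aeval s p).ker) ⊔ (Y ⊓ (aeval s q).ker) := by
    ext x
    simp only [Submodule.mem_sup, Submodule.mem_inf, LinearMap.mem_ker]
    constructor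
    · rintro ⟨hx, hx0⟩
      rw [aeval_mul_apply'] at hx0
      refine ⟨aeval s v (aeval s q x), ⟨mem_aeval hY _ (mem_aeval hY _ hx), ?_⟩,
        aeval s u (aeval s p x), ⟨mem_aeval hY _ (mem_aeval hY _ hx), ?_⟩, ?_⟩
      · rw [aeval_swap, hx0, map_zero]
      · rw [aeval_swap, aeval_swap q p, hx0, map_zero]
      · rw [add_comm]; exact huv x
    · rintro ⟨y, ⟨hy, hy0⟩, z, ⟨hz, hz0⟩, rfl⟩
      refine ⟨Y.add_mem hy hz, ?_⟩
      rw [aeval_mul_apply', map_add, map_add, hz0, map_zero, add_zero, aeval_swap, hy0,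
        map_zero]
  have h2 : (Y ⊓ (aeval s p).ker) ⊓ (Y ⊓ (aeval s q).ker) = ⊥ := by
    rw [eq_bot_iff]
    rintro x ⟨⟨_, hx⟩, ⟨_, hx'⟩⟩
    have := huv x
    rw [LinearMap.mem_ker.1 hx, LinearMap.mem_ker.1 hx'] at this
    simpa using this.symm
  have h3 := Submodule.finrank_sup_add_finrank_inf_eq (Y ⊓ (aeval s p).ker) (Y ⊓ (aeval s q).ker)
  rw [h2, finrank_bot, add_zero] at h3
  rw [h1, h3]

lemma finrank_ker_prod {Y : Submodule ℝ V} (hY : ∀ x ∈ Y, s x ∈ Y) (hΩ : ∀ ω ∈ Ω, 0 ≤ ω) :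
    Module.finrank ℝ (Y ⊓ (aeval s (∏ ω ∈ Ω, pw ω)).ker : Submodule ℝ V) =
      ∑ ω ∈ Ω, Module.finrank ℝ (Y ⊓ (aeval s (pw ω)).ker : Submodule ℝ V) := by
  induction Ω using Finset.induction_on with
  | empty =>
    have : (Y ⊓ (aeval s (∏ ω ∈ (∅ : Finset ℝ), pw ω)).ker : Submodule ℝ V) = ⊥ := by
      rw [eq_bot_iff]
      rintro x ⟨_, hx⟩
      simpa using hx
    rw [this]; simp
  | insert ω Ω hω ih =>
    rw [Finset.prod_insert hω, Finset.sum_insert hω, finrank_ker_mul hY,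
      ih fun w hw => hΩ w (Finset.mem_insert_of_mem hw)]
    refine IsCoprime.prod_right fun w hw => pw_coprime (hΩ _ (Finset.mem_insert_self _ _))
      (hΩ _ (Finset.mem_insert_of_mem hw)) ?_
    rintro rfl; exact hω hw

lemma CL.finrank_eq (H : CL a s n Ω) {Y : Submodule ℝ V} (hY : ∀ x ∈ Y, s x ∈ Y) :
    Module.finrank ℝ Y = ∑ ω ∈ Ω, Module.finrank ℝ (Y ⊓ (aeval s (pw ω)).ker : Submodule ℝ V) := by
  rw [← finrank_ker_prod hY H.pos, H.ann, LinearMap.ker_zero, inf_top_eq]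

lemma CL.inj_of_coprime (H : CL a s n Ω) {p : ℝ[X]} (hp : ∀ ω ∈ Ω, IsCoprime p (pw ω)) {x : V}
    (hx : aeval s p x = 0) : x = 0 := by
  obtain ⟨u, v, huv⟩ := bez (s := s) (IsCoprime.prod_right hp)
  have := huv x
  rw [hx, H.ann] at this
  simpa using this.symm

lemma CL.inj_of_notMem (H : CL a s n Ω) {ω : ℝ} (h0 : 0 ≤ ω) (hω : ω ∉ Ω) {x : V}
    (hx : aeval s (pw ω) x = 0) : x = 0 :=
  H.inj_of_coprime (fun w hw => pw_coprime h0 (H.pos w hw) (by rintro rfl; exact hω hw)) hx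

lemma CL.ss (H : CL a s n Ω) {ω : ℝ} (h0 : 0 ≤ ω) {x : V}
    (hx : aeval s (pw ω) (aeval s (pw ω) x) = 0) : aeval s (pw ω) x = 0 := by
  by_cases hω : ω ∈ Ω
  · have hc : IsCoprime (pw ω) (∏ w ∈ Ω.erase ω, pw w) := IsCoprime.prod_right fun w hw =>
      pw_coprime h0 (H.pos w (Finset.mem_of_mem_erase hw)) (Finset.ne_of_mem_erase hw).symm
    obtain ⟨u, v, huv⟩ := bez (s := s) hc
    have h1 := huv (aeval s (pw ω) x)
    rw [hx, map_zero, zero_add, aeval_swap (∏ w ∈ Ω.erase ω, pw w), ← aeval_mul_apply' (pw ω),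
      Finset.mul_prod_erase Ω pw hω, H.ann] at h1
    simpa using h1.symm
  · exact H.inj_of_notMem h0 hω hx

lemma aeval_eq_of_ker (hc : Commute s n) {x : V} (hx : n x = 0) (p : ℝ[X]) :
    aeval (s + n) p x = aeval s p x := by
  induction p using Polynomial.induction_on' with
  | add p q hp hq => rw [map_add, map_add, LinearMap.add_apply, LinearMap.add_apply, hp, hq]
  | monomial k c =>
    rw [aeval_monomial, aeval_monomial]
    have : ∀ k : ℕ, ((s + n) ^ k) x = (s ^ k) x := by
      intro k
      induction k with
      | zero => rfl
      | succ k ih =>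
        have h1 : n ((s ^ k) x) = 0 := by
          have := congrArg (fun f : V →ₗ[ℝ] V => f x) (hc.pow_left k).eq
          simp only [Module.End.mul_apply, hx, map_zero] at this
          exact this.symm
        rw [pow_succ', pow_succ', Module.End.mul_apply, ih, LinearMap.add_apply, h1, add_zero]; rfl
    simp only [Module.End.mul_apply, this]

/-- an invariant subspace meeting `ker n` trivially is trivial -/
lemma nil_triv (hn : ∃ N, n ^ N = 0) {K : Submodule ℝ V} (hK : ∀ x ∈ K, n x ∈ K)
    (h : ∀ x ∈ K, n x = 0 → x = 0) {x : V} (hx : x ∈ K) : x = 0 := by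
  obtain ⟨N, hN⟩ := hn
  have : ∀ k : ℕ, ∀ x ∈ K, (n ^ k) x = 0 → x = 0 := by
    intro k
    induction k with
    | zero => intro x _ h; exact h
    | succ k ih =>
      intro x hx h1
      rw [pow_succ] at h1
      exact h x hx (ih _ (hK x hx) h1)
  exact this N x hx (by rw [hN]; rfl)

lemma comm_aeval {f : V →ₗ[ℝ] V} (h : Commute s f) (p : ℝ[X]) (x : V) :
    aeval s p (f x) = f (aeval s p x) := by
  have : Commute (aeval s p) f := by
    induction p using Polynomial.induction_on' with
    | add p q hp hq => rw [map_add]; exact hp.add_left hq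
    | monomial k c =>
      rw [aeval_monomial]
      exact Commute.mul_left (Algebra.commutes c f) (h.pow_left k)
  exact congrArg (fun f : V →ₗ[ℝ] V => f x) this.eq

lemma CL.comm_a (H : CL a s n Ω) : Commute a n := by
  rw [H.add]; exact H.comm.add_left (Commute.refl n)

lemma CL.comm_as (H : CL a s n Ω) : Commute a s := by
  rw [H.add]; exact (Commute.refl s).add_left H.comm.symm

/-- `ker n ⊓ range n^k` -/
def FL (n : V →ₗ[ℝ] V) (k : ℕ) : Submodule ℝ V := n.ker ⊓ (n ^ k).range

lemma mem_FL {k : ℕ} {x : V} : x ∈ FL n k ↔ n x = 0 ∧ ∃ y, (n ^ k) y = x := Iff.rfl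

lemma CL.inj_ap (H : CL a s n Ω) {p : ℝ[X]} (K : Submodule ℝ V) (hK : ∀ x ∈ K, n x ∈ K)
    (h : ∀ x ∈ K, aeval s p x = 0 → x = 0) {x : V} (hx : x ∈ K) (hp : aeval a p x = 0) : x = 0 := by
  refine nil_triv H.nil (K := K ⊓ (aeval a p).ker) ?_ ?_ ⟨hx, hp⟩
  · rintro x ⟨hx, hx'⟩
    refine ⟨hK x hx, ?_⟩
    have hx2 : aeval a p x = 0 := hx'
    change aeval a p (n x) = 0
    rw [comm_aeval H.comm_a, hx2, map_zero]
  · rintro x ⟨hx, hx'⟩ hn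
    have : aeval a p x = 0 := hx'
    rw [H.add, aeval_eq_of_ker H.comm hn] at this
    exact h x hx this

lemma CL.uexists (H : CL a s n Ω) {ω : ℝ} (h0 : 0 ≤ ω) : ∃ u : V →ₗ[ℝ] V, Commute s u ∧ Commute n u ∧
    aeval a (pw ω) = aeval s (pw ω) + n * u ∧ ∀ x, aeval s (pw ω) x = 0 → n x = 0 → u x = 0 → x = 0 := by
  by_cases hω : ω = 0
  · refine ⟨1, Commute.one_right _, Commute.one_right _, ?_, fun x _ _ h => h⟩
    simp [pw, hω, H.add]
  · refine ⟨s + s + n, ((Commute.refl s).add_right (Commute.refl s)).add_right H.comm,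
      (H.comm.symm.add_right H.comm.symm).add_right (Commute.refl n), ?_, ?_⟩
    · simp only [pw, hω, if_false, map_add, map_pow, aeval_X, aeval_C, H.add]
      have := H.comm.eq
      rw [pow_two (s + n), pow_two s, add_mul, mul_add, mul_add, mul_add, mul_add, this]
      abel
    · intro x h1 h2 h3
      simp only [LinearMap.add_apply, h2, add_zero] at h3
      have h4 : s x = 0 := by
        rw [← two_smul ℝ] at h3
        exact (smul_eq_zero.1 h3).resolve_left two_ne_zero
      simp only [pw, hω, if_false, map_add, map_pow, aeval_X, aeval_C, LinearMap.add_apply, pow_two s,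
        Module.End.mul_apply, h4, map_zero, zero_add] at h1
      rw [← map_pow, Module.algebraMap_end_apply] at h1
      have h5 : ω ^ 2 ≠ 0 := by positivity
      exact (smul_eq_zero.1 h1).resolve_left h5

lemma ker_range_decomp {q : V →ₗ[ℝ] V} (h : ∀ x, q (q x) = 0 → q x = 0) (x : V) :
    ∃ v w, q v = 0 ∧ x = v + q w := by
  have hd : Disjoint q.ker q.range := by
    rw [Submodule.disjoint_def]
    rintro _ h1 ⟨y, rfl⟩
    exact h y h1
  have h3 := Submodule.finrank_sup_add_finrank_inf_eq q.ker q.range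
  rw [hd.eq_bot, finrank_bot, add_zero, add_comm (Module.finrank ℝ q.ker), q.finrank_range_add_finrank_ker] at h3
  have : q.ker ⊔ q.range = ⊤ := Submodule.eq_top_of_finrank_eq h3
  have hx : x ∈ q.ker ⊔ q.range := by rw [this]; trivial
  obtain ⟨v, hv, _, ⟨w, rfl⟩, e⟩ := Submodule.mem_sup.1 hx
  exact ⟨v, w, hv, e.symm⟩

lemma comm_pow_apply {f g : V →ₗ[ℝ] V} (h : Commute f g) (k : ℕ) (x : V) :
    (f ^ k) (g x) = g ((f ^ k) x) :=
  congrArg (fun f : V →ₗ[ℝ] V => f x) (h.pow_left k).eq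

lemma CL.Gs_eq (H : CL a s n Ω) {ω : ℝ} (h0 : 0 ≤ ω) (k : ℕ) :
    ((aeval a (pw ω)).ker ⊓ (aeval a (pw ω) ^ k).range : Submodule ℝ V) =
      FL n k ⊓ (aeval s (pw ω)).ker := by
  obtain ⟨u, hsu, hnu, hau, hu⟩ := H.uexists h0
  set P := aeval a (pw ω) with hP
  set q := aeval s (pw ω) with hq
  have hqn : Commute q n := LinearMap.ext fun x => comm_aeval H.comm _ x
  have hqu : Commute q u := LinearMap.ext fun x => comm_aeval hsu _ x
  have hPn : Commute P n := LinearMap.ext fun x => comm_aeval H.comm_a _ x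
  have hPq : Commute P q := by
    rw [hau]; exact (Commute.refl q).add_left (hqn.symm.mul_left hqu.symm)
  have ap {f g : V →ₗ[ℝ] V} (h : Commute f g) (x : V) : f (g x) = g (f x) :=
    congrArg (fun f : V →ₗ[ℝ] V => f x) h.eq
  have hss : ∀ x, q (q x) = 0 → q x = 0 := fun x => H.ss h0
  -- P is injective on the range of q
  have hPW : ∀ x, P (q x) = 0 → q x = 0 := by
    intro x hx
    refine H.inj_ap (p := pw ω) q.range ?_ ?_ ⟨x, rfl⟩ hx
    · rintro _ ⟨y, rfl⟩; exact ⟨n y, ap hqn y⟩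
    · rintro _ ⟨y, rfl⟩ h; exact hss y h
  have hPkW : ∀ k x, q ((P ^ k) (q x)) = 0 → q x = 0 := by
    intro k
    induction k with
    | zero => intro x hx; exact hss x hx
    | succ k ih =>
      intro x hx
      rw [pow_succ] at hx
      have hx' : q ((P ^ k) (P (q x))) = 0 := hx
      rw [ap hPq] at hx'
      have := ih _ hx'
      rw [← ap hPq] at this
      exact hPW _ this
  -- on the kernel of q
  have hPV : ∀ v, q v = 0 → P v = n (u v) := by
    intro v hv; rw [hau]; simp [hv]
  have hPkV : ∀ k v, q v = 0 → (P ^ k) v = (n ^ k) ((u ^ k) v) := by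
    intro k
    induction k with
    | zero => intro v _; rfl
    | succ k ih =>
      intro v hv
      rw [pow_succ, Module.End.mul_apply, hPV v hv,
        ih _ (by rw [ap hqn, ap hqu, hv, map_zero, map_zero]), comm_pow_apply hnu.symm,
        pow_succ n, pow_succ u]
      rfl
  have huV : ∀ v, q v = 0 → u v = 0 → v = 0 := by
    intro v hv huv
    refine nil_triv H.nil (K := q.ker ⊓ u.ker) ?_ ?_ ⟨hv, huv⟩
    · rintro x ⟨h1, h2⟩
      have h1' : q x = 0 := h1
      have h2' : u x = 0 := h2
      exact ⟨show q (n x) = 0 by rw [ap hqn, h1', map_zero],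
        show u (n x) = 0 by rw [← ap hnu, h2', map_zero]⟩
    · rintro x ⟨h1, h2⟩ h3
      exact hu x h1 h3 h2
  have husurj : ∀ v, q v = 0 → ∃ v', q v' = 0 ∧ u v' = v := by
    let U : q.ker →ₗ[ℝ] q.ker := u.restrict (fun x hx => by
      rw [LinearMap.mem_ker, ap hqu, LinearMap.mem_ker.1 hx, map_zero])
    have hU : Function.Injective U := by
      rw [injective_iff_map_eq_zero]
      rintro ⟨x, hx⟩ h
      have h' : u x = 0 := congrArg Subtype.val h
      exact Subtype.ext (huV x hx h')
    intro v hv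
    obtain ⟨⟨w, hw⟩, h⟩ := LinearMap.injective_iff_surjective.1 hU ⟨v, hv⟩
    exact ⟨w, hw, congrArg Subtype.val h⟩
  have hukS : ∀ k v, q v = 0 → ∃ v', q v' = 0 ∧ (u ^ k) v' = v := by
    intro k
    induction k with
    | zero => intro v hv; exact ⟨v, hv, rfl⟩
    | succ k ih =>
      intro v hv
      obtain ⟨v1, h1, rfl⟩ := ih v hv
      obtain ⟨v2, h2, rfl⟩ := husurj v1 h1
      exact ⟨v2, h2, by rw [pow_succ]; rfl⟩
  have hqnk (k : ℕ) (x : V) : q ((n ^ k) x) = (n ^ k) (q x) := (comm_pow_apply hqn.symm k x).symm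
  ext x
  simp only [Submodule.mem_inf, LinearMap.mem_ker, LinearMap.mem_range, mem_FL]
  constructor
  · rintro ⟨hx, y, hy⟩
    have hqx : q x = 0 := by
      obtain ⟨v, w, hv, e⟩ := ker_range_decomp hss x
      have h1 : P (q (q w)) = 0 := by
        have := congrArg q e
        rw [map_add, hv, zero_add] at this
        rw [← this, ap hPq, hx, map_zero]
      have h2 := hPW _ h1
      have h3 := hss _ h2
      rw [e, h3, add_zero, hv]
    obtain ⟨v, w, hv, e⟩ := ker_range_decomp hss y
    have hw : q w = 0 := by
      apply hPkW k w
      have h1 : (P ^ k) (q w) = x - (P ^ k) v := by rw [← hy, e, map_add]; abel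
      rw [h1, map_sub, hqx, ← comm_pow_apply hPq, hv, map_zero, sub_zero]
    rw [e, hw, add_zero, hPkV k v hv] at hy
    refine ⟨⟨?_, _, hy⟩, hqx⟩
    have := hPV x hqx
    rw [hx, ap hnu] at this
    exact huV _ (by rw [ap hqn, hqx, map_zero]) this.symm
  · rintro ⟨⟨hn, y, hy⟩, hqx⟩
    refine ⟨by rw [hPV x hqx, ap hnu, hn, map_zero], ?_⟩
    obtain ⟨v, w, hv, e⟩ := ker_range_decomp hss y
    have h1 : (n ^ k) (q w) = 0 := by
      have h2 : q (q ((n ^ k) w)) = 0 := by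
        have := congrArg q hy
        rw [e, map_add, map_add, hqnk, hv, map_zero, zero_add, hqx, ← hqnk] at this
        exact this
      have := hss _ h2
      rwa [hqnk] at this
    rw [e, map_add, h1, add_zero] at hy
    obtain ⟨v', hv', rfl⟩ := hukS k v hv
    exact ⟨v', by rw [hPkV k v' hv', hy]⟩

lemma CL.sim {W : Type*} [AddCommGroup W] [Module ℝ W] [FiniteDimensional ℝ W]
    {b s' n' : W →ₗ[ℝ] W} {Ω' : Finset ℝ} (H : CL a s n Ω) (H' : CL b s' n' Ω')
    (h : ∀ k : ℕ, ∀ ω : ℝ, 0 ≤ ω → Module.finrank ℝ (FL n k ⊓ (aeval s (pw ω)).ker : Submodule ℝ V) =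
      Module.finrank ℝ (FL n' k ⊓ (aeval s' (pw ω)).ker : Submodule ℝ W)) :
    ∃ Q : V ≃ₗ[ℝ] W, ∀ x, Q (a x) = b (Q x) := by
  refine similar_of_finrank a b fun p hm hp k => ?_
  by_cases hω : ∃ ω, 0 ≤ ω ∧ p = pw ω
  · obtain ⟨ω, h0, rfl⟩ := hω
    rw [H.Gs_eq h0, H'.Gs_eq h0, h k ω h0]
  · push Not at hω
    have e1 : (aeval a p).ker = ⊥ := by
      rw [eq_bot_iff]
      intro x hx
      refine H.inj_ap ⊤ (fun _ _ => trivial) (fun x _ h => ?_) (x := x) trivial hx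
      exact H.inj_of_coprime (fun ω hw => (coprime_or_eq hm hp (pw_monic ω) (pw_irred ω)).resolve_right
        (hω ω (H.pos ω hw))) h
    have e2 : (aeval b p).ker = ⊥ := by
      rw [eq_bot_iff]
      intro x hx
      refine H'.inj_ap ⊤ (fun _ _ => trivial) (fun x _ h => ?_) (x := x) trivial hx
      exact H'.inj_of_coprime (fun ω hw => (coprime_or_eq hm hp (pw_monic ω) (pw_irred ω)).resolve_right
        (hω ω (H'.pos ω hw))) h
    rw [e1, e2, bot_inf_eq, bot_inf_eq, finrank_bot, finrank_bot]

open Classical in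
/-- counting along multiples determines the multiplicities -/
lemma count_mult {Ω : Finset ℝ} (hΩ : ∀ ω ∈ Ω, 0 ≤ ω) (f g : ℝ → ℕ) (h0 : f 0 = g 0)
    (h : ∀ w > 0, ∑ ω ∈ Ω, (if ∃ k : ℕ, ω = (k : ℝ) * w then f ω else 0) =
      ∑ ω ∈ Ω, (if ∃ k : ℕ, ω = (k : ℝ) * w then g ω else 0)) :
    ∀ ω ∈ Ω, f ω = g ω := by
  by_contra hcon
  push Not at hcon
  obtain ⟨ω1, hω1, hne1⟩ := hcon
  obtain ⟨w, hw, hmax⟩ := Finset.exists_max_image (Ω.filter fun ω => f ω ≠ g ω) id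
    ⟨ω1, by simp [hω1, hne1]⟩
  rw [Finset.mem_filter] at hw
  have hwpos : 0 < w := lt_of_le_of_ne (hΩ w hw.1) (by rintro rfl; exact hw.2 h0)
  have h1 := h w hwpos
  rw [← Finset.add_sum_erase _ _ hw.1, ← Finset.add_sum_erase (a := w) _ _ hw.1] at h1
  rw [if_pos ⟨1, by simp⟩, if_pos ⟨1, by simp⟩] at h1
  have h2 : ∑ ω ∈ Ω.erase w, (if ∃ k : ℕ, ω = (k : ℝ) * w then f ω else 0) =
      ∑ ω ∈ Ω.erase w, (if ∃ k : ℕ, ω = (k : ℝ) * w then g ω else 0) := by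
    refine Finset.sum_congr rfl fun x hx => ?_
    rw [Finset.mem_erase] at hx
    split_ifs with hk
    · obtain ⟨k, rfl⟩ := hk
      by_contra hne
      have hle := hmax (k * w) (by rw [Finset.mem_filter]; exact ⟨hx.2, hne⟩)
      simp only [id] at hle
      have hk : (k : ℝ) ≤ 1 := by
        by_contra hk
        push Not at hk
        nlinarith
      have hk' : k ≤ 1 := by exact_mod_cast hk
      interval_cases k
      · simp [h0] at hne
      · simp at hx
    · rfl
  have := hw.2
  omega

end LinAlg


section CentralMain
open Polynomial
variable {E : Type*} [NormedAddCommGroup E] [NormedSpace ℝ E] [FiniteDimensional ℝ E]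
  [CompleteSpace E] {a s n : E →L[ℝ] E}
variable {F : Type*} [NormedAddCommGroup F] [NormedSpace ℝ F] [FiniteDimensional ℝ F]
  [CompleteSpace F] {b s' n' : F →L[ℝ] F}

lemma pw_apply (ω : ℝ) (hω : ω ≠ 0) (x : E) :
    aeval (s : E →ₗ[ℝ] E) (pw ω) x = s (s x) + ω ^ 2 • x := by
  simp only [pw, hω, if_false, map_add, aeval_X_pow, aeval_C, LinearMap.add_apply,
    Module.algebraMap_end_apply, pow_two (s : E →ₗ[ℝ] E), Module.End.mul_apply]
  rfl

lemma pw_apply_zero (x : E) : aeval (s : E →ₗ[ℝ] E) (pw 0) x = s x := by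
  simp [pw]

lemma eig_of_pw {ω : ℝ} {x : E} (h : aeval (s : E →ₗ[ℝ] E) (pw ω) x = 0) :
    ∃ y, IsEig s 0 ω x y := by
  by_cases hω : ω = 0
  · subst hω
    rw [pw_apply_zero] at h
    exact ⟨0, by simp [IsEig, h]⟩
  · rw [pw_apply ω hω] at h
    refine ⟨ω⁻¹ • s x, ?_, ?_⟩
    · rw [smul_smul, mul_inv_cancel₀ hω]; simp
    · rw [map_smul, eq_neg_of_add_eq_zero_left h, smul_neg, smul_smul]
      simp only [zero_smul, zero_sub]
      congr 2
      field_simp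

lemma pw_of_eig {ω : ℝ} {x y : E} (h : IsEig s 0 ω x y) :
    aeval (s : E →ₗ[ℝ] E) (pw ω) x = 0 := by
  obtain ⟨h1, h2⟩ := h
  by_cases hω : ω = 0
  · subst hω
    rw [pw_apply_zero, h1]; simp
  · rw [pw_apply ω hω, h1]
    simp only [zero_smul, zero_add, map_smul, h2, zero_sub, smul_neg, smul_smul, pow_two]
    abel

lemma ann_ceE {x : E} (hx : x ∈ ceE s) : ∃ Ω : Finset ℝ, (∀ ω ∈ Ω, 0 ≤ ω) ∧
    aeval (s : E →ₗ[ℝ] E) (∏ ω ∈ Ω, pw ω) x = 0 := by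
  classical
  unfold ceE at hx
  induction hx using Submodule.span_induction with
  | mem x hx =>
    obtain ⟨β, y, hβ, h⟩ := hx
    exact ⟨{β}, by simpa using hβ, by simpa using pw_of_eig h⟩
  | zero => exact ⟨∅, by simp, map_zero _⟩
  | add x y _ _ h1 h2 =>
    obtain ⟨Ω, h3, h4⟩ := h1
    obtain ⟨Ω', h3', h4'⟩ := h2
    refine ⟨Ω ∪ Ω', fun ω hω => (Finset.mem_union.1 hω).elim (h3 ω) (h3' ω), ?_⟩
    rw [map_add]
    nth_rw 1 [← Finset.prod_sdiff (Finset.subset_union_left (s₁ := Ω) (s₂ := Ω'))]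
    nth_rw 1 [← Finset.prod_sdiff (Finset.subset_union_right (s₁ := Ω) (s₂ := Ω'))]
    rw [aeval_mul_apply', aeval_mul_apply', h4, h4', map_zero, map_zero, add_zero]
  | smul c x _ h =>
    obtain ⟨Ω, h3, h4⟩ := h
    exact ⟨Ω, h3, by rw [map_smul, h4, smul_zero]⟩

lemma Cen.toCL (H : Cen a s n) : ∃ Ω, CL (a : E →ₗ[ℝ] E) s n Ω := by
  classical
  have hx : ∀ x : E, x ∈ ceE s := fun x => by rw [H.spn]; trivial
  choose Ω h1 h2 using fun x : E => ann_ceE (hx x)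
  let B := Module.finBasis ℝ E
  refine ⟨Finset.univ.biUnion fun i => Ω (B i), ?_, ?_, ?_, ?_, ?_⟩
  · rw [H.add]; rfl
  · have := H.comm.eq
    exact LinearMap.ext fun x => congrArg (fun f : E →L[ℝ] E => f x) this
  · obtain ⟨N, hN⟩ := H.nil
    refine ⟨N, ?_⟩
    rw [← ContinuousLinearMap.toLinearMap_pow, hN]; rfl
  · intro ω hω
    obtain ⟨i, _, hi⟩ := Finset.mem_biUnion.1 hω
    exact h1 _ _ hi
  · refine B.ext fun i => ?_
    rw [← Finset.prod_sdiff (Finset.subset_biUnion_of_mem (fun i => Ω (B i)) (Finset.mem_univ i)),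
      aeval_mul_apply', h2, map_zero]; rfl

/-- points of period `T` -/
def Per (a : E →L[ℝ] E) (T : ℝ) : Submodule ℝ E where
  carrier := {x | fl a T x = x}
  zero_mem' := map_zero _
  add_mem' := fun {x y} hx hy => by
    have hx' : fl a T x = x := hx
    have hy' : fl a T y = y := hy
    change fl a T (x + y) = x + y
    rw [map_add, hx', hy']
  smul_mem' := fun c x hx => by
    have hx' : fl a T x = x := hx
    change fl a T (c • x) = c • x
    rw [map_smul, hx']

lemma mem_Per {T : ℝ} {x : E} : x ∈ Per a T ↔ fl a T x = x := Iff.rfl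

lemma per_eig {ω w : ℝ} (h0 : 0 ≤ ω) (hw : 0 < w) {x y : E} (h : IsEig s 0 ω x y) (hx : x ≠ 0)
    (hT : fl s (2 * Real.pi / w) x = x) : ∃ k : ℕ, ω = (k : ℝ) * w := by
  by_cases hω : ω = 0
  · exact ⟨0, by simp [hω]⟩
  rw [fl_eig h] at hT
  set θ := ω * (2 * Real.pi / w) with hθ
  simp only [zero_mul, Real.exp_zero, one_smul] at hT
  have h2 := congrArg s hT
  simp only [map_add, map_smul, h.1, h.2, zero_smul, zero_add, zero_sub] at h2
  have h3 : Real.cos θ • y - Real.sin θ • x = y := by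
    have : ω • (Real.cos θ • y - Real.sin θ • x) = ω • y := by
      rw [← h2, smul_sub, smul_smul, smul_smul, smul_smul, smul_neg, smul_smul, mul_comm ω, mul_comm ω]
      abel
    exact smul_right_injective E hω this
  have h4 : ((Real.cos θ - 1) ^ 2 + Real.sin θ ^ 2) • x = 0 := by
    have e : ((Real.cos θ - 1) ^ 2 + Real.sin θ ^ 2) • x =
        (Real.cos θ - 1) • ((Real.cos θ • x + Real.sin θ • y) - x)
        - Real.sin θ • ((Real.cos θ • y - Real.sin θ • x) - y) := by module
    rw [e, h3, hT]; simp
  have h5 := (smul_eq_zero.1 h4).resolve_right hx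
  have h6 : Real.cos θ = 1 := by nlinarith [sq_nonneg (Real.cos θ - 1), sq_nonneg (Real.sin θ)]
  obtain ⟨m, hm⟩ := (Real.cos_eq_one_iff _).1 h6
  have h7 : (m : ℝ) * w = ω := by
    rw [hθ] at hm
    have := Real.pi_pos
    field_simp at hm
    linarith
  have h8 : 0 ≤ m := by
    by_contra hneg
    push Not at hneg
    have : (m : ℝ) < 0 := by exact_mod_cast hneg
    nlinarith
  lift m to ℕ using h8
  exact ⟨m, by rw [← h7]; simp⟩

lemma per_eig' {w : ℝ} (hw : 0 < w) {x y : E} (k : ℕ) (h : IsEig s 0 (k * w) x y) :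
    fl s (2 * Real.pi / w) x = x := by
  rw [fl_eig h]
  have e : (k : ℝ) * w * (2 * Real.pi / w) = k * (2 * Real.pi) := by field_simp
  rw [e, Real.cos_nat_mul_two_pi]
  have : Real.sin (k * (2 * Real.pi)) = 0 := by
    have := Real.sin_nat_mul_pi (2 * k)
    push_cast at this
    rw [← this]; congr 1; ring
  rw [this]; simp

lemma finrank_congr {Y Y' : Submodule ℝ E} (h : Y = Y') :
    Module.finrank ℝ Y = Module.finrank ℝ Y' := by rw [h]

open Classical in
lemma finrank_per {Ω : Finset ℝ} {a' n'' : E →ₗ[ℝ] E} (H : CL a' (s : E →ₗ[ℝ] E) n'' Ω)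
    {Y : Submodule ℝ E} (hY : ∀ x ∈ Y, s x ∈ Y) {w : ℝ} (hw : 0 < w) :
    Module.finrank ℝ (Y ⊓ Per s (2 * Real.pi / w) : Submodule ℝ E) =
      ∑ ω ∈ Ω, if ∃ k : ℕ, ω = (k : ℝ) * w then
        Module.finrank ℝ (Y ⊓ (aeval (s : E →ₗ[ℝ] E) (pw ω)).ker : Submodule ℝ E) else 0 := by
  rw [H.finrank_eq (Y := Y ⊓ Per s (2 * Real.pi / w))]
  · refine Finset.sum_congr rfl fun ω hω => ?_
    split_ifs with hk
    · apply finrank_congr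
      obtain ⟨k, rfl⟩ := hk
      ext x
      constructor
      · rintro ⟨⟨h1, _⟩, h3⟩; exact ⟨h1, h3⟩
      · rintro ⟨h1, h3⟩
        obtain ⟨y, hy⟩ := eig_of_pw (LinearMap.mem_ker.1 h3)
        exact ⟨⟨h1, per_eig' hw k hy⟩, h3⟩
    · refine (finrank_congr ?_).trans (finrank_bot ℝ E)
      rw [eq_bot_iff]
      rintro x ⟨⟨_, h2⟩, h3⟩
      obtain ⟨y, hy⟩ := eig_of_pw (LinearMap.mem_ker.1 h3)
      by_contra hx
      exact hk (per_eig (H.pos ω hω) hw hy hx h2)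
  · rintro x ⟨h1, h2⟩
    refine ⟨hY x h1, ?_⟩
    have h2' : fl s (2 * Real.pi / w) x = x := h2
    change fl s (2 * Real.pi / w) (s x) = s x
    rw [← fl_comm_apply s s (Commute.refl s), h2']

lemma FL_eq (k : ℕ) : FL (n : E →ₗ[ℝ] E) k = Fil n k ⊤ := by
  ext x
  rw [mem_FL, mem_Fil, ← ContinuousLinearMap.toLinearMap_pow]
  constructor
  · rintro ⟨h1, y, h2⟩; exact ⟨h1, y, trivial, h2⟩
  · rintro ⟨h1, y, _, h2⟩; exact ⟨h1, y, h2⟩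

lemma FL_smul (k : ℕ) {c : ℝ} (hc : c ≠ 0) :
    FL ((c • n : E →L[ℝ] E) : E →ₗ[ℝ] E) k = FL (n : E →ₗ[ℝ] E) k := by
  have hk : c ^ k ≠ 0 := pow_ne_zero _ hc
  have e1 : (c • n : E →L[ℝ] E) ^ k = c ^ k • n ^ k := _root_.smul_pow _ _ _
  rw [FL_eq, FL_eq]
  ext x
  rw [mem_Fil, mem_Fil, e1]
  constructor
  · rintro ⟨h1, y, _, rfl⟩
    refine ⟨(smul_eq_zero.1 h1).resolve_left hc, c ^ k • y, trivial, ?_⟩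
    rw [map_smul]; rfl
  · rintro ⟨h1, y, _, rfl⟩
    refine ⟨?_, (c ^ k)⁻¹ • y, trivial, ?_⟩
    · rw [ContinuousLinearMap.smul_apply, h1, smul_zero]
    · rw [ContinuousLinearMap.smul_apply, map_smul, smul_smul, mul_inv_cancel₀ hk, one_smul]

lemma Cen.FL_inv (H : Cen a s n) (k : ℕ) : ∀ x ∈ FL (n : E →ₗ[ℝ] E) k, s x ∈ FL (n : E →ₗ[ℝ] E) k := by
  obtain ⟨Ω, C⟩ := H.toCL
  rintro x ⟨h1, y, rfl⟩
  refine ⟨?_, s y, ?_⟩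
  · have := congrArg (fun f : E →ₗ[ℝ] E => f (((n : E →ₗ[ℝ] E) ^ k) y)) C.comm.eq
    have h1' : (n : E →ₗ[ℝ] E) (((n : E →ₗ[ℝ] E) ^ k) y) = 0 := h1
    simp only [Module.End.mul_apply, h1', map_zero] at this
    exact this.symm
  · exact comm_pow_apply C.comm.symm k y

lemma finrank_le_maps {Y : Submodule ℝ E} {Y' : Submodule ℝ F} {g : E → F} (hg : Continuous g)
    (h : ∀ x ∈ Y, g x ∈ Y') {g' : F → E} (hi : ∀ x ∈ Y, g' (g x) = x) :
    Module.finrank ℝ Y ≤ Module.finrank ℝ Y' := by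
  refine finrank_le_of_inj (fun x : Y => (⟨g x, h x x.2⟩ : Y'))
    ((hg.comp continuous_subtype_val).subtype_mk _) ?_
  intro x y e
  have e' : g x = g y := congrArg Subtype.val e
  apply Subtype.ext
  rw [← hi x x.2, ← hi y y.2, e']

variable {g : E → F} {g' : F → E}

lemma FL_ker {k : ℕ} {x : E} (h : x ∈ FL (n : E →ₗ[ℝ] E) k) : n x = 0 := h.1

lemma CM.fl_map {τ : E → ℝ → ℝ} (G : CM a b g τ) (H : Cen a s n) (H' : Cen b s' n') {k : ℕ} {x : E}
    (hx : x ∈ FL (n : E →ₗ[ℝ] E) k) : g x ∈ FL (n' : F →ₗ[ℝ] F) k := by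
  rw [FL_eq] at hx ⊢
  exact G.fil_top H H' k x hx

lemma le_per (G : Continuous g)
    (Gf : ∀ k : ℕ, ∀ x ∈ FL (n : E →ₗ[ℝ] E) k, g x ∈ FL (n' : F →ₗ[ℝ] F) k) (H : Cen a s n) (H' : Cen b s' n')
    (hgg : ∀ x, Bd a x → g' (g x) = x) (hper : ∀ x, Bd a x → ∀ T, fl a T x = x → fl b T (g x) = g x)
    (k : ℕ) (T : ℝ) :
    Module.finrank ℝ (FL (n : E →ₗ[ℝ] E) k ⊓ Per s T : Submodule ℝ E) ≤
    Module.finrank ℝ (FL (n' : F →ₗ[ℝ] F) k ⊓ Per s' T : Submodule ℝ F) := by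
  refine finrank_le_maps G ?_ (g' := g') ?_
  · rintro x ⟨h1, h2⟩
    have h3 := Gf k x h1
    refine ⟨h3, ?_⟩
    change fl s' T (g x) = g x
    rw [← H'.fl_of_bd (FL_ker h3)]
    refine hper x (H.bd_iff.2 (FL_ker h1)) T ?_
    rw [H.fl_of_bd (FL_ker h1)]
    exact h2
  · rintro x ⟨h1, h2⟩
    exact hgg x (H.bd_iff.2 (FL_ker h1))

lemma Cen.a_eq (H : Cen a s n) {x : E} (hx : n x = 0) : a x = s x := by
  rw [H.add]; simp [hx]

lemma le_fix (G : Continuous g)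
    (Gf : ∀ k : ℕ, ∀ x ∈ FL (n : E →ₗ[ℝ] E) k, g x ∈ FL (n' : F →ₗ[ℝ] F) k) (H : Cen a s n) (H' : Cen b s' n')
    (hgg : ∀ x, Bd a x → g' (g x) = x) (hper : ∀ x, Bd a x → ∀ T, fl a T x = x → fl b T (g x) = g x)
    (k : ℕ) :
    Module.finrank ℝ (FL (n : E →ₗ[ℝ] E) k ⊓ (aeval (s : E →ₗ[ℝ] E) (pw 0)).ker : Submodule ℝ E) ≤
    Module.finrank ℝ (FL (n' : F →ₗ[ℝ] F) k ⊓ (aeval (s' : F →ₗ[ℝ] F) (pw 0)).ker : Submodule ℝ F) := by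
  refine finrank_le_maps G ?_ (g' := g') ?_
  · rintro x ⟨h1, h2⟩
    have h3 := Gf k x h1
    refine ⟨h3, ?_⟩
    change aeval (s' : F →ₗ[ℝ] F) (pw 0) (g x) = 0
    have h2' : aeval (s : E →ₗ[ℝ] E) (pw 0) x = 0 := h2
    rw [pw_apply_zero, ← H.a_eq (FL_ker h1)] at h2'
    rw [pw_apply_zero, ← H'.a_eq (FL_ker h3)]
    exact fix_of_fl fun T => hper x (H.bd_iff.2 (FL_ker h1)) T (fl_fix h2' T)
  · rintro x ⟨h1, h2⟩
    exact hgg x (H.bd_iff.2 (FL_ker h1))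

lemma central_core (H : Cen a s n) (H' : Cen b s' n') (G : Continuous g) (G' : Continuous g')
    (Gf : ∀ k : ℕ, ∀ x ∈ FL (n : E →ₗ[ℝ] E) k, g x ∈ FL (n' : F →ₗ[ℝ] F) k)
    (Gf' : ∀ k : ℕ, ∀ x ∈ FL (n' : F →ₗ[ℝ] F) k, g' x ∈ FL (n : E →ₗ[ℝ] E) k)
    (hgg : ∀ x, Bd a x → g' (g x) = x) (hgg' : ∀ y, Bd b y → g (g' y) = y)
    (hper : ∀ x, Bd a x → ∀ T, fl a T x = x ↔ fl b T (g x) = g x) :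
    ∃ Q : E ≃ₗ[ℝ] F, ∀ x, Q (a x) = b (Q x) := by
  classical
  obtain ⟨Ω1, C1⟩ := H.toCL
  obtain ⟨Ω2, C2⟩ := H'.toCL
  have hpos : ∀ ω ∈ Ω1 ∪ Ω2, 0 ≤ ω := fun ω hω =>
    (Finset.mem_union.1 hω).elim (C1.pos ω) (C2.pos ω)
  have C := C1.mono Finset.subset_union_left hpos
  have C' := C2.mono Finset.subset_union_right hpos
  have hp1 : ∀ x, Bd a x → ∀ T, fl a T x = x → fl b T (g x) = g x := fun x hx T => (hper x hx T).1
  have hp2 : ∀ y, Bd b y → ∀ T, fl b T y = y → fl a T (g' y) = g' y := fun y hy T h => by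
    
    have := FL_ker (Gf' 0 y ⟨H'.bd_iff.1 hy, y, rfl⟩)
    rw [hper _ (H.bd_iff.2 this), hgg' y hy]; exact h
  refine C.sim C' fun k ω hω0 => ?_
  by_cases hω : ω ∈ Ω1 ∪ Ω2
  · refine count_mult hpos
      (fun ω => Module.finrank ℝ (FL (n : E →ₗ[ℝ] E) k ⊓ (aeval (s : E →ₗ[ℝ] E) (pw ω)).ker : Submodule ℝ E))
      (fun ω => Module.finrank ℝ (FL (n' : F →ₗ[ℝ] F) k ⊓ (aeval (s' : F →ₗ[ℝ] F) (pw ω)).ker : Submodule ℝ F))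
      ?_ ?_ ω hω
    · exact le_antisymm (le_fix G Gf H H' hgg hp1 k) (le_fix G' Gf' H' H hgg' hp2 k)
    · intro w hw
      have e1 := finrank_per C (H.FL_inv k) hw
      have e2 := finrank_per C' (H'.FL_inv k) hw
      rw [← e1, ← e2]
      exact le_antisymm (le_per G Gf H H' hgg hp1 k _) (le_per G' Gf' H' H hgg' hp2 k _)
  · have e1 : (FL (n : E →ₗ[ℝ] E) k ⊓ (aeval (s : E →ₗ[ℝ] E) (pw ω)).ker : Submodule ℝ E) = ⊥ := by
      rw [eq_bot_iff]; rintro x ⟨_, hx⟩; exact C.inj_of_notMem hω0 hω hx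
    have e2 : (FL (n' : F →ₗ[ℝ] F) k ⊓ (aeval (s' : F →ₗ[ℝ] F) (pw ω)).ker : Submodule ℝ F) = ⊥ := by
      rw [eq_bot_iff]; rintro x ⟨_, hx⟩; exact C'.inj_of_notMem hω0 hω hx
    rw [e1, e2, finrank_bot, finrank_bot]

lemma Cen.smul (H : Cen a s n) (c : ℝ) : Cen (c • a) (c • s) (c • n) := by
  refine ⟨by rw [H.add, smul_add], (H.comm.smul_left c).smul_right c, ?_, ?_⟩
  · obtain ⟨N, hN⟩ := H.nil
    exact ⟨N, by rw [_root_.smul_pow, hN, smul_zero]⟩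
  · rw [eq_top_iff, ← H.spn]
    refine Submodule.span_mono ?_
    rintro x ⟨β, y, hβ, h1, h2⟩
    rcases le_total 0 c with hc | hc
    · refine ⟨c * β, y, mul_nonneg hc hβ, ?_, ?_⟩
      · simp [h1, smul_smul]
      · simp [h2, smul_smul]
    · refine ⟨-c * β, -y, mul_nonneg (by linarith) hβ, ?_, ?_⟩
      · simp [h1, smul_smul]
      · simp [h2, smul_smul]

/-- a central generator is similar to its negative -/
lemma neg_sim (H : Cen a s n) : ∃ R : E ≃ₗ[ℝ] E, ∀ x, R (a x) = -a (R x) := by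
  obtain ⟨Ω, C⟩ := H.toCL
  obtain ⟨Ω', C'⟩ := (H.smul (-1)).toCL
  obtain ⟨Q, hQ⟩ := C.sim C' fun k ω h0 => by
    apply finrank_congr
    rw [FL_smul k (by norm_num)]
    congr 1
    ext x
    rw [LinearMap.mem_ker, LinearMap.mem_ker]
    by_cases hω : ω = 0
    · subst hω; rw [pw_apply_zero, pw_apply_zero]; simp
    · rw [pw_apply ω hω, pw_apply ω hω]; simp
  exact ⟨Q, fun x => by rw [show a x = (a : E →ₗ[ℝ] E) x from rfl, hQ]; simp⟩

lemma Bd.smul {x : E} (h : Bd a x) (c : ℝ) : Bd (c • a) x := by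
  obtain ⟨M, hM⟩ := h
  exact ⟨M, fun t => by rw [fl_smul]; exact hM _⟩

lemma Bd.of_smul {x : E} {c : ℝ} (hc : c ≠ 0) (h : Bd (c • a) x) : Bd a x := by
  have := h.smul c⁻¹
  rwa [smul_smul, inv_mul_cancel₀ hc, one_smul] at this

instance (V : Submodule ℝ E) : CompleteSpace V := FiniteDimensional.complete ℝ V

/-- restriction of a generator to an invariant subspace -/
def rs (a : E →L[ℝ] E) (V : Submodule ℝ E) (hV : ∀ x ∈ V, a x ∈ V) : V →L[ℝ] V :=
  (a.comp V.subtypeL).codRestrict V fun x => hV x x.2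

lemma rs_apply {V : Submodule ℝ E} (hV : ∀ x ∈ V, a x ∈ V) (x : V) :
    (rs a V hV x : E) = a x := rfl

lemma rs_fl {V : Submodule ℝ E} (hV : ∀ x ∈ V, a x ∈ V) (t : ℝ) (x : V) :
    (fl (rs a V hV) t x : E) = fl a t x := by
  have := fl_unique a (fun t => (fl (rs a V hV) t x : E)) (fun t => ?_) t
  · simpa using this
  · exact V.subtypeL.hasFDerivAt.comp_hasDerivAt t (hasDerivAt_fl (rs a V hV) t x)

theorem central_main {τ : E → ℝ → ℝ} {τ' : F → ℝ → ℝ} (ha : ∀ x, x ∈ ceS a) (hb : ∀ x, x ∈ ceS b)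
    (G : CM a b g τ) (G' : CM b a g' τ')
    (hgg : ∀ x, Bd a x → g' (g x) = x) (hgg' : ∀ y, Bd b y → g (g' y) = y) :
    ∃ c : ℝ, c ≠ 0 ∧ ∃ Q : E ≃ₗ[ℝ] F, ∀ x, Q (a x) = c • b (Q x) := by
  obtain ⟨s, n, H⟩ := exists_Cen a ha
  obtain ⟨s', n', H'⟩ := exists_Cen b hb
  let V : Submodule ℝ E := LinearMap.ker (n : E →ₗ[ℝ] E)
  let W : Submodule ℝ F := LinearMap.ker (n' : F →ₗ[ℝ] F)
  have mV : ∀ x, x ∈ V ↔ Bd a x := fun x => H.bd_iff.symm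
  have mW : ∀ x, x ∈ W ↔ Bd b x := fun x => H'.bd_iff.symm
  have hV : ∀ x ∈ V, a x ∈ V := by
    intro x hx
    have hx' : n x = 0 := hx
    change n (a x) = 0
    have : Commute n a := by rw [H.add]; exact H.comm.symm.add_right (Commute.refl n)
    have := congrArg (fun f : E →L[ℝ] E => f x) this.eq
    simp only [ContinuousLinearMap.mul_apply, hx', map_zero] at this
    exact this
  have hW : ∀ x ∈ W, b x ∈ W := by
    intro x hx
    have hx' : n' x = 0 := hx
    change n' (b x) = 0
    have : Commute n' b := by rw [H'.add]; exact H'.comm.symm.add_right (Commute.refl n')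
    have := congrArg (fun f : F →L[ℝ] F => f x) this.eq
    simp only [ContinuousLinearMap.mul_apply, hx', map_zero] at this
    exact this
  let g0 : V ≃ₜ W :=
    { toFun := fun x => ⟨g x, (mW _).2 (G.bd x ((mV _).1 x.2))⟩
      invFun := fun y => ⟨g' y, (mV _).2 (G'.bd y ((mW _).1 y.2))⟩
      left_inv := fun x => Subtype.ext (hgg x ((mV _).1 x.2))
      right_inv := fun y => Subtype.ext (hgg' y ((mW _).1 y.2))
      continuous_toFun := (G.cont.comp continuous_subtype_val).subtype_mk _
      continuous_invFun := (G'.cont.comp continuous_subtype_val).subtype_mk _ }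
  have hR : RE (rs a V hV) (rs b W hW) g0 := by
    refine ⟨rot_of_bdd fun x => ?_, rot_of_bdd fun x => ?_, fun x t => ⟨τ x t, Subtype.ext ?_⟩,
      fun y t => ⟨τ' y t, Subtype.ext ?_⟩⟩
    · obtain ⟨M, hM⟩ := (mV x).1 x.2
      exact ⟨M, fun t => by
        change ‖(fl (rs a V hV) t x : E)‖ ≤ M; rw [rs_fl]; exact hM t⟩
    · obtain ⟨M, hM⟩ := (mW x).1 x.2
      exact ⟨M, fun t => by
        change ‖(fl (rs b W hW) t x : F)‖ ≤ M; rw [rs_fl]; exact hM t⟩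
    · rw [rs_fl]
      change g (fl (rs a V hV) t x : E) = _
      rw [rs_fl]; exact G.orb x t
    · rw [rs_fl]
      change g' (fl (rs b W hW) t y : F) = _
      rw [rs_fl]; exact G'.orb y t
  obtain ⟨c, hc, hper⟩ := hR.main
  refine ⟨c, hc, ?_⟩
  have hp : ∀ x, Bd a x → ∀ T, fl a T x = x ↔ fl (c • b) T (g x) = g x := by
    intro x hx T
    have h1 := hper ⟨x, (mV x).2 hx⟩ T
    rw [Subtype.ext_iff, Subtype.ext_iff, rs_fl, rs_fl] at h1
    rw [fl_smul]
    exact h1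
  obtain ⟨Q, hQ⟩ := central_core H (H'.smul c) G.cont G'.cont
    (fun k x hx => by rw [FL_smul k hc]; exact G.fl_map H H' hx)
    (fun k x hx => by rw [FL_smul k hc] at hx; exact G'.fl_map H' H hx) hgg
    (fun y hy => hgg' y (hy.of_smul hc)) hp
  exact ⟨Q, fun x => hQ x⟩

end CentralMain


section OrbEq
variable {E : Type*} [NormedAddCommGroup E] [NormedSpace ℝ E] [FiniteDimensional ℝ E]
  [CompleteSpace E] {a : E →L[ℝ] E}
variable {F : Type*} [NormedAddCommGroup F] [NormedSpace ℝ F] [FiniteDimensional ℝ F]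
  [CompleteSpace F] {b : F →L[ℝ] F}

/-- orbit equivalence of linear flows -/
structure OE (a : E →L[ℝ] E) (b : F →L[ℝ] F) (h : E ≃ₜ F) : Prop where
  zero : h 0 = 0
  orb : ∀ t x, ∃ t', h (fl a t x) = fl b t' (h x)
  orb' : ∀ t y, ∃ t', h.symm (fl b t y) = fl a t' (h.symm y)

variable {h : E ≃ₜ F}

lemma OE.symm (O : OE a b h) : OE b a h.symm :=
  ⟨by rw [Homeomorph.symm_apply_eq, O.zero], O.orb', O.orb⟩

lemma OE.neg (O : OE a b h) : OE a (-b) h := by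
  refine ⟨O.zero, fun t x => ?_, fun t y => ?_⟩
  · obtain ⟨t', ht⟩ := O.orb t x
    exact ⟨-t', by rw [fl_neg_gen, neg_neg, ht]⟩
  · rw [fl_neg_gen]; exact O.orb' (-t) y

lemma Bd.ce {x : E} (hx : Bd a x) : x ∈ ceS a := by
  obtain ⟨M, hM⟩ := hx
  rw [mem_ceS]
  intro ε hε
  rw [tendsto_zero_iff_norm_tendsto_zero]
  have h0 : Tendsto (fun t : ℝ => |t|) (atBot ⊔ atTop) atTop :=
    tendsto_sup.2 ⟨tendsto_abs_atBot_atTop, tendsto_abs_atTop_atTop⟩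
  have h1 : Tendsto (fun t : ℝ => Real.exp (-(ε * |t|)) * M) (atBot ⊔ atTop) (𝓝 0) := by
    have := (Real.tendsto_exp_atBot.comp
      (tendsto_neg_atTop_atBot.comp (h0.const_mul_atTop hε))).mul_const M
    simpa [Function.comp_def] using this
  refine squeeze_zero (fun t => norm_nonneg _) (fun t => ?_) h1
  rw [norm_smul, Real.norm_of_nonneg (Real.exp_pos _).le]
  exact mul_le_mul_of_nonneg_left (hM t) (Real.exp_pos _).le

lemma cont_bdd (h : E ≃ₜ F) (M : ℝ) : ∃ M', ∀ x, ‖x‖ ≤ M → ‖h x‖ ≤ M' := by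
  have : ProperSpace E := FiniteDimensional.proper ℝ E
  obtain ⟨M', hM'⟩ := (isCompact_closedBall (0 : E) M).exists_bound_of_continuousOn
    h.continuous.continuousOn
  exact ⟨M', fun x hx => hM' x (by simpa using hx)⟩

lemma OE.bd (O : OE a b h) {x : E} (hx : Bd a x) : Bd b (h x) := by
  obtain ⟨M, hM⟩ := hx
  obtain ⟨M', hM'⟩ := cont_bdd h M
  refine ⟨M', fun t => ?_⟩
  obtain ⟨t', ht⟩ := O.orb' t (h x)
  rw [Homeomorph.symm_apply_eq, h.symm_apply_apply] at ht
  rw [ht]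
  exact hM' _ (hM t')

lemma rs_ce {V : Submodule ℝ E} (hV : ∀ x ∈ V, a x ∈ V) (x : V) :
    x ∈ ceS (rs a V hV) ↔ (x : E) ∈ ceS a := by
  rw [mem_ceS, mem_ceS]
  refine forall₂_congr fun ε _ => ?_
  rw [tendsto_subtype_rng]
  simp only [Submodule.coe_smul, rs_fl, Submodule.coe_zero]

lemma rs_st {V : Submodule ℝ E} (hV : ∀ x ∈ V, a x ∈ V) (x : V) :
    x ∈ stS (rs a V hV) ↔ (x : E) ∈ stS a := by
  rw [mem_stS, mem_stS, tendsto_subtype_rng]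
  simp only [rs_fl, Submodule.coe_zero]

lemma rs_bd {V : Submodule ℝ E} (hV : ∀ x ∈ V, a x ∈ V) (x : V) :
    Bd (rs a V hV) x ↔ Bd a (x : E) := by
  unfold Bd
  refine exists_congr fun M => forall_congr' fun t => ?_
  rw [← rs_fl hV]; rfl

lemma ceS_self (a : E →L[ℝ] E) : ∀ x ∈ ceS a, a x ∈ ceS a :=
  fun _ hx => ceS_inv a a (Commute.refl a) hx

/-- the central restriction -/
abbrev ra (a : E →L[ℝ] E) : ceS a →L[ℝ] ceS a := rs a (ceS a) (ceS_self a)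

lemma ra_ce (a : E →L[ℝ] E) (x : ceS a) : x ∈ ceS (ra a) := (rs_ce _ x).2 x.2

/-- an unbounded central orbit is an embedded closed line -/
lemma emb_of_not_bd (ha : ∀ x, x ∈ ceS a) {x : E} (hx : ¬ Bd a x) :
    IsClosedEmbedding (fun t : ℝ => fl a t x) := by
  obtain ⟨s, n, H⟩ := exists_Cen a ha
  have hn : n x ≠ 0 := fun h0 => hx (H.bd_iff.2 h0)
  obtain ⟨c, hc, D, hD⟩ := H.escape hn
  have : ProperSpace E := FiniteDimensional.proper ℝ E
  have hcont : Continuous fun t : ℝ => fl a t x :=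
    (continuous_fl_uncurry a).comp (continuous_id.prodMk continuous_const)
  refine IsClosedEmbedding.of_continuous_injective_isClosedMap hcont ?_ ?_
  · intro t t' htt
    by_contra hne
    have h1 : fl a (t - t') x = x := by
      have : fl a (t - t') x = fl a (-t') (fl a t x) := by
        rw [← fl_add_apply]; congr 2; ring
      rw [this]; simp only at htt; rw [htt, fl_neg_apply]
    have h2 : ∀ k : ℕ, fl a (k * (t - t')) x = x := by
      intro k
      induction k with
      | zero => simp
      | succ k ih =>
        have : ((k + 1 : ℕ) : ℝ) * (t - t') = k * (t - t') + (t - t') := by push_cast; ring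
        rw [this, fl_add_apply, h1, ih]
    have hp : 0 < c * |t - t'| := mul_pos hc (abs_pos.2 (sub_ne_zero.2 hne))
    obtain ⟨k, hk⟩ := exists_nat_gt ((‖x‖ + D) / (c * |t - t'|))
    rw [div_lt_iff₀ hp] at hk
    have h3 := hD (k * (t - t'))
    rw [h2, abs_mul, Nat.abs_cast] at h3
    nlinarith
  · apply IsProperMap.isClosedMap
    rw [isProperMap_iff_tendsto_cocompact]
    refine ⟨hcont, ?_⟩
    apply tendsto_cocompact_of_tendsto_dist_comp_atTop (0 : E)
    simp only [dist_zero_right]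
    have h1 : Tendsto (fun t : ℝ => c * |t| - D) (cocompact ℝ) atTop := by
      have := (tendsto_norm_cocompact_atTop (E := ℝ)).const_mul_atTop hc
      exact tendsto_atTop_add_const_right _ (-D) this
    exact tendsto_atTop_mono hD h1

lemma OE.cm (O : OE a b h) {PS PC PU : F →L[ℝ] F} (P : Proj b PS PC PU) :
    ∃ τ, CM (ra a) (ra b) (fun x => ⟨PC (h x), P.memC _⟩) τ := by
  choose τ hτ using O.orb
  refine ⟨fun x t => τ t x, ?_, ?_, ?_, ?_, ?_⟩
  · exact (PC.continuous.comp (h.continuous.comp continuous_subtype_val)).subtype_mk _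
  · apply Subtype.ext; simp [O.zero]
  · intro x t
    apply Subtype.ext
    rw [rs_fl]
    simp only [rs_fl, hτ, P.flC]
  · intro R M
    obtain ⟨M1, hM1⟩ := cont_bdd h M
    obtain ⟨K, hK0, hK⟩ := fl_bdd b R
    obtain ⟨M2, hM2⟩ := cont_bdd h.symm (K * M1)
    obtain ⟨s, n, H⟩ := exists_Cen (ra a) (ra_ce a)
    obtain ⟨C, hC, hrot⟩ := H.rot
    refine ⟨max M2 (C * M), fun x t hx ht hR u hu => ?_⟩
    by_cases hb : Bd (ra a) x
    · refine le_max_of_le_right ?_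
      rw [H.fl_of_bd (H.bd_iff.1 hb)]
      exact (hrot u x).trans (mul_le_mul_of_nonneg_left hx (by linarith))
    · refine le_max_of_le_left ?_
      have he := emb_of_not_bd (ra_ce a) hb
      have hx' : ‖(x : E)‖ ≤ M := hx
      -- the path
      have hp : ∀ σ : ℝ, ∃ v, h.symm (fl b σ (h x)) = fl a v x := fun σ => by
        obtain ⟨v, hv⟩ := O.orb' σ (h x)
        rw [h.symm_apply_apply] at hv
        exact ⟨v, hv⟩
      choose T hT using hp
      have hTc : Continuous T := by
        rw [he.isEmbedding.isInducing.continuous_iff, Topology.IsInducing.subtypeVal.continuous_iff]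
        have hcs : Continuous fun σ => h.symm (fl b σ (h x)) := h.symm.continuous.comp
          ((continuous_fl_uncurry b).comp (continuous_id.prodMk continuous_const))
        refine Continuous.congr hcs fun σ => ?_
        simp only [Function.comp_apply]
        rw [rs_fl, hT]
      have hT0 : T 0 = 0 := he.injective (Subtype.ext (by
        simp only [rs_fl]; rw [← hT 0]; simp))
      have hTt : T (τ t x) = t := he.injective (Subtype.ext (by
        simp only [rs_fl]; rw [← hT, ← hτ, h.symm_apply_apply]))
      have hsub := intermediate_value_uIcc (a := 0) (b := τ t x) (f := T) hTc.continuousOn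
      rw [hT0, hTt, Set.uIcc_of_le ht] at hsub
      obtain ⟨σ, hσ, rfl⟩ := hsub hu
      have hσR : |σ| ≤ R := by
        have := Set.abs_sub_left_of_mem_uIcc hσ
        simp only [sub_zero] at this
        exact this.trans hR
      change ‖(fl (ra a) (T σ) x : E)‖ ≤ M2
      rw [rs_fl, ← hT]
      apply hM2
      exact (hK σ hσR _).trans (mul_le_mul_of_nonneg_left (hM1 _ hx') hK0)
  · intro x hx
    rw [rs_bd] at hx ⊢
    have h1 := O.bd hx
    have h2 := (P.uniq 0 (h x) 0 (zero_mem _) h1.ce (zero_mem _)).2.1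
    simp only [zero_add, add_zero] at h2
    simp only [h2]
    exact h1

theorem OE.central (O : OE a b h) : ∃ c : ℝ, c ≠ 0 ∧ ∃ Q : ceS a ≃ₗ[ℝ] ceS b,
    ∀ x, Q (ra a x) = c • ra b (Q x) := by
  obtain ⟨PS, PC, PU, P⟩ := exists_Proj a
  obtain ⟨PS', PC', PU', P'⟩ := exists_Proj b
  obtain ⟨τ, G⟩ := O.cm P'
  obtain ⟨τ', G'⟩ := O.symm.cm P
  have key : ∀ x, Bd a x → PC x = x := fun x hx => by
    have := (P.uniq 0 x 0 (zero_mem _) hx.ce (zero_mem _)).2.1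
    simpa using this
  have key' : ∀ x, Bd b x → PC' x = x := fun x hx => by
    have := (P'.uniq 0 x 0 (zero_mem _) hx.ce (zero_mem _)).2.1
    simpa using this
  refine central_main (ra_ce a) (ra_ce b) G G' (fun x hx => ?_) (fun x hx => ?_)
  · rw [rs_bd] at hx
    apply Subtype.ext
    simp only [key' _ (O.bd hx), h.symm_apply_apply, key _ hx]
  · rw [rs_bd] at hx
    apply Subtype.ext
    simp only [key _ (O.symm.bd hx), h.apply_symm_apply, key' _ hx]

end OrbEq


section Dich
variable {E : Type*} [NormedAddCommGroup E] [NormedSpace ℝ E] [FiniteDimensional ℝ E]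
  [CompleteSpace E] {a : E →L[ℝ] E}
variable {F : Type*} [NormedAddCommGroup F] [NormedSpace ℝ F] [FiniteDimensional ℝ F]
  [CompleteSpace F] {b : F →L[ℝ] F}
variable {h : E ≃ₜ F}

/-- closure of the orbit relation -/
def Er (a : E →L[ℝ] E) (x y : E) : Prop := ∃ (z : ℕ → E) (t : ℕ → ℝ), Tendsto z atTop (𝓝 x) ∧
  Tendsto (fun i => fl a (t i) (z i)) atTop (𝓝 y)

lemma OE.er (O : OE a b h) {x y : E} (hxy : Er a x y) : Er b (h x) (h y) := by
  obtain ⟨z, t, h1, h2⟩ := hxy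
  choose τ hτ using O.orb
  refine ⟨fun i => h (z i), fun i => τ (t i) (z i), (h.continuous.tendsto x).comp h1, ?_⟩
  have := (h.continuous.tendsto y).comp h2
  simpa only [Function.comp_def, hτ] using this

lemma er_su {x y : E} (hx : x ∈ stS a) (hy : y ∈ unS a) : Er a x y := by
  have hN : Tendsto (fun i : ℕ => (i : ℝ)) atTop atTop := tendsto_natCast_atTop_atTop
  refine ⟨fun i => x + fl a (-(i:ℝ)) y, fun i => i, ?_, ?_⟩
  · have := (mem_unS.1 hy).comp (tendsto_neg_atTop_atBot.comp hN)
    simpa [Function.comp_def] using this.const_add x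
  · have := (mem_stS.1 hx).comp hN
    simp only [map_add, fl_neg_apply']
    simpa [Function.comp_def] using this.add_const y

lemma er_neg {x y : E} (hxy : Er a x y) : Er (-a) x y := by
  obtain ⟨z, t, h1, h2⟩ := hxy
  exact ⟨z, fun i => -t i, h1, by simpa only [fl_neg_gen, neg_neg] using h2⟩

lemma er_symm {x y : E} (hxy : Er a x y) : Er a y x := by
  obtain ⟨z, t, h1, h2⟩ := hxy
  exact ⟨_, fun i => -t i, h2, by simpa only [fl_neg_apply] using h1⟩

lemma er_ss {x y : E} (hx : x ∈ stS a) (hy : y ∈ stS a) (hx0 : x ≠ 0) (hy0 : y ≠ 0)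
    (hxy : Er a x y) : ∃ T, y = fl a T x := by
  obtain ⟨z, t, h1, h2⟩ := hxy
  obtain ⟨PS, PC, PU, P⟩ := exists_Proj a
  obtain ⟨C, l, hC, hl, H⟩ := stS_bound a
  have ex : ∀ w ∈ stS a, PS w = w := fun w hw => by
    have := (P.uniq w 0 0 hw (zero_mem _) (zero_mem _)).1
    simpa using this
  have h3 : Tendsto (fun i => PS (z i)) atTop (𝓝 x) := by
    have := (PS.continuous.tendsto x).comp h1
    rwa [ex x hx] at this
  have h4 : Tendsto (fun i => fl a (t i) (PS (z i))) atTop (𝓝 y) := by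
    have := (PS.continuous.tendsto y).comp h2
    rw [ex y hy] at this
    simpa only [Function.comp_def, P.flS] using this
  -- uniform smallness
  have hsm : ∀ M ε : ℝ, 0 < ε → ∃ T : ℝ, 0 < T ∧ ∀ s, T ≤ s → ∀ w ∈ stS a, ‖w‖ ≤ M →
      ‖fl a s w‖ < ε := by
    intro M ε hε
    have hlim : Tendsto (fun s : ℝ => C * Real.exp (-(l * s)) * M) atTop (𝓝 0) := by
      have := ((Real.tendsto_exp_atBot.comp
        (tendsto_neg_atTop_atBot.comp (tendsto_id.const_mul_atTop hl))).const_mul C).mul_const M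
      simpa [Function.comp_def] using this
    obtain ⟨T, hT⟩ := eventually_atTop.1 (hlim.eventually_lt_const hε)
    refine ⟨max T 1, by positivity, fun s hs w hw hwM => ?_⟩
    have hs1 : T ≤ s := (le_max_left _ _).trans hs
    have hs2 : 1 ≤ s := (le_max_right _ _).trans hs
    refine lt_of_le_of_lt ((H s (by linarith) w hw).trans ?_) (hT s hs1)
    exact mul_le_mul_of_nonneg_left hwM (by positivity)
  obtain ⟨T1, hT1, H1⟩ := hsm (‖x‖ + 1) (‖y‖ / 2) (by positivity)
  obtain ⟨T2, hT2, H2⟩ := hsm (‖y‖ + 1) (‖x‖ / 2) (by positivity)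
  have e1 := h3.norm.eventually_lt_const (show ‖x‖ < ‖x‖ + 1 by linarith)
  have e2 := h4.norm.eventually_lt_const (show ‖y‖ < ‖y‖ + 1 by linarith)
  have hxp := norm_pos_iff.2 hx0
  have hyp := norm_pos_iff.2 hy0
  have e3 := h3.norm.eventually_const_lt (show ‖x‖ / 2 < ‖x‖ by linarith)
  have e4 := h4.norm.eventually_const_lt (show ‖y‖ / 2 < ‖y‖ by linarith)
  have hb : ∀ᶠ i in atTop, t i ∈ Set.Icc (-T2) T1 := by
    filter_upwards [e1, e2, e3, e4] with i i1 i2 i3 i4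
    constructor
    · by_contra hc
      push Not at hc
      have := H2 (-t i) (by linarith) _ (stS_fl a (t i) (P.memS (z i))) i2.le
      rw [fl_neg_apply] at this
      linarith
    · by_contra hc
      push Not at hc
      have := H1 (t i) hc.le _ (P.memS (z i)) i1.le
      linarith
  obtain ⟨T, -, φ, hφ, hT⟩ := isCompact_Icc.tendsto_subseq' hb.frequently
  refine ⟨T, ?_⟩
  have h5 := h4.comp hφ.tendsto_atTop
  have h6 := ((continuous_fl_uncurry a).tendsto (T, x)).comp
    (hT.prodMk_nhds (h3.comp hφ.tendsto_atTop))
  exact tendsto_nhds_unique h5 h6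

lemma er_uu {x y : E} (hx : x ∈ unS a) (hy : y ∈ unS a) (hx0 : x ≠ 0) (hy0 : y ≠ 0)
    (hxy : Er a x y) : ∃ T, y = fl a T x := by
  rw [unS_eq] at hx hy
  obtain ⟨T, hT⟩ := er_ss hx hy hx0 hy0 (er_neg hxy)
  exact ⟨-T, by rw [hT, fl_neg_gen]⟩

/-- orbits accumulating at zero -/
def Zr (a : E →L[ℝ] E) (x : E) : Prop := ∃ t : ℕ → ℝ, Tendsto (fun i => fl a (t i) x) atTop (𝓝 0)

lemma OE.zr (O : OE a b h) {x : E} (hx : Zr a x) : Zr b (h x) := by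
  obtain ⟨t, h1⟩ := hx
  choose τ hτ using O.orb
  refine ⟨fun i => τ (t i) x, ?_⟩
  have := (h.continuous.tendsto 0).comp h1
  rw [O.zero] at this
  simpa only [Function.comp_def, hτ] using this

lemma zr_s {x : E} (hx : x ∈ stS a) : Zr a x :=
  ⟨fun i => i, (mem_stS.1 hx).comp tendsto_natCast_atTop_atTop⟩

lemma zr_u {x : E} (hx : x ∈ unS a) : Zr a x :=
  ⟨fun i => -(i:ℝ), (mem_unS.1 hx).comp (tendsto_neg_atTop_atBot.comp tendsto_natCast_atTop_atTop)⟩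

lemma ce_zero (ha : ∀ x, x ∈ ceS a) {x : E} {t : ℕ → ℝ}
    (h1 : Tendsto (fun i => fl a (t i) x) atTop (𝓝 0)) : x = 0 := by
  obtain ⟨s, n, H⟩ := exists_Cen a ha
  obtain ⟨N, hN⟩ := H.nil
  obtain ⟨C, hC, hrot⟩ := H.rot
  by_contra hx
  obtain ⟨k, -, hk1, hk2⟩ := nil_last hN 0 (x := x) (by simpa using hx)
  have hn : n ((n ^ k) x) = 0 := by rw [pow_succ'] at hk2; exact hk2
  have hcm : Commute (n ^ k) a := by
    rw [H.add]; exact (H.comm.symm.add_right (Commute.refl n)).pow_left k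
  have h2 := (((n ^ k).continuous.tendsto 0).comp h1).norm.const_mul C
  simp only [Function.comp_def, map_zero, norm_zero, mul_zero, fl_comm_apply a _ hcm] at h2
  have h3 : ∀ i, ‖(n ^ k) x‖ ≤ C * ‖fl a (t i) ((n ^ k) x)‖ := by
    intro i
    rw [H.fl_of_bd hn]
    have := hrot (-t i) (fl s (t i) ((n ^ k) x))
    rwa [fl_neg_apply] at this
  have h4 := ge_of_tendsto' h2 h3
  exact hk1 (norm_le_zero_iff.1 h4)

lemma st_ev {x : E} (hx : x ∈ stS a) (hx0 : x ≠ 0) {t : ℕ → ℝ}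
    (h1 : Tendsto (fun i => fl a (t i) x) atTop (𝓝 0)) : ∀ᶠ i in atTop, 0 < t i := by
  obtain ⟨C, l, hC, hl, H⟩ := stS_bound a
  have h2 := h1.norm.const_mul C
  rw [norm_zero, mul_zero] at h2
  filter_upwards [h2.eventually_lt_const (norm_pos_iff.2 hx0)] with i hi
  by_contra hc
  push Not at hc
  have h3 := H (-t i) (by linarith) _ (stS_fl a (t i) hx)
  rw [fl_neg_apply] at h3
  have h4 : Real.exp (-(l * -t i)) ≤ 1 := Real.exp_le_one_iff.2 (by nlinarith)
  have h5 : C * Real.exp (-(l * -t i)) * ‖fl a (t i) x‖ ≤ C * 1 * ‖fl a (t i) x‖ := by gcongr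
  linarith

lemma zr_or {x : E} (hx : Zr a x) : x ∈ stS a ∨ x ∈ unS a := by
  obtain ⟨t, h1⟩ := hx
  obtain ⟨PS, PC, PU, P⟩ := exists_Proj a
  have hS := (PS.continuous.tendsto 0).comp h1
  have hC := (PC.continuous.tendsto 0).comp h1
  have hU := (PU.continuous.tendsto 0).comp h1
  simp only [Function.comp_def, map_zero, P.flS, P.flC, P.flU] at hS hC hU
  have c0 : PC x = 0 := by
    have h2 : Tendsto (fun i => fl (ra a) (t i) ⟨PC x, P.memC x⟩) atTop (𝓝 0) := by
      rw [tendsto_subtype_rng]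
      simpa only [rs_fl, Submodule.coe_zero] using hC
    have := ce_zero (ra_ce a) h2
    exact congrArg Subtype.val this
  have hsum := P.sum x
  rw [c0, add_zero] at hsum
  by_cases hs : PS x = 0
  · right; rw [← hsum, hs, zero_add]; exact P.memU x
  by_cases hu : PU x = 0
  · left; rw [← hsum, hu, add_zero]; exact P.memS x
  exfalso
  have e1 := st_ev (P.memS x) hs hS
  have e2 : ∀ᶠ i in atTop, 0 < -t i := by
    refine st_ev (a := -a) (by rw [← unS_eq]; exact P.memU x) hu ?_
    simpa only [fl_neg_gen, neg_neg] using hU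
  obtain ⟨i, h3, h4⟩ := (e1.and e2).exists
  linarith

lemma su_zero {x : E} (hx : x ∈ stS a) (hx' : x ∈ unS a) : x = 0 :=
  indep_st a hx (zero_mem _) hx' (by rw [zero_add])

/-- `h` respects the stable and unstable spaces -/
structure Rsp (a : E →L[ℝ] E) (b : F →L[ℝ] F) (h : E ≃ₜ F) : Prop where
  s : ∀ x, x ∈ stS a ↔ h x ∈ stS b
  u : ∀ x, x ∈ unS a ↔ h x ∈ unS b

lemma OE.ne (O : OE a b h) {x : E} (hx : x ≠ 0) : h x ≠ 0 := fun h0 =>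
  hx (h.injective (h0.trans O.zero.symm))

/-- the orbit of a stable point -/
lemma OE.st_orb (O : OE a b h) {x : E} (T : ℝ) (hx : h x ∈ stS b) : h (fl a T x) ∈ stS b := by
  obtain ⟨t', ht⟩ := O.orb T x
  rw [ht]; exact stS_fl b _ hx

lemma OE.un_orb (O : OE a b h) {x : E} (T : ℝ) (hx : h x ∈ unS b) : h (fl a T x) ∈ unS b := by
  obtain ⟨t', ht⟩ := O.orb T x
  rw [ht]; exact unS_fl b _ hx

/-- if one stable point is mapped to a stable point then everything is respected -/
lemma OE.half (O : OE a b h) {x : E} (hx : x ∈ stS a) (hx0 : x ≠ 0) (hhx : h x ∈ stS b) :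
    (∀ y ∈ stS a, h y ∈ stS b) ∧ (∀ y ∈ unS a, h y ∈ unS b) := by
  have z1 : h 0 ∈ stS b := by rw [O.zero]; exact zero_mem _
  have z2 : h 0 ∈ unS b := by rw [O.zero]; exact zero_mem _
  constructor
  · intro y hy
    by_cases hy0 : y = 0
    · rw [hy0]; exact z1
    refine (zr_or (O.zr (zr_s hy))).elim id fun hu => ?_
    have h1 := O.symm.er (er_su hhx hu)
    rw [h.symm_apply_apply, h.symm_apply_apply] at h1
    obtain ⟨T, rfl⟩ := er_ss hx hy hx0 hy0 h1
    exact O.st_orb T hhx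
  · intro y hy
    by_cases hy0 : y = 0
    · rw [hy0]; exact z2
    refine (zr_or (O.zr (zr_u hy))).elim (fun hs => ?_) id
    exfalso
    have h1 := O.er (er_su hx hy)
    obtain ⟨T, hT⟩ := er_ss hhx hs (O.ne hx0) (O.ne hy0) h1
    obtain ⟨T', hT'⟩ := O.orb' T (h x)
    rw [← hT, h.symm_apply_apply, h.symm_apply_apply] at hT'
    exact hy0 (su_zero (by rw [hT']; exact stS_fl a _ hx) hy)

lemma OE.rsp_of (O : OE a b h) (h1 : ∀ y ∈ stS a, h y ∈ stS b) (h2 : ∀ y ∈ unS a, h y ∈ unS b) :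
    Rsp a b h := by
  refine ⟨fun x => ⟨h1 x, fun hx => ?_⟩, fun x => ⟨h2 x, fun hx => ?_⟩⟩
  · have := O.symm.zr (zr_s hx)
    rw [h.symm_apply_apply] at this
    refine (zr_or this).elim id fun hu => ?_
    by_contra hx'
    have hx0 : x ≠ 0 := fun h0 => hx' (by rw [h0]; exact zero_mem _)
    exact O.ne hx0 (su_zero hx (h2 x hu))
  · have := O.symm.zr (zr_u hx)
    rw [h.symm_apply_apply] at this
    refine (zr_or this).elim (fun hs => ?_) id
    by_contra hx'
    have hx0 : x ≠ 0 := fun h0 => hx' (by rw [h0]; exact zero_mem _)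
    exact O.ne hx0 (su_zero (h1 x hs) hx)

lemma OE.dich_aux (O : OE a b h) {x : E} (hx : x ∈ stS a) (hx0 : x ≠ 0) :
    Rsp a b h ∨ Rsp a (-b) h := by
  rcases zr_or (O.zr (zr_s hx)) with h1 | h1
  · obtain ⟨h2, h3⟩ := O.half hx hx0 h1
    exact Or.inl (O.rsp_of h2 h3)
  · rw [unS_eq] at h1
    obtain ⟨h2, h3⟩ := O.neg.half hx hx0 h1
    exact Or.inr (O.neg.rsp_of h2 h3)

lemma Rsp.neg (R : Rsp a b h) : Rsp (-a) (-b) h := by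
  refine ⟨fun x => ?_, fun x => ?_⟩
  · rw [← unS_eq, ← unS_eq]; exact R.u x
  · rw [← stS_eq, ← stS_eq]; exact R.s x

lemma OE.negl (O : OE a b h) : OE (-a) b h := O.symm.neg.symm

lemma OE.dich (O : OE a b h) : Rsp a b h ∨ Rsp a (-b) h := by
  by_cases hs : ∃ x ∈ stS a, x ≠ 0
  · obtain ⟨x, hx, hx0⟩ := hs
    exact O.dich_aux hx hx0
  by_cases hu : ∃ x ∈ unS a, x ≠ 0
  · obtain ⟨x, hx, hx0⟩ := hu
    rw [unS_eq] at hx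
    rcases O.negl.dich_aux hx hx0 with h1 | h1
    · right; simpa using h1.neg
    · left; simpa using h1.neg
  · push Not at hs hu
    left
    refine O.rsp_of (fun y hy => ?_) (fun y hy => ?_)
    · rw [hs y hy, O.zero]; exact zero_mem _
    · rw [hu y hy, O.zero]; exact zero_mem _

end Dich


section Glue
variable {X1 X2 Y1 Y2 V W Z : Type*}
  [NormedAddCommGroup X1] [NormedSpace ℝ X1] [NormedAddCommGroup X2] [NormedSpace ℝ X2]
  [NormedAddCommGroup Y1] [NormedSpace ℝ Y1] [NormedAddCommGroup Y2] [NormedSpace ℝ Y2]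
  [NormedAddCommGroup V] [NormedSpace ℝ V] [NormedAddCommGroup W] [NormedSpace ℝ W]
  [NormedAddCommGroup Z] [NormedSpace ℝ Z]

lemma HNZ.nn {β : ℝ} {f : V → W} (hf : HNZ β f) : ∃ r > 0, ∃ K, 0 ≤ K ∧
    ∀ x y, ‖x‖ < r → ‖y‖ < r → ‖f x - f y‖ ≤ K * ‖x - y‖ ^ β := by
  obtain ⟨r, hr, K, H⟩ := hf
  refine ⟨r, hr, |K|, abs_nonneg K, fun x y hx hy => (H x y hx hy).trans ?_⟩
  exact mul_le_mul_of_nonneg_right (le_abs_self K) (Real.rpow_nonneg (norm_nonneg _) β)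

lemma HNZ.comp {β γ : ℝ} {g : W → Z} {f : V → W} (hγ : 0 < γ) (hg : HNZ γ g) (hf : HNZ β f)
    (hc : ContinuousAt f 0) (h0 : f 0 = 0) : HNZ (β * γ) (fun x => g (f x)) := by
  obtain ⟨r, hr, K, hK, H⟩ := hf.nn
  obtain ⟨r', hr', K', hK', H'⟩ := hg.nn
  have h1 : ∀ᶠ x in 𝓝 (0 : V), ‖f x‖ < r' := by
    have := hc.norm
    unfold ContinuousAt at this
    simp only at this
    rw [h0, norm_zero] at this
    exact this.eventually_lt_const hr'
  obtain ⟨ρ, hρ, h2⟩ := Metric.eventually_nhds_iff.1 h1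
  simp only [dist_zero_right] at h2
  refine ⟨min r ρ, lt_min hr hρ, K' * K ^ γ, fun x y hx hy => ?_⟩
  have hx1 := lt_min_iff.1 hx
  have hy1 := lt_min_iff.1 hy
  refine (H' _ _ (h2 hx1.2) (h2 hy1.2)).trans ?_
  have h3 := H x y hx1.1 hy1.1
  calc K' * ‖f x - f y‖ ^ γ ≤ K' * (K * ‖x - y‖ ^ β) ^ γ := by gcongr
    _ = K' * K ^ γ * ‖x - y‖ ^ (β * γ) := by
      rw [Real.mul_rpow hK (Real.rpow_nonneg (norm_nonneg _) _), Real.rpow_mul (norm_nonneg _)]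
      ring

lemma hnz_clm (L : V →L[ℝ] W) : HNZ 1 (fun x => L x) :=
  ⟨1, one_pos, ‖L‖, fun x y _ _ => by
    rw [← map_sub, Real.rpow_one]; exact L.le_opNorm _⟩

lemma HNZ.prod {β : ℝ} {f : X1 → Y1} {g : X2 → Y2} (hβ : 0 < β) (hf : HNZ β f) (hg : HNZ β g) :
    HNZ β (fun x : X1 × X2 => (f x.1, g x.2)) := by
  obtain ⟨r, hr, K, hK, H⟩ := hf.nn
  obtain ⟨r', hr', K', hK', H'⟩ := hg.nn
  refine ⟨min r r', lt_min hr hr', max K K', fun x y hx hy => ?_⟩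
  have hx1 := lt_min_iff.1 hx
  have hy1 := lt_min_iff.1 hy
  have a1 := H x.1 y.1 ((norm_fst_le x).trans_lt hx1.1) ((norm_fst_le y).trans_lt hy1.1)
  have a2 := H' x.2 y.2 ((norm_snd_le x).trans_lt hx1.2) ((norm_snd_le y).trans_lt hy1.2)
  rw [Prod.norm_def]
  refine max_le (a1.trans ?_) (a2.trans ?_)
  · have : ‖x.1 - y.1‖ ≤ ‖x - y‖ := norm_fst_le (x - y)
    have hm := le_max_left K K'
    gcongr
  · have : ‖x.2 - y.2‖ ≤ ‖x - y‖ := norm_snd_le (x - y)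
    have hm := le_max_right K K'
    gcongr

/-- some-Hölder homeomorphisms fixing zero -/
structure SH (h : V ≃ₜ W) : Prop where
  zero : h 0 = 0
  hol : ∃ β > 0, HNZ β h ∧ HNZ β h.symm

lemma SH.symm_zero {h : V ≃ₜ W} (S : SH h) : h.symm 0 = 0 := by
  rw [Homeomorph.symm_apply_eq, S.zero]

lemma SH.trans {h : V ≃ₜ W} {g : W ≃ₜ Z} (S : SH h) (S' : SH g) : SH (h.trans g) := by
  obtain ⟨β, hβ, h1, h2⟩ := S.hol
  obtain ⟨γ, hγ, g1, g2⟩ := S'.hol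
  refine ⟨by simp [S.zero, S'.zero], β * γ, mul_pos hβ hγ, ?_, ?_⟩
  · have := HNZ.comp hγ g1 h1 h.continuous.continuousAt S.zero
    exact this
  · rw [mul_comm]
    have := HNZ.comp hβ h2 g2 g.symm.continuous.continuousAt S'.symm_zero
    exact this

lemma sh_clm (L : V ≃L[ℝ] W) : SH L.toHomeomorph :=
  ⟨by simp, 1, one_pos, hnz_clm (L : V →L[ℝ] W), hnz_clm (L.symm : W →L[ℝ] V)⟩

lemma SH.prod {h : X1 ≃ₜ Y1} {g : X2 ≃ₜ Y2} (S : SH h) (S' : SH g) : SH (h.prodCongr g) := by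
  obtain ⟨β, hβ, h1, h2⟩ := S.hol
  obtain ⟨γ, hγ, g1, g2⟩ := S'.hol
  have hm : 0 < min β γ := lt_min hβ hγ
  refine ⟨by ext <;> simp [S.zero, S'.zero], min β γ, hm, ?_, ?_⟩
  · exact HNZ.prod hm (h1.mono hm (min_le_left _ _)) (g1.mono hm (min_le_right _ _))
  · exact HNZ.prod hm (h2.mono hm (min_le_left _ _)) (g2.mono hm (min_le_right _ _))

lemma glue {H1 : X1 ≃ₜ Y1} {H2 : X2 ≃ₜ Y2} (S : SH H1) (S' : SH H2) (e : (X1 × X2) ≃L[ℝ] V)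
    (e' : (Y1 × Y2) ≃L[ℝ] W) : ∃ H : V ≃ₜ W, SH H ∧ ∀ x y, H (e (x, y)) = e' (H1 x, H2 y) := by
  refine ⟨e.symm.toHomeomorph.trans ((H1.prodCongr H2).trans e'.toHomeomorph),
    (sh_clm e.symm).trans ((S.prod S').trans (sh_clm e')), fun x y => ?_⟩
  simp

end Glue

section Hyp
variable {E : Type*} [NormedAddCommGroup E] [NormedSpace ℝ E] [FiniteDimensional ℝ E]
  [CompleteSpace E] {a : E →L[ℝ] E}
variable {F : Type*} [NormedAddCommGroup F] [NormedSpace ℝ F] [FiniteDimensional ℝ F]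
  [CompleteSpace F] {b : F →L[ℝ] F}
variable {h : E ≃ₜ F}

lemma sumEquiv {p q V : Submodule ℝ E} (hd : ∀ x ∈ p, x ∈ q → x = 0) (hV : V = p ⊔ q) :
    ∃ e : (p × q) ≃L[ℝ] V, ∀ z, (e z : E) = z.1 + z.2 := by
  subst hV
  let f : (p × q) →ₗ[ℝ] (p ⊔ q : Submodule ℝ E) :=
    (p.subtype.coprod q.subtype).codRestrict (p ⊔ q) fun z =>
      Submodule.add_mem_sup z.1.2 z.2.2
  have hf : Function.Bijective f := by
    constructor
    · rw [injective_iff_map_eq_zero]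
      rintro ⟨x, y⟩ hz
      have h1 : (x : E) + y = 0 := congrArg Subtype.val hz
      have h2 : (x : E) = -y := eq_neg_of_add_eq_zero_left h1
      have h3 : (x : E) = 0 := hd x x.2 (by rw [h2]; exact q.neg_mem y.2)
      have h4 : (y : E) = 0 := by rw [h3, zero_add] at h1; exact h1
      ext <;> simp [h3, h4]
    · rintro ⟨x, hx⟩
      obtain ⟨y, hy, z, hz, rfl⟩ := Submodule.mem_sup.1 hx
      exact ⟨(⟨y, hy⟩, ⟨z, hz⟩), rfl⟩
  exact ⟨(LinearEquiv.ofBijective f hf).toContinuousLinearEquiv, fun z => rfl⟩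

/-- restricting a some-Hölder orbit equivalence to corresponding stable subspaces -/
lemma OE.stable (O : OE a b h) (S : SH h) (hs : ∀ x, x ∈ stS a ↔ h x ∈ stS b) :
    ∃ H : stS a ≃ₜ stS b, SH H ∧
      ∀ (t : ℝ) (x y : stS a), (y : E) = fl a t x → (H y : F) = fl b t (H x) := by
  have ia : ∀ x ∈ stS a, a x ∈ stS a := fun x hx => stS_inv a a (Commute.refl a) hx
  have ib : ∀ x ∈ stS b, b x ∈ stS b := fun x hx => stS_inv b b (Commute.refl b) hx
  let k : stS a ≃ₜ stS b := h.subtype hs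
  have k1 : ∀ x : stS a, (k x : F) = h x := fun x => rfl
  have k2 : ∀ x : stS b, (k.symm x : E) = h.symm x := fun x => rfl
  obtain ⟨γ, hγ, h1, h2⟩ := S.hol
  obtain ⟨H, H0, H1, H2⟩ := lemG (rs a (stS a) ia) (rs b (stS b) ib)
    (fun x => (rs_st ia x).2 x.2) (fun x => (rs_st ib x).2 x.2) k
    (Subtype.ext (by rw [k1]; exact S.zero))
    (fun t x => by
      obtain ⟨t', ht⟩ := O.orb t x
      exact ⟨t', Subtype.ext (by rw [k1, rs_fl, rs_fl, k1, ht])⟩)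
    (fun t x => by
      obtain ⟨t', ht⟩ := O.orb' t x
      exact ⟨t', Subtype.ext (by rw [k2, rs_fl, rs_fl, k2, ht])⟩) hγ
    (by
      obtain ⟨r, hr, K, hK⟩ := h1
      exact ⟨r, hr, K, fun x y hx hy => hK x y hx hy⟩)
    (by
      obtain ⟨r, hr, K, hK⟩ := h2
      exact ⟨r, hr, K, fun x y hx hy => hK x y hx hy⟩)
  refine ⟨H, ⟨H0, H2⟩, fun t x y hy => ?_⟩
  have : y = fl (rs a (stS a) ia) t x := Subtype.ext (by rw [rs_fl, hy])
  rw [this, H1, rs_fl]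

lemma OE.unstable (O : OE a b h) (S : SH h) (hs : ∀ x, x ∈ unS a ↔ h x ∈ unS b) :
    ∃ H : unS a ≃ₜ unS b, SH H ∧
      ∀ (t : ℝ) (x y : unS a), (y : E) = fl a t x → (H y : F) = fl b t (H x) := by
  have key := O.negl.neg.stable S
  rw [← unS_eq, ← unS_eq] at key
  obtain ⟨H, h1, h2⟩ := key hs
  refine ⟨H, h1, fun t x y hy => ?_⟩
  have := h2 (-t) x y (by rw [fl_neg_gen, neg_neg, hy])
  rwa [fl_neg_gen, neg_neg] at this

theorem OE.hyp (O : OE a b h) (S : SH h) (R : Rsp a b h) {V : Submodule ℝ E} {W : Submodule ℝ F}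
    (hV : V = stS a ⊔ unS a) (hW : W = stS b ⊔ unS b) :
    ∃ H : V ≃ₜ W, SH H ∧
      ∀ (t : ℝ) (x y : V), (y : E) = fl a t x → (H y : F) = fl b t (H x) := by
  obtain ⟨e, he⟩ := sumEquiv (p := stS a) (q := unS a) (fun x => su_zero) hV
  obtain ⟨e', he'⟩ := sumEquiv (p := stS b) (q := unS b) (fun x => su_zero) hW
  obtain ⟨H1, S1, c1⟩ := O.stable S R.s
  obtain ⟨H2, S2, c2⟩ := O.unstable S R.u
  obtain ⟨H, SH', hH⟩ := glue S1 S2 e e'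
  refine ⟨H, SH', fun t x y hy => ?_⟩
  obtain ⟨⟨x1, x2⟩, rfl⟩ := e.surjective x
  have : y = e (⟨fl a t x1, stS_fl a t x1.2⟩, ⟨fl a t x2, unS_fl a t x2.2⟩) := by
    apply Subtype.ext
    rw [hy, he, he, map_add]
  rw [this, hH, hH, he', he']
  simp only [map_add]
  rw [c1 t x1 _ rfl, c2 t x2 _ rfl]

/-- positive rescaling of time on the hyperbolic part -/
theorem rescale (b : F →L[ℝ] F) {c : ℝ} (hc : 0 < c) {W : Submodule ℝ F}
    (hW : W = stS b ⊔ unS b) : ∃ H : W ≃ₜ W, SH H ∧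
      ∀ (t : ℝ) (x y : W), (y : F) = fl b t x → (H y : F) = fl b (c * t) (H x) := by
  have es : stS (c • b) = stS b := by
    ext x
    rw [mem_stS, mem_stS]
    simp only [fl_smul]
    refine ⟨fun h1 => ?_, fun h1 => h1.comp (tendsto_id.const_mul_atTop hc)⟩
    have := h1.comp (tendsto_id.const_mul_atTop (inv_pos.2 hc))
    simpa [Function.comp_def, mul_inv_cancel_left₀ hc.ne'] using this
  have eu : unS (c • b) = unS b := by
    ext x
    rw [mem_unS, mem_unS]
    simp only [fl_smul]
    refine ⟨fun h1 => ?_, fun h1 => h1.comp (tendsto_id.const_mul_atBot hc)⟩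
    have := h1.comp (tendsto_id.const_mul_atBot (inv_pos.2 hc))
    simpa [Function.comp_def, mul_inv_cancel_left₀ hc.ne'] using this
  have O : OE b (c • b) (Homeomorph.refl F) := by
    refine ⟨rfl, fun t x => ⟨c⁻¹ * t, ?_⟩, fun t x => ⟨c * t, ?_⟩⟩
    · rw [fl_smul, mul_inv_cancel_left₀ hc.ne']; rfl
    · rw [fl_smul]; rfl
  have S : SH (Homeomorph.refl F) := sh_clm (ContinuousLinearEquiv.refl ℝ F)
  have R : Rsp b (c • b) (Homeomorph.refl F) := ⟨fun x => by rw [es]; rfl, fun x => by rw [eu]; rfl⟩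
  obtain ⟨H, h1, h2⟩ := O.hyp S R hW (W := W) (by rw [es, eu]; exact hW)
  refine ⟨H, h1, fun t x y hy => ?_⟩
  rw [h2 t x y hy, fl_smul]

end Hyp


section Final
variable {d : ℕ}

lemma hnz_of_holder {β : ℝ} {f : Euc d → Euc d} : HolderNearZero β f ↔ HNZ β f := by
  constructor
  · rintro ⟨r, hr, K, H⟩
    refine ⟨r, hr, K, fun x y hx hy => ?_⟩
    have := H x (by simpa using hx) y (by simpa using hy)
    rwa [dist_eq_norm, dist_eq_norm] at this
  · rintro ⟨r, hr, K, H⟩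
    refine ⟨r, hr, K, fun x hx y hy => ?_⟩
    have := H x y (by simpa using hx) (by simpa using hy)
    rwa [dist_eq_norm, dist_eq_norm]

lemma hnz_of_holderS {V W : Submodule ℝ (Euc d)} {β : ℝ} {f : V → W} :
    HolderNearZeroS β f ↔ HNZ β f := by
  constructor
  · rintro ⟨r, hr, K, H⟩
    refine ⟨r, hr, K, fun x y hx hy => ?_⟩
    have := H x y (by rwa [dist_zero_right]) (by rwa [dist_zero_right])
    rwa [dist_eq_norm, dist_eq_norm] at this
  · rintro ⟨r, hr, K, H⟩
    refine ⟨r, hr, K, fun x y hx hy => ?_⟩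
    rw [dist_zero_right] at hx hy
    have := H x y hx hy
    rwa [dist_eq_norm, dist_eq_norm]

lemma oe_iff {A B : Matrix (Fin d) (Fin d) ℝ} {h : Euc d ≃ₜ Euc d} (h0 : h 0 = 0) :
    IsOrbitEquiv A B h ↔ OE (mcl A) (mcl B) h := by
  constructor
  · intro H
    refine ⟨h0, fun t x => ?_, fun t y => ?_⟩
    · have : h (linFlow A t x) ∈ flowOrbit B (h x) := by
        rw [← H x]; exact ⟨_, ⟨t, rfl⟩, rfl⟩
      obtain ⟨t', ht⟩ := this
      simp only [linFlow_eq] at ht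
      exact ⟨t', ht.symm⟩
    · have : linFlow B t y ∈ h '' flowOrbit A (h.symm y) := by
        rw [H, h.apply_symm_apply]; exact ⟨t, rfl⟩
      obtain ⟨z, ⟨t', rfl⟩, ht⟩ := this
      simp only [linFlow_eq] at ht
      exact ⟨t', by rw [← ht, h.symm_apply_apply]⟩
  · intro O x
    ext z
    constructor
    · rintro ⟨w, ⟨t, rfl⟩, rfl⟩
      obtain ⟨t', ht⟩ := O.orb t x
      exact ⟨t', by simp only [linFlow_eq]; exact ht.symm⟩
    · rintro ⟨t, rfl⟩
      obtain ⟨t', ht⟩ := O.orb' t (h x)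
      rw [h.symm_apply_apply, Homeomorph.symm_apply_eq] at ht
      exact ⟨_, ⟨t', rfl⟩, by simp only [linFlow_eq]; exact ht.symm⟩

lemma XH_fl (A : Matrix (Fin d) (Fin d) ℝ) (t : ℝ) (x : Euc d) (hx : x ∈ XH A) :
    linFlow A t x ∈ XH A := by
  rw [XH_eq] at *
  obtain ⟨y, hy, z, hz, rfl⟩ := Submodule.mem_sup.1 hx
  rw [linFlow_eq, map_add]
  exact Submodule.add_mem_sup (stS_fl _ t hy) (unS_fl _ t hz)

lemma XC_fl (A : Matrix (Fin d) (Fin d) ℝ) (t : ℝ) (x : Euc d) (hx : x ∈ XC A) :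
    linFlow A t x ∈ XC A := by
  rw [XC_eq] at *
  rw [linFlow_eq]
  exact ceS_fl _ t hx

lemma conj_of_gen {V W : Type*} [NormedAddCommGroup V] [NormedSpace ℝ V] [FiniteDimensional ℝ V]
    [CompleteSpace V] [NormedAddCommGroup W] [NormedSpace ℝ W] [FiniteDimensional ℝ W]
    [CompleteSpace W] {a : V →L[ℝ] V} {b : W →L[ℝ] W} {c : ℝ} (Q : V ≃ₗ[ℝ] W)
    (hQ : ∀ x, Q (a x) = c • b (Q x)) (t : ℝ) (x : V) : Q (fl a t x) = fl b (c * t) (Q x) := by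
  have := fl_unique (c • b) (fun t => Q (fl a t x)) (fun t => ?_) t
  · rw [← fl_smul]; simpa using this
  · have h1 := Q.toContinuousLinearEquiv.toContinuousLinearMap.hasFDerivAt.comp_hasDerivAt t
      (hasDerivAt_fl a t x)
    refine h1.congr_deriv ?_
    exact hQ _

lemma central_forward {a b : Euc d →L[ℝ] Euc d} {h : Euc d ≃ₜ Euc d} (O : OE a b h)
    {V W : Submodule ℝ (Euc d)} (hV : V = ceS a) (hW : W = ceS b) :
    ∃ c : ℝ, c ≠ 0 ∧ ∃ Q : V ≃ₗ[ℝ] W, ∀ (t : ℝ) (x y : V), (y : Euc d) = fl a t x →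
      (Q y : Euc d) = fl b (c * t) (Q x) := by
  subst hV hW
  obtain ⟨c, hc, Q, hQ⟩ := O.central
  refine ⟨c, hc, Q, fun t x y hy => ?_⟩
  have : y = fl (ra a) t x := Subtype.ext (by rw [rs_fl, hy])
  rw [this, conj_of_gen Q hQ, rs_fl]

lemma central_rev {a : Euc d →L[ℝ] Euc d} {V : Submodule ℝ (Euc d)} (hV : V = ceS a) :
    ∃ Q : V ≃ₗ[ℝ] V, ∀ (t : ℝ) (x y : V), (y : Euc d) = fl a t x →
      (Q y : Euc d) = fl a (-t) (Q x) := by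
  subst hV
  obtain ⟨s, n, H⟩ := exists_Cen (ra a) (ra_ce a)
  obtain ⟨R, hR⟩ := neg_sim H
  refine ⟨R, fun t x y hy => ?_⟩
  have : y = fl (ra a) t x := Subtype.ext (by rw [rs_fl, hy])
  rw [this, conj_of_gen (b := ra a) (c := -1) R (fun x => by rw [hR, neg_smul, one_smul]), rs_fl,
    neg_one_mul]

lemma hc_equiv (a : Euc d →L[ℝ] Euc d) {V W : Submodule ℝ (Euc d)} (hV : V = stS a ⊔ unS a)
    (hW : W = ceS a) : ∃ e : (V × W) ≃L[ℝ] Euc d, ∀ z, e z = (z.1 : Euc d) + z.2 := by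
  subst hV hW
  have hd : ∀ x ∈ stS a ⊔ unS a, x ∈ ceS a → x = 0 := fun x hx hx' => by
    obtain ⟨y, hy, z, hz, h⟩ := Submodule.mem_sup.1 hx
    exact indep_ce a hx' hy hz h.symm
  have ht : (⊤ : Submodule ℝ (Euc d)) = (stS a ⊔ unS a) ⊔ ceS a := by
    symm
    rw [eq_top_iff]
    intro x _
    obtain ⟨u, hu, c, hc, v, hv, rfl⟩ := decomp a x
    have : u + c + v = (u + v) + c := by abel
    rw [this]
    exact Submodule.add_mem_sup (Submodule.add_mem_sup hu hv) hc
  obtain ⟨e, he⟩ := sumEquiv hd ht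
  refine ⟨e.trans (LinearEquiv.ofTop (⊤ : Submodule ℝ (Euc d)) rfl).toContinuousLinearEquiv,
    fun z => ?_⟩
  rw [← he]; rfl

lemma backward {A B : Matrix (Fin d) (Fin d) ℝ} (h : XH A ≃ₜ XH B) (S : SH h) {α α' : ℝ}
    (hα : α ≠ 0) (hα' : α' ≠ 0) (Q : XC A ≃ₗ[ℝ] XC B)
    (hh : ∀ (t : ℝ) (x y : XH A), (y : Euc d) = fl (mcl A) t x →
      (h y : Euc d) = fl (mcl B) (α * t) (h x))
    (hQ : ∀ (t : ℝ) (x y : XC A), (y : Euc d) = fl (mcl A) t x →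
      (Q y : Euc d) = fl (mcl B) (α' * t) (Q x)) (hp : 0 < α' / α) :
    RelEquivWith MemH0plus A B := by
  obtain ⟨g, Sg, hg⟩ := rescale (mcl B) hp (XH_eq B)
  obtain ⟨e, he⟩ := hc_equiv (mcl A) (XH_eq A) (XC_eq A)
  obtain ⟨e', he'⟩ := hc_equiv (mcl B) (XH_eq B) (XC_eq B)
  obtain ⟨k, Sk, hk⟩ := glue (S.trans Sg) (sh_clm Q.toContinuousLinearEquiv) e e'
  have hconj : ∀ t x, k (fl (mcl A) t x) = fl (mcl B) (α' * t) (k x) := by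
    intro t x
    obtain ⟨⟨x1, x2⟩, rfl⟩ := e.surjective x
    have h1 := XH_fl A t x1 x1.2
    have h2 := XC_fl A t x2 x2.2
    rw [linFlow_eq] at h1 h2
    have e1 : fl (mcl A) t (e (x1, x2)) = e (⟨_, h1⟩, ⟨_, h2⟩) := by
      rw [he, he, map_add]
    rw [e1, hk, hk, he', he', map_add]
    congr 1
    · have := hg (α * t) (h x1) (h ⟨_, h1⟩) (hh t x1 ⟨_, h1⟩ rfl)
      have e2 : α' / α * (α * t) = α' * t := by field_simp
      rw [e2] at this
      exact this
    · exact hQ t x2 ⟨_, h2⟩ rfl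
  obtain ⟨β, hβ, k1, k2⟩ := Sk.hol
  refine ⟨k, ⟨β, hβ, Sk.zero, hnz_of_holder.2 k1, hnz_of_holder.2 k2⟩, (oe_iff Sk.zero).2 ?_⟩
  refine ⟨Sk.zero, fun t x => ⟨_, hconj t x⟩, fun t y => ⟨α'⁻¹ * t, ?_⟩⟩
  rw [Homeomorph.symm_apply_eq, hconj, k.apply_symm_apply, mul_inv_cancel_left₀ hα']

end Final

/-- **Corollary 6.3**: `Φ ~^{0⁺} Ψ` iff the hyperbolic parts are some-Hölder flow
equivalent and the central parts are linearly flow equivalent. -/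
theorem someHolder_iff_hyperbolic_and_central {d : ℕ} (A B : Matrix (Fin d) (Fin d) ℝ) :
    RelEquivWith MemH0plus A B ↔
      ((∃ (hA : ∀ t : ℝ, ∀ x ∈ XH A, linFlow A t x ∈ XH A)
          (h : ↥(XH A) ≃ₜ ↥(XH B)) (α : ℝ), α ≠ 0 ∧ h 0 = 0 ∧
          (∃ β > (0 : ℝ), HolderNearZeroS β ⇑h ∧ HolderNearZeroS β ⇑h.symm) ∧
          ∀ (t : ℝ) (x : ↥(XH A)),
            (h ⟨linFlow A t ↑x, hA t ↑x x.2⟩ : Euc d) = linFlow B (α * t) ↑(h x)) ∧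
        (∃ (hA : ∀ t : ℝ, ∀ x ∈ XC A, linFlow A t x ∈ XC A)
          (Q : ↥(XC A) ≃ₗ[ℝ] ↥(XC B)) (α' : ℝ), α' ≠ 0 ∧
          ∀ (t : ℝ) (x : ↥(XC A)),
            (Q ⟨linFlow A t ↑x, hA t ↑x x.2⟩ : Euc d) = linFlow B (α' * t) ↑(Q x))) := by
  constructor
  · rintro ⟨h, ⟨γ, hγ, h0, h1, h2⟩, H⟩
    have O := (oe_iff h0).1 H
    have S : SH h := ⟨h0, γ, hγ, hnz_of_holder.1 h1, hnz_of_holder.1 h2⟩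
    constructor
    · rcases O.dich with R | R
      · obtain ⟨k, ⟨k0, β, hβ, k1, k2⟩, hk⟩ := O.hyp S R (XH_eq A) (XH_eq B)
        refine ⟨XH_fl A, k, 1, one_ne_zero, k0,
          ⟨β, hβ, hnz_of_holderS.2 k1, hnz_of_holderS.2 k2⟩, fun t x => ?_⟩
        rw [hk t x _ (linFlow_eq A t x), linFlow_eq, one_mul]
      · obtain ⟨k, ⟨k0, β, hβ, k1, k2⟩, hk⟩ := O.neg.hyp S R (XH_eq A) (W := XH B)
          (by rw [XH_eq, ← unS_eq, ← stS_eq, sup_comm])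
        refine ⟨XH_fl A, k, -1, by norm_num, k0,
          ⟨β, hβ, hnz_of_holderS.2 k1, hnz_of_holderS.2 k2⟩, fun t x => ?_⟩
        rw [hk t x _ (linFlow_eq A t x), linFlow_eq, fl_neg_gen, neg_one_mul]
    · obtain ⟨c, hc, Q, hQ⟩ := central_forward O (XC_eq A) (XC_eq B)
      refine ⟨XC_fl A, Q, c, hc, fun t x => ?_⟩
      rw [hQ t x _ (linFlow_eq A t x), linFlow_eq]
  · rintro ⟨⟨hA, h, α, hα, h0, ⟨β, hβ, h1, h2⟩, hh⟩, hA', Q, α', hα', hQ⟩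
    have S : SH h := ⟨h0, β, hβ, hnz_of_holderS.1 h1, hnz_of_holderS.1 h2⟩
    have hh' : ∀ (t : ℝ) (x y : XH A), (y : Euc d) = fl (mcl A) t x →
        (h y : Euc d) = fl (mcl B) (α * t) (h x) := by
      intro t x y hy
      rw [← linFlow_eq] at hy ⊢
      rw [← hh]
      congr 2
      exact Subtype.ext hy
    have hQ' : ∀ (t : ℝ) (x y : XC A), (y : Euc d) = fl (mcl A) t x →
        (Q y : Euc d) = fl (mcl B) (α' * t) (Q x) := by
      intro t x y hy
      rw [← linFlow_eq] at hy ⊢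
      rw [← hQ]
      congr 2
      exact Subtype.ext hy
    rcases lt_or_gt_of_ne (div_ne_zero hα' hα) with hn | hp
    · obtain ⟨R, hR⟩ := central_rev (XC_eq A)
      refine backward h S hα (α' := -α') (neg_ne_zero.2 hα') (R.trans Q) hh' ?_
        (by rw [neg_div]; linarith)
      intro t x y hy
      have := hQ' (-t) (R x) (R y) (hR t x y hy)
      rw [neg_mul, ← mul_neg]
      exact this
    · exact backward h S hα hα' Q hh' hQ' hp

end LF
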